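/- arXiv:2408.04346 — 2 statements merged into one kernel-verified Lean document; each statement's English description precedes it below -/
import Mathlib

section
/- Let n ≥ 3, p ≥ 2 real, q = p/(p−1), and let f be a C^d function in some neighbourhood of S_p^{n−1} in ℝⁿ with μ_{p,n}-mean zero. Then for every t ≥ 0, μ_{p,n}(|f| ≥ t) ≤ 2 exp( −C_{p,d} n · min( min_{k=1,…,d−1} (t/‖f^{(k)}‖_{op(q),q})^{p/k}, (t/‖f^{(d)}‖_{op(q),∞})^{p/d} ) ), where C_{p,d} = log(2)^p / (3^{p−1} 4^{2p−1} p² (p−1)^{p−1} d^p e^p) and the norms ‖·‖_{op(q),r} are taken with respect to μ_{p,n}. -/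
open MeasureTheory Real

/-- The `ℓ_p`-norm on `ℝⁿ`. -/
noncomputable def lpNorm (p : ℝ) {n : ℕ} (x : Fin n → ℝ) : ℝ :=
  (∑ i, |x i| ^ p) ^ (1 / p)

/-- The cone probability measure `μ_{p,n}` on the `ℓ_p`-sphere: the pushforward of the
normalized Lebesgue measure on the `ℓ_p`-unit ball under radial projection `x ↦ x/|x|_p`. -/
noncomputable def coneMeasure (p : ℝ) (n : ℕ) : Measure (Fin n → ℝ) :=
  Measure.map (fun x => (lpNorm p x)⁻¹ • x)
    ((volume {x : Fin n → ℝ | lpNorm p x ≤ 1})⁻¹ •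
      volume.restrict {x : Fin n → ℝ | lpNorm p x ≤ 1})

/-- The entropy functional `Ent_μ(g) = ∫ g log g dμ - (∫ g dμ) log(∫ g dμ)`. -/
noncomputable def entropy {α : Type*} [MeasurableSpace α] (μ : Measure α) (g : α → ℝ) : ℝ :=
  (∫ x, g x * Real.log (g x) ∂μ) - (∫ x, g x ∂μ) * Real.log (∫ x, g x ∂μ)

/-- The operator-type norm `|T|_{op(q)}` of a `k`-linear form on `ℝⁿ`: the supremum of
`T[v₁,…,v_k]` over vectors of `ℓ_p`-norm one (`q = p/(p-1)`). -/
noncomputable def opNormQ (p : ℝ) {n k : ℕ}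
    (T : ContinuousMultilinearMap ℝ (fun _ : Fin k => (Fin n → ℝ)) ℝ) : ℝ :=
  sSup {y | ∃ v : Fin k → Fin n → ℝ, (∀ i, lpNorm p (v i) = 1) ∧ y = T v}

/-- The norm `‖f^{(k)}‖_{op(q),q} = (∫ |f^{(k)}|_{op(q)}^q dμ)^{1/q}`. -/
noncomputable def opNormLq {n : ℕ} (μ : Measure (Fin n → ℝ)) (p q : ℝ) (k : ℕ)
    (f : (Fin n → ℝ) → ℝ) : ℝ :=
  (∫ x, opNormQ p (iteratedFDeriv ℝ k f x) ^ q ∂μ) ^ (1 / q)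

/-- The norm `‖f^{(k)}‖_{op(q),∞}`, the essential supremum of `|f^{(k)}|_{op(q)}`. -/
noncomputable def opNormLinfty {n : ℕ} (μ : Measure (Fin n → ℝ)) (p : ℝ) (k : ℕ)
    (f : (Fin n → ℝ) → ℝ) : ℝ :=
  essSup (fun x => opNormQ p (iteratedFDeriv ℝ k f x)) μ


open Pointwise in
/-- One-dimensional Brunn-Minkowski for midpoints. -/
theorem bm_one_aux (A B M : Set ℝ) (hA : IsCompact A) (hB : IsCompact B)
    (hAn : A.Nonempty) (hBn : B.Nonempty)
    (h : ∀ a ∈ A, ∀ b ∈ B, (a + b) / 2 ∈ M) :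
    volume A + volume B ≤ 2 * volume M := by
  obtain ⟨α, hα, hαm⟩ := hA.exists_isGreatest hAn
  obtain ⟨β, hβ, hβm⟩ := hB.exists_isLeast hBn
  have h2 : 2 * volume M = volume ((2:ℝ) • M) := by
    rw [Measure.addHaar_smul]; simp
  rw [h2]
  have hsub : ((fun x => β + x) '' A) ∪ ((fun x => α + x) '' B) ⊆ (2:ℝ) • M := by
    rintro x (⟨a, ha, rfl⟩ | ⟨b, hb, rfl⟩)
    · exact ⟨(a + β)/2, h a ha β hβ, by simp; ring⟩
    · exact ⟨(α + b)/2, h α hα b hb, by simp; ring⟩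
  refine le_trans (le_of_eq ?_) (measure_mono hsub)
  rw [measure_union₀]
  · simp only [Set.image_add_left, measure_preimage_add]
  · have : IsCompact ((fun x => α + x) '' B) := hB.image (by fun_prop)
    exact this.measurableSet.nullMeasurableSet
  · refine measure_mono_null (t := {α + β}) ?_ (by simp)
    rintro x ⟨⟨a, ha, rfl⟩, ⟨b, hb, hx⟩⟩
    have := hαm ha
    have := hβm hb
    simp only at hx
    simp; linarith

theorem bm_one (A B M : Set ℝ) (hA : MeasurableSet A) (hB : MeasurableSet B)
    (hAn : A.Nonempty) (hBn : B.Nonempty)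
    (h : ∀ a ∈ A, ∀ b ∈ B, (a + b) / 2 ∈ M) :
    volume A + volume B ≤ 2 * volume M := by
  obtain ⟨a0, ha0⟩ := hAn
  obtain ⟨b0, hb0⟩ := hBn
  have key : ∀ K ⊆ A, IsCompact K → ∀ L ⊆ B, IsCompact L → volume K + volume L ≤ 2 * volume M := by
    intro K hK hKc L hL hLc
    refine le_trans (add_le_add (measure_mono (Set.subset_insert a0 K))
      (measure_mono (Set.subset_insert b0 L))) ?_
    apply bm_one_aux _ _ _ (hKc.insert a0) (hLc.insert b0) (by simp) (by simp)
    intro a ha b hb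
    exact h a (Set.insert_subset ha0 hK ha) b (Set.insert_subset hb0 hL hb)
  have hs : ∀ S : Set ℝ, MeasurableSet S →
      volume S = ⨆ K : {K : Set ℝ // K ⊆ S ∧ IsCompact K}, volume K.1 := by
    intro S hS
    rw [hS.measure_eq_iSup_isCompact, iSup_subtype]
    simp only [iSup_and]
  rw [hs A hA, hs B hB]
  have : Nonempty {K : Set ℝ // K ⊆ A ∧ IsCompact K} := ⟨⟨∅, by simp, by simp⟩⟩
  have : Nonempty {K : Set ℝ // K ⊆ B ∧ IsCompact K} := ⟨⟨∅, by simp, by simp⟩⟩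
  apply ENNReal.iSup_add_iSup_le
  rintro ⟨K, hK, hKc⟩ ⟨L, hL, hLc⟩
  exact key K hK hKc L hL hLc

theorem ennreal_amgm (x y z : ENNReal) (h : x + y ≤ 2 * z) : x * y ≤ z ^ 2 := by
  by_cases hz : z = ⊤
  · simp [hz]
  have h2 : 2 * z ≠ ⊤ := ENNReal.mul_ne_top (by simp) hz
  have hx : x ≠ ⊤ := ne_top_of_le_ne_top h2 (le_trans le_self_add h)
  have hy : y ≠ ⊤ := ne_top_of_le_ne_top h2 (le_trans le_add_self h)
  lift x to NNReal using hx
  lift y to NNReal using hy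
  lift z to NNReal using hz
  have h' : (x:ℝ) + y ≤ 2 * z := by exact_mod_cast h
  have : (x:ℝ) * y ≤ z ^ 2 := by
    have h1 := x.2
    have h2 := y.2
    have h3 : ((x:ℝ)+y)^2 ≤ (2*z)^2 := by gcongr
    nlinarith [sq_nonneg ((x:ℝ)-y)]
  exact_mod_cast this

/-- One-dimensional Prékopa–Leindler, normalized version. -/
theorem pl_one_norm (f g h : ℝ → ℝ) (hf : Measurable f) (hg : Measurable g) (hh : Measurable h)
    (hf0 : ∀ x, 0 ≤ f x) (hg0 : ∀ x, 0 ≤ g x) (hh0 : ∀ x, 0 ≤ h x)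
    (hf1 : ∀ x, f x ≤ 1) (hg1 : ∀ x, g x ≤ 1)
    (hfs : ∀ s < 1, ∃ x, s < f x) (hgs : ∀ s < 1, ∃ x, s < g x)
    (H : ∀ x y, f x * g y ≤ h ((x + y) / 2) ^ 2) :
    (∫⁻ x, ENNReal.ofReal (f x)) * (∫⁻ x, ENNReal.ofReal (g x)) ≤
      (∫⁻ x, ENNReal.ofReal (h x)) ^ 2 := by
  apply ennreal_amgm
  rw [lintegral_eq_lintegral_meas_lt _ (Filter.Eventually.of_forall hf0) hf.aemeasurable,
    lintegral_eq_lintegral_meas_lt _ (Filter.Eventually.of_forall hg0) hg.aemeasurable,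
    lintegral_eq_lintegral_meas_lt _ (Filter.Eventually.of_forall hh0) hh.aemeasurable]
  have hanti : ∀ u : ℝ → ℝ, Antitone fun t => volume {a : ℝ | t < u a} := by
    intro u s t hst
    exact measure_mono fun x hx => lt_of_le_of_lt hst hx
  rw [← lintegral_add_left (hanti f).measurable, ← lintegral_const_mul _ (hanti h).measurable]
  apply setLIntegral_mono ((hanti h).measurable.const_mul _)
  intro s hs
  have hs : 0 < s := hs
  by_cases hs1 : s < 1
  · apply bm_one _ _ _ (measurableSet_lt measurable_const hf)
      (measurableSet_lt measurable_const hg) (hfs s hs1) (hgs s hs1)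
    intro a ha b hb
    simp only [Set.mem_ofPred_eq] at ha hb ⊢
    have h1 := H a b
    have h2 : s * s < f a * g b := mul_lt_mul'' ha hb hs.le hs.le
    by_contra hcon
    push Not at hcon
    have := hh0 ((a+b)/2)
    nlinarith
  · have e1 : {a | s < f a} = ∅ := by
      ext x; simp; linarith [hf1 x]
    have e2 : {a | s < g a} = ∅ := by
      ext x; simp; linarith [hg1 x]
    simp [e1, e2]

theorem pl_one_bdd (f g h : ℝ → ℝ) (hf : Measurable f) (hg : Measurable g) (hh : Measurable h)
    (hf0 : ∀ x, 0 ≤ f x) (hg0 : ∀ x, 0 ≤ g x) (hh0 : ∀ x, 0 ≤ h x) (N : ℝ)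
    (hf1 : ∀ x, f x ≤ N) (hg1 : ∀ x, g x ≤ N)
    (H : ∀ x y, f x * g y ≤ h ((x + y) / 2) ^ 2) :
    (∫⁻ x, ENNReal.ofReal (f x)) * (∫⁻ x, ENNReal.ofReal (g x)) ≤
      (∫⁻ x, ENNReal.ofReal (h x)) ^ 2 := by
  have bf : BddAbove (Set.range f) := ⟨N, by rintro _ ⟨x, rfl⟩; exact hf1 x⟩
  have bg : BddAbove (Set.range g) := ⟨N, by rintro _ ⟨x, rfl⟩; exact hg1 x⟩
  set a := ⨆ x, f x with ha
  set b := ⨆ x, g x with hb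
  have fa : ∀ x, f x ≤ a := fun x => le_ciSup bf x
  have gb : ∀ x, g x ≤ b := fun x => le_ciSup bg x
  rcases (le_trans (hf0 0) (fa 0)).eq_or_lt with ha0 | ha0
  · have : ∀ x, f x = 0 := fun x => le_antisymm (ha0 ▸ fa x) (hf0 x)
    simp [this]
  rcases (le_trans (hg0 0) (gb 0)).eq_or_lt with hb0 | hb0
  · have : ∀ x, g x = 0 := fun x => le_antisymm (hb0 ▸ gb x) (hg0 x)
    simp [this]
  set c := Real.sqrt (a * b) with hc
  have hc0 : 0 < c := Real.sqrt_pos.2 (mul_pos ha0 hb0)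
  have hcc : c ^ 2 = a * b := Real.sq_sqrt (mul_pos ha0 hb0).le
  have key := pl_one_norm (fun x => f x / a) (fun x => g x / b) (fun x => h x / c)
    (hf.div_const _) (hg.div_const _) (hh.div_const _)
    (fun x => div_nonneg (hf0 x) ha0.le) (fun x => div_nonneg (hg0 x) hb0.le)
    (fun x => div_nonneg (hh0 x) hc0.le)
    (fun x => (div_le_one ha0).2 (fa x)) (fun x => (div_le_one hb0).2 (gb x))
    (fun s hs => by
      have : s * a < a := by nlinarith
      obtain ⟨x, hx⟩ := exists_lt_of_lt_ciSup this
      exact ⟨x, (lt_div_iff₀ ha0).2 hx⟩)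
    (fun s hs => by
      have : s * b < b := by nlinarith
      obtain ⟨x, hx⟩ := exists_lt_of_lt_ciSup this
      exact ⟨x, (lt_div_iff₀ hb0).2 hx⟩)
    (fun x y => by
      rw [div_pow, hcc, div_mul_div_comm]
      gcongr
      exact H x y)
  have sc : ∀ (u : ℝ → ℝ) (e : ℝ), 0 < e → Measurable u →
      ∫⁻ x, ENNReal.ofReal (u x) = ENNReal.ofReal e * ∫⁻ x, ENNReal.ofReal (u x / e) := by
    intro u e he hu
    rw [← lintegral_const_mul _ (by fun_prop)]
    congr 1; ext x
    rw [← ENNReal.ofReal_mul he.le]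
    congr 1; field_simp
  rw [sc f a ha0 hf, sc g b hb0 hg, sc h c hc0 hh, mul_pow, mul_mul_mul_comm,
    ← ENNReal.ofReal_mul ha0.le, ← ENNReal.ofReal_pow hc0.le, hcc]
  gcongr

theorem pl_one (f g h : ℝ → ENNReal) (hf : Measurable f) (hg : Measurable g) (hh : Measurable h)
    (H : ∀ x y, f x * g y ≤ h ((x + y) / 2) ^ 2) :
    (∫⁻ x, f x) * (∫⁻ x, g x) ≤ (∫⁻ x, h x) ^ 2 := by
  have tr : ∀ u : ℝ → ENNReal, Measurable u →
      ∫⁻ x, u x = ⨆ N : ℕ, ∫⁻ x, min (u x) N := by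
    intro u hu
    rw [← lintegral_iSup]
    · congr 1; ext x
      rw [← inf_iSup_eq, ENNReal.iSup_natCast]; simp
    · intro N; exact hu.min measurable_const
    · intro N M hNM x
      exact min_le_min le_rfl (by exact_mod_cast hNM)
  have mono : ∀ u : ℝ → ENNReal, Monotone fun N : ℕ => ∫⁻ x, min (u x) N := by
    intro u N M hNM
    exact lintegral_mono fun x => min_le_min le_rfl (by exact_mod_cast hNM)
  rw [tr f hf, tr g hg, ENNReal.iSup_mul]
  apply iSup_le
  intro N₁
  rw [ENNReal.mul_iSup]
  apply iSup_le
  intro N₂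
  set N := max N₁ N₂
  refine le_trans (mul_le_mul' (mono f (le_max_left N₁ N₂)) (mono g (le_max_right N₁ N₂))) ?_
  have hle : ∫⁻ x, min (h x) N ≤ ∫⁻ x, h x := lintegral_mono fun x => min_le_left _ _
  refine le_trans ?_ (pow_le_pow_left₀ zero_le hle 2)
  have ne : ∀ (u : ℝ → ENNReal) x, min (u x) (N:ENNReal) ≠ ⊤ := fun u x =>
    ne_top_of_le_ne_top (ENNReal.natCast_ne_top N) (min_le_right _ _)
  have e : ∀ (u : ℝ → ENNReal) x, min (u x) (N:ENNReal) = ENNReal.ofReal (min (u x) (N:ENNReal)).toReal :=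
    fun u x => (ENNReal.ofReal_toReal (ne u x)).symm
  have bd : ∀ (u : ℝ → ENNReal) x, (min (u x) (N:ENNReal)).toReal ≤ N := fun u x => by
    have := ENNReal.toReal_mono (ENNReal.natCast_ne_top N) (min_le_right (u x) N)
    simpa using this
  change (∫⁻ x, min (f x) (N:ENNReal)) * (∫⁻ x, min (g x) (N:ENNReal)) ≤ _
  rw [lintegral_congr (e f), lintegral_congr (e g), lintegral_congr (e h)]
  apply pl_one_bdd _ _ _ (hf.min measurable_const).ennreal_toReal (hg.min measurable_const).ennreal_toReal
    (hh.min measurable_const).ennreal_toReal (fun _ => ENNReal.toReal_nonneg)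
    (fun _ => ENNReal.toReal_nonneg) (fun _ => ENNReal.toReal_nonneg) N (bd f) (bd g)
  intro x y
  rw [← ENNReal.toReal_mul, ← ENNReal.toReal_pow]
  apply ENNReal.toReal_mono (ENNReal.pow_ne_top (ne h _))
  rcases min_cases (h ((x+y)/2)) (N:ENNReal) with ⟨h1, _⟩ | ⟨h1, _⟩
  · rw [h1]
    exact le_trans (mul_le_mul' (min_le_left _ _) (min_le_left _ _)) (H x y)
  · rw [h1, sq]
    exact mul_le_mul' (min_le_right _ _) (min_le_right _ _)

theorem pl_n : ∀ (n : ℕ) (f g h : (Fin n → ℝ) → ENNReal), Measurable f → Measurable g →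
    Measurable h → (∀ x y, f x * g y ≤ h ((1/2 : ℝ) • (x + y)) ^ 2) →
    (∫⁻ x, f x) * (∫⁻ x, g x) ≤ (∫⁻ x, h x) ^ 2 := by
  intro n
  induction n with
  | zero =>
    intro f g h hf hg hh H
    have := H 0 0
    have e : ∀ u : (Fin 0 → ℝ) → ENNReal, ∫⁻ x, u x = u 0 := by
      intro u
      rw [lintegral_unique, volume_pi, Measure.pi_of_empty]
      rw [measure_univ, mul_one]
      congr 1
      exact Subsingleton.elim _ _
    rw [e, e, e]
    simpa using this
  | succ n ih =>
    intro f g h hf hg hh H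
    let E := (MeasurableEquiv.piFinSuccAbove (fun _ : Fin (n+1) => ℝ) 0)
    have tr : ∀ u : (Fin (n+1) → ℝ) → ENNReal, Measurable u →
        ∫⁻ x, u x = ∫⁻ s : ℝ, ∫⁻ z : Fin n → ℝ, u (E.symm (s, z)) := by
      intro u hu
      have h1 := (volume_preserving_piFinSuccAbove (fun _ : Fin (n+1) => ℝ) 0).symm
      rw [← h1.lintegral_comp hu, Measure.volume_eq_prod, lintegral_prod]
      exact (hu.comp E.symm.measurable).aemeasurable
    have ms : ∀ u : (Fin (n+1) → ℝ) → ENNReal, Measurable u →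
        Measurable fun s : ℝ => ∫⁻ z : Fin n → ℝ, u (E.symm (s, z)) := by
      intro u hu
      exact (hu.comp E.symm.measurable).lintegral_prod_right'
    have mz : ∀ u : (Fin (n+1) → ℝ) → ENNReal, Measurable u → ∀ s : ℝ,
        Measurable fun z : Fin n → ℝ => u (E.symm (s, z)) := by
      intro u hu s
      exact (hu.comp E.symm.measurable).comp measurable_prodMk_left
    rw [tr f hf, tr g hg, tr h hh]
    apply pl_one _ _ _ (ms f hf) (ms g hg) (ms h hh)
    intro s s'
    apply ih _ _ _ (mz f hf s) (mz g hg s') (mz h hh _)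
    intro x y
    refine le_trans (H _ _) (le_of_eq ?_)
    congr 2
    ext i
    refine Fin.cases ?_ (fun j => ?_) i
    · simp [E, MeasurableEquiv.piFinSuccAbove, Fin.insertNthEquiv]; ring
    · simp [E, MeasurableEquiv.piFinSuccAbove, Fin.insertNthEquiv]; ring

/-- Multiplicative Brunn–Minkowski for midpoints. -/
theorem bm_n (n : ℕ) (A B M : Set (Fin n → ℝ)) (hA : MeasurableSet A) (hB : MeasurableSet B)
    (hM : MeasurableSet M) (h : ∀ a ∈ A, ∀ b ∈ B, (1/2 : ℝ) • (a + b) ∈ M) :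
    volume A * volume B ≤ volume M ^ 2 := by
  have := pl_n n (A.indicator 1) (B.indicator 1) (M.indicator 1)
    (measurable_one.indicator hA) (measurable_one.indicator hB) (measurable_one.indicator hM) ?_
  · simpa [lintegral_indicator, hA, hB, hM] using this
  · intro x y
    by_cases hx : x ∈ A
    · by_cases hy : y ∈ B
      · have := h x hx y hy
        rw [Set.indicator_of_mem hx, Set.indicator_of_mem hy, Set.indicator_of_mem this]
        simp
      · simp [hy]
    · simp [hx]


theorem lpn_nonneg (p : ℝ) {n : ℕ} (x : Fin n → ℝ) : 0 ≤ _root_.lpNorm p x := by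
  unfold _root_.lpNorm; positivity

theorem lpn_rpow {p : ℝ} (hp : 2 ≤ p) {n : ℕ} (x : Fin n → ℝ) :
    _root_.lpNorm p x ^ p = ∑ i, |x i| ^ p := by
  unfold _root_.lpNorm
  rw [← Real.rpow_mul (by positivity), one_div, inv_mul_cancel₀ (by linarith), Real.rpow_one]

theorem lpn_smul {p : ℝ} (hp : 2 ≤ p) {n : ℕ} (c : ℝ) (x : Fin n → ℝ) :
    _root_.lpNorm p (c • x) = |c| * _root_.lpNorm p x := by
  unfold _root_.lpNorm
  simp only [Pi.smul_apply, smul_eq_mul, abs_mul]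
  simp_rw [Real.mul_rpow (abs_nonneg _) (abs_nonneg _)]
  rw [← Finset.mul_sum, Real.mul_rpow (by positivity) (by positivity),
    ← Real.rpow_mul (abs_nonneg _), mul_one_div_cancel (by linarith), Real.rpow_one]

theorem lpn_add_le {p : ℝ} (hp : 2 ≤ p) {n : ℕ} (x y : Fin n → ℝ) :
    _root_.lpNorm p (x + y) ≤ _root_.lpNorm p x + _root_.lpNorm p y := by
  unfold _root_.lpNorm
  exact Real.Lp_add_le Finset.univ x y (by linarith)

theorem lpn_neg {p : ℝ} {n : ℕ} (x : Fin n → ℝ) : _root_.lpNorm p (-x) = _root_.lpNorm p x := by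
  unfold _root_.lpNorm; simp

theorem lpn_zero {p : ℝ} (hp : 2 ≤ p) {n : ℕ} : _root_.lpNorm p (0 : Fin n → ℝ) = 0 := by
  have := lpn_smul hp (n := n) 0 0
  simpa using this

theorem lpn_sub_comm {p : ℝ} {n : ℕ} (x y : Fin n → ℝ) :
    _root_.lpNorm p (x - y) = _root_.lpNorm p (y - x) := by
  rw [← lpn_neg, neg_sub]

theorem lpn_sub_le {p : ℝ} (hp : 2 ≤ p) {n : ℕ} (x y : Fin n → ℝ) :
    _root_.lpNorm p (x - y) ≤ _root_.lpNorm p x + _root_.lpNorm p y := by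
  have := lpn_add_le hp x (-y)
  rwa [lpn_neg, ← sub_eq_add_neg] at this

theorem lpn_le_add_sub {p : ℝ} (hp : 2 ≤ p) {n : ℕ} (x y : Fin n → ℝ) :
    _root_.lpNorm p x ≤ _root_.lpNorm p y + _root_.lpNorm p (x - y) := by
  have := lpn_add_le hp y (x - y)
  simpa using this

theorem abs_le_lpn {p : ℝ} (hp : 2 ≤ p) {n : ℕ} (x : Fin n → ℝ) (i : Fin n) :
    |x i| ≤ _root_.lpNorm p x := by
  have h1 : |x i| ^ p ≤ _root_.lpNorm p x ^ p := by
    rw [lpn_rpow hp]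
    exact Finset.single_le_sum (f := fun i => |x i| ^ p) (fun j _ => by positivity) (Finset.mem_univ i)
  exact (Real.rpow_le_rpow_iff (abs_nonneg _) (lpn_nonneg p x) (by linarith)).1 h1

theorem lpn_mono {p : ℝ} (hp : 2 ≤ p) {n : ℕ} (x y : Fin n → ℝ) (h : ∀ i, |x i| ≤ |y i|) :
    _root_.lpNorm p x ≤ _root_.lpNorm p y := by
  unfold _root_.lpNorm
  apply Real.rpow_le_rpow (by positivity) _ (by positivity)
  exact Finset.sum_le_sum fun i _ => Real.rpow_le_rpow (abs_nonneg _) (h i) (by linarith)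

theorem norm_le_lpn {p : ℝ} (hp : 2 ≤ p) {n : ℕ} (x : Fin n → ℝ) : ‖x‖ ≤ _root_.lpNorm p x := by
  rw [pi_norm_le_iff_of_nonneg (lpn_nonneg p x)]
  exact fun i => abs_le_lpn hp x i

theorem lpn_eq_zero {p : ℝ} (hp : 2 ≤ p) {n : ℕ} (x : Fin n → ℝ) (h : _root_.lpNorm p x = 0) :
    x = 0 := by
  have := norm_le_lpn hp x
  rw [h] at this
  simpa using this

theorem lpn_pos {p : ℝ} (hp : 2 ≤ p) {n : ℕ} (x : Fin n → ℝ) (h : x ≠ 0) :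
    0 < _root_.lpNorm p x :=
  lt_of_le_of_ne (lpn_nonneg p x) fun h0 => h (lpn_eq_zero hp x h0.symm)

theorem lpn_continuous {p : ℝ} (hp : 2 ≤ p) {n : ℕ} :
    Continuous (fun x : Fin n → ℝ => _root_.lpNorm p x) := by
  unfold _root_.lpNorm
  refine Continuous.rpow_const ?_ (fun x => Or.inr (by positivity))
  refine continuous_finsetSum _ fun i _ => ?_
  exact ((continuous_apply i).abs).rpow_const (fun x => Or.inr (by linarith))

theorem clarkson_one {p : ℝ} (hp : 2 ≤ p) (x y : ℝ) :
    |(x + y) / 2| ^ p + |(x - y) / 2| ^ p ≤ (|x| ^ p + |y| ^ p) / 2 := by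
  have e : ∀ z : ℝ, |z| ^ p = (z ^ 2) ^ (p / 2) := by
    intro z
    rw [← sq_abs, ← Real.rpow_natCast, ← Real.rpow_mul (abs_nonneg z)]
    congr 1; push_cast; ring
  rw [e, e, e, e]
  have h1 := Real.add_rpow_le_rpow_add (sq_nonneg ((x+y)/2)) (sq_nonneg ((x-y)/2))
    (p := p/2) (by linarith)
  have h2 := (convexOn_rpow (p := p/2) (by linarith)).2
    (Set.mem_Ici.2 (sq_nonneg x)) (Set.mem_Ici.2 (sq_nonneg y))
    (show (0:ℝ) ≤ 1/2 by norm_num) (show (0:ℝ) ≤ 1/2 by norm_num) (by norm_num)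
  simp only [smul_eq_mul] at h2
  have e2 : ((x+y)/2)^2 + ((x-y)/2)^2 = 1/2 * x^2 + 1/2 * y^2 := by ring
  rw [e2] at h1
  linarith

theorem clarkson {p : ℝ} (hp : 2 ≤ p) {n : ℕ} (x y : Fin n → ℝ) :
    _root_.lpNorm p ((1/2 : ℝ) • (x + y)) ^ p + (_root_.lpNorm p (x - y) / 2) ^ p ≤
      (_root_.lpNorm p x ^ p + _root_.lpNorm p y ^ p) / 2 := by
  have e : _root_.lpNorm p (x - y) / 2 = _root_.lpNorm p ((1/2 : ℝ) • (x - y)) := by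
    rw [lpn_smul hp, abs_of_pos (by norm_num)]; ring
  rw [e, lpn_rpow hp, lpn_rpow hp, lpn_rpow hp, lpn_rpow hp, ← Finset.sum_add_distrib,
    ← Finset.sum_add_distrib, Finset.sum_div]
  apply Finset.sum_le_sum
  intro i _
  have := clarkson_one hp (x i) (y i)
  simp only [Pi.smul_apply, Pi.add_apply, Pi.sub_apply, smul_eq_mul]
  rwa [one_div_mul_eq_div, one_div_mul_eq_div]

/-- radial projection -/
noncomputable def rproj (p : ℝ) {n : ℕ} (x : Fin n → ℝ) : Fin n → ℝ := (_root_.lpNorm p x)⁻¹ • x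

theorem lpn_rproj {p : ℝ} (hp : 2 ≤ p) {n : ℕ} (x : Fin n → ℝ) (h : x ≠ 0) :
    _root_.lpNorm p (rproj p x) = 1 := by
  have := lpn_pos hp x h
  rw [rproj, lpn_smul hp, abs_of_pos (by positivity)]
  field_simp

theorem rproj_measurable {p : ℝ} (hp : 2 ≤ p) {n : ℕ} : Measurable (rproj p (n := n)) := by
  unfold rproj
  exact (lpn_continuous hp).measurable.inv.smul measurable_id

theorem rproj_lip {p : ℝ} (hp : 2 ≤ p) {n : ℕ} (x y : Fin n → ℝ) (hx : x ≠ 0) (hy : y ≠ 0) :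
    _root_.lpNorm p (rproj p y - rproj p x) ≤ 2 / _root_.lpNorm p x * _root_.lpNorm p (y - x) := by
  have h1 := lpn_pos hp x hx
  have h2 := lpn_pos hp y hy
  set a := _root_.lpNorm p x
  set b := _root_.lpNorm p y
  have e : rproj p y - rproj p x = a⁻¹ • (y - x) + ((a - b) / (a * b)) • y := by
    unfold rproj
    ext i
    simp only [Pi.sub_apply, Pi.smul_apply, Pi.add_apply, smul_eq_mul]
    change b⁻¹ * y i - a⁻¹ * x i = _
    field_simp; ring
  rw [e]
  refine le_trans (lpn_add_le hp _ _) ?_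
  rw [lpn_smul hp, lpn_smul hp, abs_of_pos (inv_pos.2 h1), abs_div, abs_of_pos (mul_pos h1 h2)]
  have h3 : |a - b| ≤ _root_.lpNorm p (y - x) := by
    rw [abs_le]
    have := lpn_le_add_sub hp x y
    have h5 := lpn_le_add_sub hp y x
    rw [lpn_sub_comm x y] at this
    constructor <;> linarith
  change a⁻¹ * _ + |a - b| / (a * b) * b ≤ _
  have : |a - b| / (a * b) * b = a⁻¹ * |a - b| := by field_simp
  rw [this]
  have : a⁻¹ * |a - b| ≤ a⁻¹ * _root_.lpNorm p (y - x) := by gcongr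
  calc _ ≤ a⁻¹ * _root_.lpNorm p (y - x) + a⁻¹ * _root_.lpNorm p (y - x) := by linarith
    _ = _ := by ring


/-- the unit ball -/
def lpBall (p : ℝ) (n : ℕ) : Set (Fin n → ℝ) := {x | _root_.lpNorm p x ≤ 1}
/-- the unit sphere -/
def lpSphere (p : ℝ) (n : ℕ) : Set (Fin n → ℝ) := {x | _root_.lpNorm p x = 1}

theorem mem_lpSphere {p : ℝ} {n : ℕ} {x : Fin n → ℝ} :
    x ∈ lpSphere p n ↔ _root_.lpNorm p x = 1 := Iff.rfl

theorem mem_lpBall {p : ℝ} {n : ℕ} {x : Fin n → ℝ} :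
    x ∈ lpBall p n ↔ _root_.lpNorm p x ≤ 1 := Iff.rfl

theorem lpBall_closed {p : ℝ} (hp : 2 ≤ p) (n : ℕ) : IsClosed (lpBall p n) :=
  isClosed_le (lpn_continuous hp) continuous_const

theorem lpSphere_closed {p : ℝ} (hp : 2 ≤ p) (n : ℕ) : IsClosed (lpSphere p n) :=
  isClosed_eq (lpn_continuous hp) continuous_const

theorem lpBall_subset {p : ℝ} (hp : 2 ≤ p) (n : ℕ) : lpBall p n ⊆ Metric.closedBall 0 1 := by
  intro x hx
  simpa using le_trans (norm_le_lpn hp x) hx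

theorem lpSphere_subset {p : ℝ} (n : ℕ) : lpSphere p n ⊆ lpBall p n := fun _ hx => le_of_eq hx

theorem lpSphere_compact {p : ℝ} (hp : 2 ≤ p) (n : ℕ) : IsCompact (lpSphere p n) :=
  (isCompact_closedBall (0 : Fin n → ℝ) 1).of_isClosed_subset (lpSphere_closed hp n)
    ((lpSphere_subset n).trans (lpBall_subset hp n))

theorem lpBall_vol_ne_top {p : ℝ} (hp : 2 ≤ p) (n : ℕ) : volume (lpBall p n) ≠ ⊤ :=
  ne_top_of_le_ne_top (measure_closedBall_lt_top).ne (measure_mono (lpBall_subset hp n))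

theorem lpBall_vol_ne_zero {p : ℝ} (hp : 2 ≤ p) (n : ℕ) : volume (lpBall p n) ≠ 0 := by
  have ho : IsOpen {x : Fin n → ℝ | _root_.lpNorm p x < 1} :=
    isOpen_lt (lpn_continuous hp) continuous_const
  have h1 := ho.measure_pos volume ⟨0, by simp [lpn_zero hp]⟩
  exact (lt_of_lt_of_le h1 (measure_mono fun x hx =>
    mem_lpBall.2 (le_of_lt (show _root_.lpNorm p x < 1 from hx)))).ne'

theorem cone_apply {p : ℝ} (hp : 2 ≤ p) (n : ℕ) (A : Set (Fin n → ℝ)) (hA : MeasurableSet A) :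
    coneMeasure p n A = (volume (lpBall p n))⁻¹ * volume (rproj p ⁻¹' A ∩ lpBall p n) := by
  unfold coneMeasure
  change Measure.map (rproj p) _ A = _
  rw [Measure.map_apply (rproj_measurable hp) hA, Measure.smul_apply,
    Measure.restrict_apply (rproj_measurable hp hA)]
  rfl

theorem cone_prob {p : ℝ} (hp : 2 ≤ p) (n : ℕ) : IsProbabilityMeasure (coneMeasure p n) := by
  constructor
  rw [cone_apply hp n _ MeasurableSet.univ]
  simp only [Set.preimage_univ, Set.univ_inter]
  exact ENNReal.inv_mul_cancel (lpBall_vol_ne_zero hp n) (lpBall_vol_ne_top hp n)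

theorem cone_compl {p : ℝ} (hp : 2 ≤ p) (n : ℕ) (hn : 1 ≤ n) :
    coneMeasure p n (lpSphere p n)ᶜ = 0 := by
  rw [cone_apply hp n _ (lpSphere_closed hp n).measurableSet.compl]
  have : volume (rproj p ⁻¹' (lpSphere p n)ᶜ ∩ lpBall p n) = 0 := by
    refine measure_mono_null (t := {0}) ?_ ?_
    · rintro x ⟨hx, _⟩
      by_contra h
      exact hx (lpn_rproj hp x h)
    · have : Nonempty (Fin n) := ⟨⟨0, hn⟩⟩
      have : Nontrivial (Fin n → ℝ) := inferInstance
      exact measure_singleton 0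
  rw [this, mul_zero]

theorem cone_open_pos {p : ℝ} (hp : 2 ≤ p) (n : ℕ) (G : Set (Fin n → ℝ)) (hG : IsOpen G)
    (x : Fin n → ℝ) (hx : x ∈ lpSphere p n) (hxG : x ∈ G) : coneMeasure p n G ≠ 0 := by
  rw [cone_apply hp n _ hG.measurableSet]
  have hx0 : x ≠ 0 := by
    rintro rfl
    rw [mem_lpSphere, lpn_zero hp] at hx
    norm_num at hx
  refine mul_ne_zero (ENNReal.inv_ne_zero.2 (lpBall_vol_ne_top hp n)) ?_
  have hcont : ContinuousAt (rproj p (n := n)) ((1/2 : ℝ) • x) := by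
    unfold rproj
    refine ContinuousAt.smul (ContinuousAt.inv₀ (lpn_continuous hp).continuousAt ?_) continuousAt_id
    exact (lpn_pos hp _ (smul_ne_zero (by norm_num) hx0)).ne'
  have hnorm : _root_.lpNorm p ((1/2 : ℝ) • x) = 1/2 := by
    rw [lpn_smul hp, mem_lpSphere.1 hx, abs_of_pos (by norm_num)]; norm_num
  have hr : rproj p ((1/2 : ℝ) • x) = x := by
    unfold rproj
    rw [hnorm, smul_smul]; norm_num
  have h1 : rproj p ⁻¹' G ∈ nhds ((1/2 : ℝ) • x) :=
    hcont.preimage_mem_nhds (by rw [hr]; exact hG.mem_nhds hxG)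
  have h2 : lpBall p n ∈ nhds ((1/2 : ℝ) • x) := by
    have ho : IsOpen {x : Fin n → ℝ | _root_.lpNorm p x < 1} :=
      isOpen_lt (lpn_continuous hp) continuous_const
    refine Filter.mem_of_superset (ho.mem_nhds ?_) (fun y hy =>
      mem_lpBall.2 (le_of_lt (show _root_.lpNorm p y < 1 from hy)))
    change _root_.lpNorm p ((1/2 : ℝ) • x) < 1
    rw [hnorm]; norm_num
  exact (Measure.measure_pos_of_mem_nhds volume (Filter.inter_mem h1 h2)).ne'

theorem midpoint_bound {p : ℝ} (hp : 2 ≤ p) {n : ℕ} (a b : Fin n → ℝ)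
    (ha : _root_.lpNorm p a = 1) (hb : _root_.lpNorm p b = 1) (s t δ : ℝ)
    (hs0 : 0 ≤ s) (hs : s ≤ t) (ht1 : t ≤ 1) (h2 : 1/2 ≤ δ)
    (h : _root_.lpNorm p ((1/2 : ℝ) • (a + b)) ≤ δ) :
    _root_.lpNorm p ((1/2 : ℝ) • (t • a + s • b)) ≤ δ := by
  have e : (1/2 : ℝ) • (t • a + s • b) = s • ((1/2 : ℝ) • (a + b)) + ((t - s)/2) • a := by
    ext i; simp; ring
  rw [e]
  refine le_trans (lpn_add_le hp _ _) ?_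
  rw [lpn_smul hp, lpn_smul hp ((t-s)/2), ha, abs_of_nonneg hs0, abs_of_nonneg (by linarith)]
  have : s * _root_.lpNorm p ((1/2 : ℝ) • (a + b)) ≤ s * δ := by gcongr
  nlinarith

theorem cone_conc {p : ℝ} (hp : 2 ≤ p) (n : ℕ) (A B : Set (Fin n → ℝ))
    (hA : MeasurableSet A) (hB : MeasurableSet B) (hAS : A ⊆ lpSphere p n) (hBS : B ⊆ lpSphere p n)
    (ρ : ℝ) (hρ : 0 ≤ ρ) (h : ∀ a ∈ A, ∀ b ∈ B, ρ ≤ _root_.lpNorm p (a - b)) :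
    coneMeasure p n A * coneMeasure p n B ≤
      ENNReal.ofReal (Real.exp (-(2 * n / p) * (ρ / 2) ^ p)) := by
  rcases A.eq_empty_or_nonempty with rfl | ⟨a0, ha0⟩
  · simp
  rcases B.eq_empty_or_nonempty with rfl | ⟨b0, hb0⟩
  · simp
  have hp0 : 0 < p := by linarith
  have hρ2 : ρ / 2 ≤ 1 := by
    have h1 := h a0 ha0 b0 hb0
    have h2 := lpn_sub_le hp a0 b0
    rw [mem_lpSphere.1 (hAS ha0), mem_lpSphere.1 (hBS hb0)] at h2
    linarith
  have hρp : (ρ/2) ^ p ≤ 1 := Real.rpow_le_one (by linarith) hρ2 hp0.le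
  have hρp0 : 0 ≤ (ρ/2) ^ p := by positivity
  set δ := Real.exp (-((ρ/2)^p / p)) with hδ
  have hδ2 : 1/2 ≤ δ := by
    have : -(1/2 : ℝ) ≤ -((ρ/2)^p/p) := by
      rw [neg_le_neg_iff, div_le_iff₀ hp0]; linarith
    have h3 := Real.add_one_le_exp (-((ρ/2)^p/p))
    linarith
  have hmid : ∀ a ∈ A, ∀ b ∈ B, _root_.lpNorm p ((1/2 : ℝ) • (a + b)) ≤ δ := by
    intro a ha b hb
    have h1 := clarkson hp a b
    rw [mem_lpSphere.1 (hAS ha), mem_lpSphere.1 (hBS hb), Real.one_rpow] at h1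
    have h2 : (ρ/2)^p ≤ (_root_.lpNorm p (a - b) / 2)^p := by
      have := h a ha b hb
      gcongr
    have h3 := Real.add_one_le_exp (-((ρ/2)^p))
    have h4 : δ ^ p = Real.exp (-((ρ/2)^p)) := by
      rw [hδ, ← Real.exp_mul]; congr 1; field_simp
    refine (Real.rpow_le_rpow_iff (lpn_nonneg p _) (Real.exp_pos _).le hp0).1 ?_
    change _ ≤ δ ^ p
    rw [h4]; linarith
  have hbm := bm_n n (rproj p ⁻¹' A ∩ lpBall p n) (rproj p ⁻¹' B ∩ lpBall p n)
    {x | _root_.lpNorm p x ≤ δ}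
    ((rproj_measurable hp hA).inter (lpBall_closed hp n).measurableSet)
    ((rproj_measurable hp hB).inter (lpBall_closed hp n).measurableSet)
    (isClosed_le (lpn_continuous hp) continuous_const).measurableSet ?_
  · have hvol : volume {x : Fin n → ℝ | _root_.lpNorm p x ≤ δ} =
        ENNReal.ofReal (δ ^ n) * volume (lpBall p n) := by
      have hδ0 : 0 < δ := Real.exp_pos _
      have := Measure.addHaar_preimage_smul (volume : Measure (Fin n → ℝ)) (inv_ne_zero hδ0.ne') (lpBall p n)
      rw [Module.finrank_fin_fun, inv_pow, inv_inv, abs_of_pos (by positivity)] at this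
      rw [← this]
      congr 1
      ext x
      simp only [Set.mem_ofPred_eq, Set.mem_preimage, mem_lpBall]
      rw [lpn_smul hp, abs_of_pos (by positivity), inv_mul_le_iff₀ hδ0, mul_one]
    rw [hvol] at hbm
    rw [cone_apply hp n A hA, cone_apply hp n B hB]
    set V := volume (lpBall p n)
    have hV0 : V ≠ 0 := lpBall_vol_ne_zero hp n
    have hV1 : V ≠ ⊤ := lpBall_vol_ne_top hp n
    rw [mul_mul_mul_comm]
    refine le_trans (mul_le_mul' le_rfl hbm) (le_of_eq ?_)
    have e1 : V⁻¹ * V⁻¹ * (ENNReal.ofReal (δ ^ n) * V) ^ 2 =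
      (V⁻¹ * V) * (V⁻¹ * V) * ENNReal.ofReal (δ ^ n) ^ 2 := by ring
    rw [e1, ENNReal.inv_mul_cancel hV0 hV1, one_mul, one_mul, ← ENNReal.ofReal_pow (by positivity),
      ← pow_mul, hδ, ← Real.exp_nat_mul]
    congr 2
    push_cast
    ring
  · rintro x ⟨hx, hx1⟩ y ⟨hy, hy1⟩
    have rep : ∀ z : Fin n → ℝ, rproj p z ∈ lpSphere p n → z = _root_.lpNorm p z • rproj p z := by
      intro z hz
      have hz0 : z ≠ 0 := by
        rintro rfl
        rw [mem_lpSphere, rproj, smul_zero, lpn_zero hp] at hz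
        norm_num at hz
      have := lpn_pos hp z hz0
      rw [rproj, smul_smul, mul_inv_cancel₀ this.ne', one_smul]
    have ex := rep x (hAS hx)
    have ey := rep y (hBS hy)
    change _root_.lpNorm p ((1/2 : ℝ) • (x + y)) ≤ δ
    rw [ex, ey]
    rcases le_total (_root_.lpNorm p y) (_root_.lpNorm p x) with hl | hl
    · exact midpoint_bound hp _ _ (hAS hx) (hBS hy) _ _ δ (lpn_nonneg p y) hl hx1 hδ2 (hmid _ hx _ hy)
    · rw [add_comm]
      refine midpoint_bound hp _ _ (hBS hy) (hAS hx) _ _ δ (lpn_nonneg p x) hl hy1 hδ2 ?_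
      rw [add_comm]
      exact hmid _ hx _ hy


/-- Truncated Taylor-type polynomial. -/
noncomputable def tayP (d : ℕ) (M : ℕ → ℝ) (k : ℕ) (L : ℝ) : ℝ :=
  ∑ i ∈ Finset.range (d - k + 1), M (k + i) * (L ^ i / (i.factorial : ℝ))

theorem tayP_hasDerivAt (d : ℕ) (M : ℕ → ℝ) (k : ℕ) (hk : k < d) (L : ℝ) :
    HasDerivAt (tayP d M k) (tayP d M (k + 1) L) L := by
  obtain ⟨e, rfl⟩ : ∃ e, d = k + 1 + e := ⟨d - (k + 1), by omega⟩
  have h1 : k + 1 + e - k + 1 = e + 1 + 1 := by omega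
  have h2 : k + 1 + e - (k + 1) + 1 = e + 1 := by omega
  have hf : tayP (k + 1 + e) M k = fun L => ∑ i ∈ Finset.range (e + 1 + 1), M (k + i) * (L ^ i / (i.factorial : ℝ)) := by
    ext L; simp only [tayP, h1]
  rw [hf, tayP, h2]
  have hd : ∀ i ∈ Finset.range (e + 1 + 1), HasDerivAt (fun L : ℝ => M (k + i) * (L ^ i / (i.factorial : ℝ)))
      (M (k + i) * ((i * L ^ (i - 1)) / (i.factorial : ℝ))) L := by
    intro i _
    exact ((hasDerivAt_pow i L).div_const _).const_mul _
  refine (HasDerivAt.fun_sum hd).congr_deriv ?_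
  rw [Finset.sum_range_succ']
  simp only [Nat.cast_zero, zero_mul, zero_div, mul_zero, add_zero]
  apply Finset.sum_congr rfl
  intro i _
  rw [show k + (i + 1) = k + 1 + i by ring, Nat.add_sub_cancel, Nat.factorial_succ]
  congr 1
  push_cast
  have : (i.factorial : ℝ) ≠ 0 := by positivity
  field_simp

theorem tayP_mono (d : ℕ) (M : ℕ → ℝ) (hM : ∀ k, 0 ≤ M k) (k : ℕ) (L L' : ℝ) (h0 : 0 ≤ L) (h : L ≤ L') :
    tayP d M k L ≤ tayP d M k L' := by
  unfold tayP
  gcongr with i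
  exact hM _

theorem tayP_top (d : ℕ) (M : ℕ → ℝ) (L : ℝ) : tayP d M d L = M d := by
  simp [tayP]

theorem tayP_zero (d : ℕ) (M : ℕ → ℝ) (k : ℕ) : tayP d M k 0 = M k := by
  simp [tayP, Finset.sum_range_succ']

theorem cons_bound {p : ℝ} (hp : 2 ≤ p) {n k : ℕ}
    (T : ContinuousMultilinearMap ℝ (fun _ : Fin (k+1) => (Fin n → ℝ)) ℝ) (C : ℝ) (hC : 0 ≤ C)
    (hT : ∀ v : Fin (k+1) → Fin n → ℝ, (∀ i, _root_.lpNorm p (v i) = 1) → |T v| ≤ C)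
    (w : Fin n → ℝ) (v : Fin k → Fin n → ℝ) (hv : ∀ i, _root_.lpNorm p (v i) = 1) :
    |T (Fin.cons w v)| ≤ C * _root_.lpNorm p w := by
  by_cases hw : w = 0
  · have : T (Fin.cons w v) = 0 := T.map_coord_zero 0 (by simp [hw])
    rw [this, abs_zero]
    exact mul_nonneg hC (lpn_nonneg p w)
  · have h0 := lpn_pos hp w hw
    have e : w = _root_.lpNorm p w • rproj p w := by
      rw [rproj, smul_smul, mul_inv_cancel₀ h0.ne', one_smul]
    have h1 : T (Fin.cons w v) = _root_.lpNorm p w * T (Fin.cons (rproj p w) v) := by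
      conv_lhs => rw [e]
      exact T.toMultilinearMap.cons_smul v _ _
    rw [h1, abs_mul, abs_of_pos h0, mul_comm]
    gcongr
    apply hT
    intro i
    refine Fin.cases ?_ (fun j => ?_) i
    · simpa using lpn_rproj hp w hw
    · simpa using hv j

/-- state predicate -/
def StB (p : ℝ) {n : ℕ} (d : ℕ) (M : ℕ → ℝ) (f : (Fin n → ℝ) → ℝ) (x : Fin n → ℝ) (L : ℝ) : Prop :=
  ∀ k ≤ d, ∀ v : Fin k → Fin n → ℝ, (∀ i, _root_.lpNorm p (v i) = 1) →
    |iteratedFDeriv ℝ k f x v| ≤ tayP d M k L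

theorem propagate {p : ℝ} (hp : 2 ≤ p) {n d : ℕ} (M : ℕ → ℝ) (hM : ∀ k, 0 ≤ M k)
    (f : (Fin n → ℝ) → ℝ) (U : Set (Fin n → ℝ)) (hU : IsOpen U)
    (hsub : lpSphere p n ⊆ U) (hf : ContDiffOn ℝ (d : ℕ∞) f U)
    (htop : ∀ x ∈ lpSphere p n, ∀ v : Fin d → Fin n → ℝ, (∀ i, _root_.lpNorm p (v i) = 1) →
      |iteratedFDeriv ℝ d f x v| ≤ M d)
    (γ γ' : ℝ → Fin n → ℝ) (V L0 : ℝ) (hV : 0 ≤ V) (hL0 : 0 ≤ L0)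
    (hγ : ∀ s ∈ Set.Icc (0:ℝ) 1, HasDerivAt γ (γ' s) s)
    (hγS : ∀ s ∈ Set.Icc (0:ℝ) 1, γ s ∈ lpSphere p n)
    (hγV : ∀ s ∈ Set.Icc (0:ℝ) 1, _root_.lpNorm p (γ' s) ≤ V)
    (h0 : StB p d M f (γ 0) L0) :
    ∀ s ∈ Set.Icc (0:ℝ) 1, StB p d M f (γ s) (L0 + V * s) := by
  have key : ∀ j ≤ d, ∀ s ∈ Set.Icc (0:ℝ) 1, ∀ v : Fin (d - j) → Fin n → ℝ,
      (∀ i, _root_.lpNorm p (v i) = 1) →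
      |iteratedFDeriv ℝ (d - j) f (γ s) v| ≤ tayP d M (d - j) (L0 + V * s) := by
    intro j
    induction j with
    | zero =>
      intro _ s hs v hv
      change |iteratedFDeriv ℝ d f (γ s) v| ≤ tayP d M d (L0 + V * s)
      rw [tayP_top]
      exact htop _ (hγS s hs) v hv
    | succ j ih =>
      intro hj s hs v hv
      obtain ⟨k, hk⟩ : ∃ k, d - (j+1) = k := ⟨_, rfl⟩
      have hk1 : d - j = k + 1 := by omega
      have ih := ih (by omega)
      rw [hk1] at ih
      revert v
      rw [hk]
      intro v hv
      have hkd : k < d := by omega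
      have hder : ∀ s ∈ Set.Icc (0:ℝ) 1, HasDerivAt (fun s => iteratedFDeriv ℝ k f (γ s) v)
          (iteratedFDeriv ℝ (k+1) f (γ s) (Fin.cons (γ' s) v)) s := by
        intro s hs
        have hc : ContDiffAt ℝ (d : ℕ∞) f (γ s) := hf.contDiffAt (hU.mem_nhds (hsub (hγS s hs)))
        have hdiff : DifferentiableAt ℝ (iteratedFDeriv ℝ k f) (γ s) :=
          hc.differentiableAt_iteratedFDeriv (by exact_mod_cast hkd)
        have h1 := hdiff.hasFDerivAt.comp_hasDerivAt s (hγ s hs)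
        have h2 := ((ContinuousMultilinearMap.apply ℝ (fun _ : Fin k => (Fin n → ℝ)) ℝ v).hasFDerivAt.comp_hasDerivAt s h1)
        refine h2.congr_deriv ?_
        rw [iteratedFDeriv_succ_apply_left]
        simp
      have hB : ∀ s : ℝ, HasDerivAt (fun s => tayP d M k (L0 + V * s))
          (tayP d M (k+1) (L0 + V * s) * V) s := by
        intro s
        have h1 : HasDerivAt (fun s : ℝ => L0 + V * s) V s := by
          simpa using ((hasDerivAt_id s).const_mul V).const_add L0
        exact (tayP_hasDerivAt d M k hkd (L0 + V * s)).comp s h1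
      have hnn : ∀ s ∈ Set.Icc (0:ℝ) 1, 0 ≤ tayP d M (k+1) (L0 + V * s) := by
        intro s hs
        have : 0 ≤ L0 + V * s := add_nonneg hL0 (mul_nonneg hV hs.1)
        exact Finset.sum_nonneg fun i _ => mul_nonneg (hM _) (by positivity)
      refine image_norm_le_of_norm_deriv_right_le_deriv_boundary
        (f := fun s => iteratedFDeriv ℝ k f (γ s) v)
        (f' := fun s => iteratedFDeriv ℝ (k+1) f (γ s) (Fin.cons (γ' s) v))
        (B := fun s => tayP d M k (L0 + V * s)) ?_ ?_ ?_ hB ?_ hs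
      · exact fun s hs => (hder s hs).continuousAt.continuousWithinAt
      · exact fun s hs => (hder s (Set.Ico_subset_Icc_self hs)).hasDerivWithinAt
      · simpa using h0 k hkd.le v hv
      · intro s hs
        have hs' := Set.Ico_subset_Icc_self hs
        refine le_trans (cons_bound hp _ _ (hnn s hs') (ih s hs') (γ' s) v hv) ?_
        exact mul_le_mul_of_nonneg_left (hγV s hs') (hnn s hs')
  intro s hs k hk
  have := key (d - k) (by omega) s hs
  rwa [show d - (d - k) = k by omega] at this

theorem lpn_differentiableAt {p : ℝ} (hp : 2 ≤ p) {n : ℕ} (x : Fin n → ℝ) (hx : x ≠ 0) :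
    DifferentiableAt ℝ (fun x : Fin n → ℝ => _root_.lpNorm p x) x := by
  unfold _root_.lpNorm
  refine DifferentiableAt.rpow_const ?_ (Or.inl ?_)
  · refine DifferentiableAt.fun_sum fun i _ => ?_
    have h1 := (hasDerivAt_abs_rpow (x i) (show 1 < p by linarith)).differentiableAt
    have h2 : DifferentiableAt ℝ (fun x : Fin n → ℝ => x i) x := by fun_prop
    exact DifferentiableAt.comp (g := fun y : ℝ => |y| ^ p) x h1 h2
  · rw [← lpn_rpow hp]
    have := lpn_pos hp x hx
    positivity

theorem propagate_seg {p : ℝ} (hp : 2 ≤ p) {n d : ℕ} (M : ℕ → ℝ) (hM : ∀ k, 0 ≤ M k)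
    (f : (Fin n → ℝ) → ℝ) (U : Set (Fin n → ℝ)) (hU : IsOpen U)
    (hsub : lpSphere p n ⊆ U) (hf : ContDiffOn ℝ (d : ℕ∞) f U)
    (htop : ∀ x ∈ lpSphere p n, ∀ v : Fin d → Fin n → ℝ, (∀ i, _root_.lpNorm p (v i) = 1) →
      |iteratedFDeriv ℝ d f x v| ≤ M d)
    (a b : Fin n → ℝ) (ha : a ∈ lpSphere p n) (hb : b ∈ lpSphere p n) (m V L0 : ℝ) (hm : 0 < m)
    (hL0 : 0 ≤ L0)
    (hz : ∀ s ∈ Set.Icc (0:ℝ) 1, m ≤ _root_.lpNorm p (a + s • (b - a)))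
    (hVm : 2 / m * _root_.lpNorm p (b - a) ≤ V)
    (h0 : StB p d M f a L0) : StB p d M f b (L0 + V) := by
  let z : ℝ → Fin n → ℝ := fun s => a + s • (b - a)
  have hz0 : ∀ s ∈ Set.Icc (0:ℝ) 1, z s ≠ 0 := by
    intro s hs h
    have := hz s hs
    change m ≤ _root_.lpNorm p (z s) at this
    rw [h, lpn_zero hp] at this
    linarith
  have hzd : ∀ s, DifferentiableAt ℝ z s := by intro s; simp only [z]; fun_prop
  have hzc : Continuous z := by simp only [z]; fun_prop
  have hV : 0 ≤ V := le_trans (mul_nonneg (by positivity) (lpn_nonneg p _)) hVm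
  have hγd : ∀ s ∈ Set.Icc (0:ℝ) 1, DifferentiableAt ℝ (fun s => rproj p (z s)) s := by
    intro s hs
    unfold rproj
    have h1 : DifferentiableAt ℝ (fun s => _root_.lpNorm p (z s)) s :=
      (lpn_differentiableAt hp (z s) (hz0 s hs)).comp s (hzd s)
    exact (h1.inv (lpn_pos hp _ (hz0 s hs)).ne').smul (hzd s)
  have unit : ∀ x ∈ lpSphere p n, rproj p x = x := by
    intro x hx
    rw [rproj, mem_lpSphere.1 hx]; simp
  have key := propagate hp M hM f U hU hsub hf htop (fun s => rproj p (z s))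
    (deriv (fun s => rproj p (z s))) V L0 hV hL0 (fun s hs => (hγd s hs).hasDerivAt)
    (fun s hs => lpn_rproj hp _ (hz0 s hs)) ?_ ?_ 1 (by simp)
  · have e : rproj p (z 1) = b := by simp only [z]; rw [one_smul, add_sub_cancel, unit b hb]
    simpa [e] using key
  · intro s hs
    have h1 := (hγd s hs).hasDerivAt.tendsto_slope
    have h2 := ((lpn_continuous hp).tendsto _).comp h1
    refine le_of_tendsto h2 ?_
    have h3 : ∀ᶠ s' in nhds s, z s' ≠ 0 :=
      hzc.continuousAt.eventually_ne (hz0 s hs)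
    filter_upwards [nhdsWithin_le_nhds h3, self_mem_nhdsWithin] with s' hs' hne
    have hne : s' - s ≠ 0 := sub_ne_zero.2 hne
    have hpos : 0 < |s' - s| := abs_pos.2 hne
    have h4 := rproj_lip hp (z s) (z s') (hz0 s hs) hs'
    have h5 : z s' - z s = (s' - s) • (b - a) := by
      ext i; simp [z]; ring
    rw [h5, lpn_smul hp] at h4
    simp only [Function.comp_apply, slope, vsub_eq_sub]
    rw [lpn_smul hp, abs_inv, inv_mul_le_iff₀ hpos]
    refine le_trans h4 ?_
    have h6 : 2 / _root_.lpNorm p (z s) ≤ 2 / m := by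
      have := hz s hs
      change m ≤ _root_.lpNorm p (z s) at this
      gcongr
    calc _ ≤ 2 / m * (|s' - s| * _root_.lpNorm p (b - a)) := by
            have := lpn_nonneg p (b - a)
            gcongr
      _ = |s' - s| * (2 / m * _root_.lpNorm p (b - a)) := by ring
      _ ≤ _ := by gcongr
  · have e : rproj p (z 0) = a := by simp only [z]; rw [zero_smul, add_zero, unit a ha]
    simpa [e] using h0


theorem stB_mono {p : ℝ} {n d : ℕ} (M : ℕ → ℝ) (hM : ∀ k, 0 ≤ M k)
    (f : (Fin n → ℝ) → ℝ) (x : Fin n → ℝ) (L L' : ℝ) (h0 : 0 ≤ L) (h : L ≤ L')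
    (hs : StB p d M f x L) : StB p d M f x L' :=
  fun k hk v hv => (hs k hk v hv).trans (tayP_mono d M hM k L L' h0 h)

theorem leg_orth {p : ℝ} (hp : 2 ≤ p) {n d : ℕ} (M : ℕ → ℝ) (hM : ∀ k, 0 ≤ M k)
    (f : (Fin n → ℝ) → ℝ) (U : Set (Fin n → ℝ)) (hU : IsOpen U)
    (hsub : lpSphere p n ⊆ U) (hf : ContDiffOn ℝ (d : ℕ∞) f U)
    (htop : ∀ x ∈ lpSphere p n, ∀ v : Fin d → Fin n → ℝ, (∀ i, _root_.lpNorm p (v i) = 1) →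
      |iteratedFDeriv ℝ d f x v| ≤ M d)
    (a b : Fin n → ℝ) (ha : a ∈ lpSphere p n) (hb : b ∈ lpSphere p n) (L0 : ℝ)
    (hL0 : 0 ≤ L0) (hab : ∀ i, 0 ≤ a i * b i)
    (h0 : StB p d M f a L0) : StB p d M f b (L0 + 4) := by
  have hp0 : 0 < p := by linarith
  have hr : (0:ℝ) < 2 ^ (1 / p) := by positivity
  have hrp : ((2:ℝ) ^ (1 / p)) ^ p = 2 := by
    rw [← Real.rpow_mul (by norm_num), one_div, inv_mul_cancel₀ hp0.ne', Real.rpow_one]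
  have hap : ∑ i, |a i| ^ p = 1 := by rw [← lpn_rpow hp, mem_lpSphere.1 ha, Real.one_rpow]
  have hbp : ∑ i, |b i| ^ p = 1 := by rw [← lpn_rpow hp, mem_lpSphere.1 hb, Real.one_rpow]
  refine propagate_seg hp M hM f U hU hsub hf htop a b ha hb (2 ^ (1 / p) / 2) 4 L0 (by positivity) hL0
    ?_ ?_ h0
  · intro s hs
    have hs1 : 0 ≤ 1 - s := by linarith [hs.2]
    rw [← Real.rpow_le_rpow_iff (by positivity) (lpn_nonneg p _) hp0, lpn_rpow hp]
    have h1 : ∀ i, (1 - s) ^ p * |a i| ^ p + s ^ p * |b i| ^ p ≤ |(a + s • (b - a)) i| ^ p := by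
      intro i
      have e : |(a + s • (b - a)) i| = (1 - s) * |a i| + s * |b i| := by
        have e1 : (a + s • (b - a)) i = (1 - s) * a i + s * b i := by simp; ring
        rw [e1]
        have e2 : |(1 - s) * a i + s * b i| = |(1 - s) * a i| + |s * b i| := by
          rw [abs_add_eq_add_abs_iff]
          rcases le_total 0 (a i) with h | h
          · rcases le_total 0 (b i) with h' | h'
            · exact Or.inl ⟨mul_nonneg hs1 h, mul_nonneg hs.1 h'⟩
            · have : a i * b i = 0 := le_antisymm (mul_nonpos_of_nonneg_of_nonpos h h') (hab i)
              rcases mul_eq_zero.1 this with h2 | h2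
              · exact Or.inr ⟨by simp [h2], mul_nonpos_of_nonneg_of_nonpos hs.1 h'⟩
              · exact Or.inl ⟨mul_nonneg hs1 h, by simp [h2]⟩
          · rcases le_total 0 (b i) with h' | h'
            · have : a i * b i = 0 := le_antisymm (mul_nonpos_of_nonpos_of_nonneg h h') (hab i)
              rcases mul_eq_zero.1 this with h2 | h2
              · exact Or.inl ⟨by simp [h2], mul_nonneg hs.1 h'⟩
              · exact Or.inr ⟨mul_nonpos_of_nonneg_of_nonpos hs1 h, by simp [h2]⟩
            · exact Or.inr ⟨mul_nonpos_of_nonneg_of_nonpos hs1 h, mul_nonpos_of_nonneg_of_nonpos hs.1 h'⟩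
        rw [e2, abs_mul, abs_mul, abs_of_nonneg hs1, abs_of_nonneg hs.1]
      rw [e, ← Real.mul_rpow hs1 (abs_nonneg _), ← Real.mul_rpow hs.1 (abs_nonneg _)]
      exact Real.add_rpow_le_rpow_add (mul_nonneg hs1 (abs_nonneg _)) (mul_nonneg hs.1 (abs_nonneg _)) (by linarith)
    have h2 : (1 - s) ^ p + s ^ p ≤ ∑ i, |(a + s • (b - a)) i| ^ p := by
      calc _ = ∑ i, ((1 - s) ^ p * |a i| ^ p + s ^ p * |b i| ^ p) := by
            rw [Finset.sum_add_distrib, ← Finset.mul_sum, ← Finset.mul_sum, hap, hbp]; ring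
        _ ≤ _ := Finset.sum_le_sum fun i _ => h1 i
    refine le_trans ?_ h2
    have h3 := clarkson_one hp (1 - s) s
    rw [abs_of_nonneg hs1, abs_of_nonneg hs.1] at h3
    have h4 : (0:ℝ) ≤ |(1 - s - s) / 2| ^ p := by positivity
    have h5 : |(1 - s + s) / 2| = (1/2 : ℝ) := by rw [sub_add_cancel]; norm_num
    rw [h5] at h3
    have h6 : ((2:ℝ) ^ (1 / p) / 2) ^ p = 2 * (1/2) ^ p := by
      rw [div_eq_mul_one_div, Real.mul_rpow (by positivity) (by norm_num), hrp]
    rw [h6]; linarith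
  · have h1 : _root_.lpNorm p (b - a) ≤ 2 ^ (1 / p) := by
      rw [← Real.rpow_le_rpow_iff (lpn_nonneg p _) (by positivity) hp0, lpn_rpow hp, hrp]
      calc _ ≤ ∑ i, (|a i| ^ p + |b i| ^ p) := by
            apply Finset.sum_le_sum
            intro i _
            rw [Pi.sub_apply]
            have hm : |b i - a i| ≤ max |a i| |b i| := by
              have := hab i
              by_cases ha0 : a i = 0
              · simp [ha0]
              by_cases hb0 : b i = 0
              · simp [hb0]
              rw [abs_le]
              rcases le_total 0 (a i) with h | h <;> rcases le_total 0 (b i) with h' | h'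
              · rw [abs_of_nonneg h, abs_of_nonneg h']
                constructor
                · linarith [le_max_left (a i) (b i)]
                · linarith [le_max_right (a i) (b i)]
              · have h3 : a i = 0 ∨ b i = 0 := mul_eq_zero.1 (le_antisymm (mul_nonpos_of_nonneg_of_nonpos h h') this)
                tauto
              · have h3 : a i = 0 ∨ b i = 0 := mul_eq_zero.1 (le_antisymm (mul_nonpos_of_nonpos_of_nonneg h h') this)
                tauto
              · rw [abs_of_nonpos h, abs_of_nonpos h']
                constructor
                · linarith [le_max_right (-a i) (-b i)]
                · linarith [le_max_left (-a i) (-b i)]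
            have hA : 0 ≤ |a i| ^ p := by positivity
            have hB : 0 ≤ |b i| ^ p := by positivity
            have h2 := Real.rpow_le_rpow (abs_nonneg _) hm hp0.le
            rcases max_choice |a i| |b i| with h | h <;> rw [h] at h2 <;> linarith
        _ = 2 := by rw [Finset.sum_add_distrib, hap, hbp]; norm_num
    calc _ ≤ 2 / (2 ^ (1 / p) / 2) * (2:ℝ) ^ (1 / p) := by gcongr
      _ = 4 := by field_simp; norm_num

theorem lpn_single {p : ℝ} (hp : 2 ≤ p) {n : ℕ} (i : Fin n) (σ : ℝ) (hσ : |σ| = 1) :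
    _root_.lpNorm p (Pi.single i σ : Fin n → ℝ) = 1 := by
  have hp0 : p ≠ 0 := by linarith
  unfold _root_.lpNorm
  rw [Finset.sum_eq_single i]
  · simp [hσ]
  · intro j _ hj
    simp [Pi.single_eq_of_ne hj, Real.zero_rpow hp0]
  · simp

theorem path_stB {p : ℝ} (hp : 2 ≤ p) {n d : ℕ} (hn : 3 ≤ n) (M : ℕ → ℝ) (hM : ∀ k, 0 ≤ M k)
    (f : (Fin n → ℝ) → ℝ) (U : Set (Fin n → ℝ)) (hU : IsOpen U)
    (hsub : lpSphere p n ⊆ U) (hf : ContDiffOn ℝ (d : ℕ∞) f U)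
    (htop : ∀ x ∈ lpSphere p n, ∀ v : Fin d → Fin n → ℝ, (∀ i, _root_.lpNorm p (v i) = 1) →
      |iteratedFDeriv ℝ d f x v| ≤ M d)
    (a b : Fin n → ℝ) (ha : a ∈ lpSphere p n) (hb : b ∈ lpSphere p n)
    (h0 : StB p d M f a 0) : StB p d M f b (8 * _root_.lpNorm p (a - b)) := by
  rcases le_or_gt (_root_.lpNorm p (a - b)) (3/2) with h | h
  · have := propagate_seg hp M hM f U hU hsub hf htop a b ha hb (1/4) (8 * _root_.lpNorm p (a - b)) 0
      (by norm_num) le_rfl ?_ ?_ h0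
    · rwa [zero_add] at this
    · intro s hs
      have hnn := lpn_nonneg p (a - b)
      rcases le_total s (1/2) with h2 | h2
      · have h3 := lpn_le_add_sub hp a (a + s • (b - a))
        have e : a - (a + s • (b - a)) = s • (a - b) := by ext i; simp; ring
        rw [e, lpn_smul hp, mem_lpSphere.1 ha, abs_of_nonneg hs.1] at h3
        nlinarith [hs.1]
      · have h3 := lpn_le_add_sub hp b (a + s • (b - a))
        have e : b - (a + s • (b - a)) = (1 - s) • (b - a) := by ext i; simp; ring
        rw [e, lpn_smul hp, mem_lpSphere.1 hb, abs_of_nonneg (by linarith [hs.2]), lpn_sub_comm b a] at h3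
        nlinarith [hs.2]
    · rw [lpn_sub_comm b a]; norm_num
  · let i0 : Fin n := ⟨0, by omega⟩
    let i1 : Fin n := ⟨1, by omega⟩
    have hne : i0 ≠ i1 := by simp [i0, i1]
    have sg : ∀ y : ℝ, ∃ σ : ℝ, |σ| = 1 ∧ 0 ≤ y * σ := by
      intro y
      rcases le_total 0 y with h | h
      · exact ⟨1, by simp, by simpa using h⟩
      · exact ⟨-1, by simp, by simpa using h⟩
    obtain ⟨σ, hσ, hσa⟩ := sg (a i0)
    obtain ⟨σ', hσ', hσb⟩ := sg (b i1)
    have s1 := leg_orth hp M hM f U hU hsub hf htop a (Pi.single i0 σ) ha (lpn_single hp i0 σ hσ) 0 le_rfl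
      (by
        intro i
        by_cases hi : i = i0
        · subst hi; simpa using hσa
        · simp [Pi.single_eq_of_ne hi]) h0
    have s2 := leg_orth hp M hM f U hU hsub hf htop _ (Pi.single i1 σ') (lpn_single hp i0 σ hσ)
      (lpn_single hp i1 σ' hσ') _ (by norm_num)
      (by
        intro i
        by_cases hi : i = i0
        · subst hi; simp [Pi.single_eq_of_ne hne]
        · simp [Pi.single_eq_of_ne hi]) s1
    have s3 := leg_orth hp M hM f U hU hsub hf htop _ b (lpn_single hp i1 σ' hσ') hb _ (by norm_num)
      (by
        intro i
        by_cases hi : i = i1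
        · subst hi; simpa [mul_comm] using hσb
        · simp [Pi.single_eq_of_ne hi]) s2
    exact stB_mono M hM f b _ _ (by norm_num) (by linarith) s3

theorem iteratedFDeriv_sub_const' {n : ℕ} (f : (Fin n → ℝ) → ℝ) (c : ℝ) (k : ℕ) (hk : 1 ≤ k) :
    iteratedFDeriv ℝ k (fun x => f x - c) = iteratedFDeriv ℝ k f := by
  obtain ⟨k, rfl⟩ : ∃ j, k = j + 1 := ⟨k - 1, by omega⟩
  have : fderiv ℝ (fun x => f x - c) = fderiv ℝ f := by
    ext1 x; exact fderiv_sub_const c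
  ext1 x
  rw [iteratedFDeriv_succ_eq_comp_right, iteratedFDeriv_succ_eq_comp_right, this]

theorem path_bound {p : ℝ} (hp : 2 ≤ p) {n d : ℕ} (hn : 3 ≤ n) (hd : 1 ≤ d) (M : ℕ → ℝ)
    (hM : ∀ k, 0 ≤ M k) (hM0 : M 0 = 0)
    (f : (Fin n → ℝ) → ℝ) (U : Set (Fin n → ℝ)) (hU : IsOpen U)
    (hsub : lpSphere p n ⊆ U) (hf : ContDiffOn ℝ (d : ℕ∞) f U)
    (htop : ∀ x ∈ lpSphere p n, ∀ v : Fin d → Fin n → ℝ, (∀ i, _root_.lpNorm p (v i) = 1) →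
      |iteratedFDeriv ℝ d f x v| ≤ M d)
    (a b : Fin n → ℝ) (ha : a ∈ lpSphere p n) (hb : b ∈ lpSphere p n)
    (hk : ∀ k, 1 ≤ k → k < d → ∀ v : Fin k → Fin n → ℝ, (∀ i, _root_.lpNorm p (v i) = 1) →
      |iteratedFDeriv ℝ k f a v| ≤ M k) :
    |f b - f a| ≤ tayP d M 0 (8 * _root_.lpNorm p (a - b)) := by
  have hf' : ContDiffOn ℝ (d : ℕ∞) (fun x => f x - f a) U := hf.sub contDiffOn_const
  have key := path_stB hp hn M hM (fun x => f x - f a) U hU hsub hf'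
    (by rw [iteratedFDeriv_sub_const' f _ d hd]; exact htop) a b ha hb ?_
  · simpa using key 0 (Nat.zero_le _) 0 (fun i => i.elim0)
  · intro k hkd v hv
    rw [tayP_zero]
    rcases Nat.eq_zero_or_pos k with rfl | h
    · simp [hM0]
    · rw [iteratedFDeriv_sub_const' f _ k h]
      rcases hkd.lt_or_eq with h' | rfl
      · exact hk k h h' v hv
      · exact htop a ha v hv


theorem opq_apply_le {p : ℝ} (hp : 2 ≤ p) {n k : ℕ}
    (T : ContinuousMultilinearMap ℝ (fun _ : Fin k => (Fin n → ℝ)) ℝ)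
    (v : Fin k → Fin n → ℝ) (hv : ∀ i, _root_.lpNorm p (v i) = 1) : |T v| ≤ ‖T‖ := by
  have h1 := T.le_opNorm v
  rw [Real.norm_eq_abs] at h1
  refine h1.trans ?_
  have h2 : ∏ i, ‖v i‖ ≤ 1 :=
    Finset.prod_le_one (fun i _ => norm_nonneg _) fun i _ => (norm_le_lpn hp (v i)).trans (hv i).le
  nlinarith [norm_nonneg T]

theorem opq_bdd {p : ℝ} (hp : 2 ≤ p) {n k : ℕ}
    (T : ContinuousMultilinearMap ℝ (fun _ : Fin k => (Fin n → ℝ)) ℝ) :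
    BddAbove {y | ∃ v : Fin k → Fin n → ℝ, (∀ i, _root_.lpNorm p (v i) = 1) ∧ y = T v} := by
  refine ⟨‖T‖, ?_⟩
  rintro y ⟨v, hv, rfl⟩
  exact (le_abs_self _).trans (opq_apply_le hp T v hv)

theorem opq_le {p : ℝ} (hp : 2 ≤ p) {n k : ℕ} (hk : 1 ≤ k)
    (T : ContinuousMultilinearMap ℝ (fun _ : Fin k => (Fin n → ℝ)) ℝ)
    (v : Fin k → Fin n → ℝ) (hv : ∀ i, _root_.lpNorm p (v i) = 1) : |T v| ≤ opNormQ p T := by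
  rw [abs_le']
  refine ⟨le_csSup (opq_bdd hp T) ⟨v, hv, rfl⟩, ?_⟩
  let i0 : Fin k := ⟨0, hk⟩
  refine le_csSup (opq_bdd hp T) ⟨Function.update v i0 ((-1 : ℝ) • v i0), ?_, ?_⟩
  · intro i
    by_cases h : i = i0
    · subst h
      rw [Function.update_self, lpn_smul hp, hv]; norm_num
    · rw [Function.update_of_ne h, hv]
  · rw [T.map_update_smul, Function.update_eq_self]; simp

theorem opq_nonneg {p : ℝ} (hp : 2 ≤ p) {n k : ℕ} (hk : 1 ≤ k)
    (T : ContinuousMultilinearMap ℝ (fun _ : Fin k => (Fin n → ℝ)) ℝ) : 0 ≤ opNormQ p T := by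
  rcases Set.eq_empty_or_nonempty {y | ∃ v : Fin k → Fin n → ℝ, (∀ i, _root_.lpNorm p (v i) = 1) ∧ y = T v} with h | ⟨y, v, hv, _⟩
  · unfold opNormQ; rw [h, Real.sSup_empty]
  · exact (abs_nonneg _).trans (opq_le hp hk T v hv)

theorem opq_continuous {p : ℝ} (hp : 2 ≤ p) {n k : ℕ} :
    Continuous (fun T : ContinuousMultilinearMap ℝ (fun _ : Fin k => (Fin n → ℝ)) ℝ => opNormQ p T) := by
  refine (LipschitzWith.of_le_add (fun T T' => ?_)).continuous
  rcases Set.eq_empty_or_nonempty {y | ∃ v : Fin k → Fin n → ℝ, (∀ i, _root_.lpNorm p (v i) = 1) ∧ y = T v} with h | h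
  · have h' : {y | ∃ v : Fin k → Fin n → ℝ, (∀ i, _root_.lpNorm p (v i) = 1) ∧ y = T' v} = ∅ := by
      rw [Set.eq_empty_iff_forall_notMem] at h ⊢
      rintro y ⟨v, hv, _⟩
      exact h (T v) ⟨v, hv, rfl⟩
    unfold opNormQ
    rw [h, h', Real.sSup_empty]
    simp
  · unfold opNormQ
    refine csSup_le h ?_
    rintro y ⟨v, hv, rfl⟩
    have h1 : T' v ≤ opNormQ p T' := le_csSup (opq_bdd hp T') ⟨v, hv, rfl⟩
    have h2 := (le_abs_self _).trans (opq_apply_le hp (T - T') v hv)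
    rw [_root_.sub_apply] at h2
    rw [dist_eq_norm]
    unfold opNormQ at h1
    linarith

theorem opq_contOn {p : ℝ} (hp : 2 ≤ p) {n d : ℕ}
    (f : (Fin n → ℝ) → ℝ) (U : Set (Fin n → ℝ)) (hU : IsOpen U)
    (hsub : lpSphere p n ⊆ U) (hf : ContDiffOn ℝ (d : ℕ∞) f U) (k : ℕ) (hk : k ≤ d) :
    ContinuousOn (fun x => opNormQ p (iteratedFDeriv ℝ k f x)) (lpSphere p n) := by
  have h1 : ContinuousOn (iteratedFDerivWithin ℝ k f U) U :=
    hf.continuousOn_iteratedFDerivWithin (by exact_mod_cast hk) hU.uniqueDiffOn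
  have h2 : ContinuousOn (iteratedFDeriv ℝ k f) U :=
    h1.congr fun x hx => (iteratedFDerivWithin_of_isOpen k hU hx).symm
  exact (opq_continuous hp).comp_continuousOn (h2.mono hsub)

theorem cone_ae {p : ℝ} (hp : 2 ≤ p) (n : ℕ) (hn : 1 ≤ n) :
    ∀ᵐ x ∂(coneMeasure p n), x ∈ lpSphere p n := cone_compl hp n hn

theorem cone_integrable {p : ℝ} (hp : 2 ≤ p) (n : ℕ) (hn : 1 ≤ n) (g : (Fin n → ℝ) → ℝ)
    (hg : ContinuousOn g (lpSphere p n)) : Integrable g (coneMeasure p n) := by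
  have := cone_prob hp n
  have h1 : IntegrableOn g (lpSphere p n) (coneMeasure p n) :=
    hg.integrableOn_compact (lpSphere_compact hp n)
  rwa [IntegrableOn, Measure.restrict_eq_self_of_ae_mem (cone_ae hp n hn)] at h1

theorem ess_bound {p : ℝ} (hp : 2 ≤ p) (n : ℕ) (hn : 1 ≤ n) (g : (Fin n → ℝ) → ℝ)
    (hg : ContinuousOn g (lpSphere p n)) (x : Fin n → ℝ) (hx : x ∈ lpSphere p n) :
    g x ≤ essSup g (coneMeasure p n) := by
  by_contra hlt
  push Not at hlt
  obtain ⟨K, hK⟩ := (lpSphere_compact hp n).bddAbove_image hg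
  have hb : Filter.IsBoundedUnder (· ≤ ·) (ae (coneMeasure p n)) g := by
    refine ⟨K, ?_⟩
    rw [Filter.eventually_map]
    filter_upwards [cone_ae hp n hn] with y hy
    exact hK ⟨y, hy, rfl⟩
  have hae := ae_le_essSup hb
  obtain ⟨W, hW, hWS⟩ := (continuousOn_iff'.1 hg) (Set.Ioi (essSup g (coneMeasure p n))) isOpen_Ioi
  have hxW : x ∈ W := by
    have : x ∈ g ⁻¹' (Set.Ioi (essSup g (coneMeasure p n))) ∩ lpSphere p n := ⟨hlt, hx⟩
    rw [hWS] at this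
    exact this.1
  apply cone_open_pos hp n W hW x hx hxW
  have h2 : ∀ᵐ y ∂(coneMeasure p n), y ∉ W := by
    filter_upwards [hae, cone_ae hp n hn] with y hy hyS hyW
    have : y ∈ W ∩ lpSphere p n := ⟨hyW, hyS⟩
    rw [← hWS] at this
    exact absurd this.1 (not_lt.2 hy)
  simpa [ae_iff] using h2

theorem markov_q {p : ℝ} (hp : 2 ≤ p) (n : ℕ) (hn : 1 ≤ n) (q : ℝ) (hq : 0 < q) (g : (Fin n → ℝ) → ℝ)
    (hg : ContinuousOn g (lpSphere p n)) (hg0 : ∀ x, 0 ≤ g x) (c R : ℝ) (hc : 0 < c) (hR : 0 < R)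
    (h : (∫ x, g x ^ q ∂(coneMeasure p n)) ^ (1 / q) ≤ R) :
    c ^ q * (coneMeasure p n).real {x | c * R ≤ g x} ≤ 1 := by
  have := cone_prob hp n
  have hi : Integrable (fun x => g x ^ q) (coneMeasure p n) :=
    cone_integrable hp n hn _ (hg.rpow_const fun x _ => Or.inr hq.le)
  have h1 := mul_meas_ge_le_integral_of_nonneg (Filter.Eventually.of_forall fun x => Real.rpow_nonneg (hg0 x) q) hi ((c * R) ^ q)
  have e : {x | (c * R) ^ q ≤ g x ^ q} = {x | c * R ≤ g x} := by
    ext x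
    exact Real.rpow_le_rpow_iff (by positivity) (hg0 x) hq
  have hI : 0 ≤ ∫ x, g x ^ q ∂(coneMeasure p n) := integral_nonneg fun x => Real.rpow_nonneg (hg0 x) q
  have h2 : ∫ x, g x ^ q ∂(coneMeasure p n) ≤ R ^ q := by
    have := Real.rpow_le_rpow (by positivity) h hq.le
    rwa [← Real.rpow_mul hI, one_div, inv_mul_cancel₀ hq.ne', Real.rpow_one] at this
  rw [e, Real.mul_rpow hc.le hR.le] at h1
  have hRq : 0 < R ^ q := by positivity
  have h3 : R ^ q * (c ^ q * (coneMeasure p n).real {x | c * R ≤ g x}) ≤ R ^ q * 1 := by linarith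
  exact le_of_mul_le_mul_left h3 hRq

theorem good_set {p : ℝ} (hp : 2 ≤ p) (n : ℕ) (hn : 1 ≤ n) (q : ℝ) (hq : 0 < q) (d : ℕ) (hd : 1 ≤ d)
    (g : ℕ → (Fin n → ℝ) → ℝ) (hg : ∀ k, 1 ≤ k → k < d → ContinuousOn (g k) (lpSphere p n))
    (hg0 : ∀ k, 1 ≤ k → k < d → ∀ x, 0 ≤ g k x) (c : ℝ) (R : ℕ → ℝ) (hc : 0 < c) (hR : ∀ k, 0 < R k)
    (h : ∀ k, 1 ≤ k → k < d → (∫ x, g k x ^ q ∂(coneMeasure p n)) ^ (1 / q) ≤ R k)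
    (hcd : 4 * ((d : ℝ) - 1) ≤ c ^ q) :
    ∃ G ⊆ lpSphere p n, MeasurableSet G ∧ 3 / 4 ≤ (coneMeasure p n).real G ∧
      ∀ x ∈ G, ∀ k, 1 ≤ k → k < d → g k x ≤ c * R k := by
  have := cone_prob hp n
  set μ := coneMeasure p n with hμ
  let B : ℕ → Set (Fin n → ℝ) := fun k => lpSphere p n ∩ g k ⁻¹' (Set.Ici (c * R k))
  have hBm : MeasurableSet (⋃ k ∈ Finset.Ico 1 d, B k) := by
    refine Finset.measurableSet_biUnion _ fun k hk => ?_
    rw [Finset.mem_Ico] at hk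
    exact ((hg k hk.1 hk.2).preimage_isClosed_of_isClosed (lpSphere_closed hp n) isClosed_Ici).measurableSet
  have hSm : MeasurableSet (lpSphere p n) := (lpSphere_closed hp n).measurableSet
  refine ⟨lpSphere p n \ ⋃ k ∈ Finset.Ico 1 d, B k, Set.sdiff_subset, hSm.diff hBm, ?_, ?_⟩
  · have h1 : μ.real (⋃ k ∈ Finset.Ico 1 d, B k) ≤ ∑ k ∈ Finset.Ico 1 d, μ.real (B k) :=
      measureReal_biUnion_finset_le _ _
    have h2 : ∀ k ∈ Finset.Ico 1 d, c ^ q * μ.real (B k) ≤ 1 := by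
      intro k hk
      rw [Finset.mem_Ico] at hk
      refine le_trans ?_ (markov_q hp n hn q hq (g k) (hg k hk.1 hk.2) (hg0 k hk.1 hk.2) c (R k) hc (hR k) (h k hk.1 hk.2))
      have : μ.real (B k) ≤ μ.real {x | c * R k ≤ g k x} := measureReal_mono (fun x hx => hx.2)
      gcongr
    have hcq : 0 < c ^ q := by positivity
    have h3 : c ^ q * ∑ k ∈ Finset.Ico 1 d, μ.real (B k) ≤ (d : ℝ) - 1 := by
      rw [Finset.mul_sum]
      refine (Finset.sum_le_sum h2).trans ?_
      simp [Nat.cast_sub hd]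
    have h4 : μ.real (⋃ k ∈ Finset.Ico 1 d, B k) ≤ 1 / 4 := by
      have : c ^ q * μ.real (⋃ k ∈ Finset.Ico 1 d, B k) ≤ c ^ q * (1 / 4) := by
        have := mul_le_mul_of_nonneg_left h1 hcq.le
        linarith
      exact le_of_mul_le_mul_left this hcq
    have h5 : μ.real (lpSphere p n) = 1 := by
      rw [measureReal_def, (prob_compl_eq_zero_iff hSm).1 (cone_compl hp n hn)]; rfl
    have h6 := le_measureReal_sdiff (μ := μ) (s₁ := lpSphere p n) (s₂ := ⋃ k ∈ Finset.Ico 1 d, B k) (h := measure_ne_top _ _)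
    linarith
  · rintro x ⟨hx, hxB⟩ k hk1 hk2
    by_contra hlt
    push Not at hlt
    exact hxB (Set.mem_biUnion (Finset.mem_coe.2 (Finset.mem_Ico.2 ⟨hk1, hk2⟩)) ⟨hx, hlt.le⟩)


theorem layer_ptw (v : ℕ → ℝ) (ψ : ℝ) (hv : Monotone v) (b : ℕ → ℝ) (hb : ∀ j, 0 ≤ b j)
    (hb1 : ∀ j, v (j + 1) ≤ ψ → b j = 1) (J : ℕ) :
    min ψ (v (J + 1)) ≤ v 1 + ∑ j ∈ Finset.range J, (v (j + 2) - v (j + 1)) * b j := by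
  induction J with
  | zero => simp
  | succ J ih =>
    rw [Finset.sum_range_succ]
    have h0 : 0 ≤ v (J + 2) - v (J + 1) := sub_nonneg.2 (hv (by omega))
    rcases le_or_gt (v (J + 1)) ψ with h | h
    · rw [hb1 J h]
      rw [min_eq_right h] at ih
      have : min ψ (v (J + 1 + 1)) ≤ v (J + 2) := min_le_right _ _
      linarith
    · rw [min_eq_left h.le] at ih
      have : min ψ (v (J + 1 + 1)) ≤ ψ := min_le_left _ _
      have := mul_nonneg h0 (hb J)
      linarith

theorem layer_int {E : Type*} [MeasurableSpace E] (μ : Measure E) [IsProbabilityMeasure μ]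
    (ψ : E → ℝ) (hψ : Integrable ψ μ) (v : ℕ → ℝ) (hv : Monotone v) (B : ℕ → Set E)
    (hB : ∀ j, MeasurableSet (B j)) (J : ℕ)
    (h1 : ∀ᵐ x ∂μ, ψ x ≤ v (J + 1) ∧ ∀ j, v (j + 1) ≤ ψ x → x ∈ B j) :
    ∫ x, ψ x ∂μ ≤ v 1 + ∑ j ∈ Finset.range J, (v (j + 2) - v (j + 1)) * μ.real (B j) := by
  have hi : ∀ j, Integrable ((B j).indicator (fun _ => (1 : ℝ))) μ := fun j =>
    (integrable_const 1).indicator (hB j)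
  have hi2 : ∀ j ∈ Finset.range J, Integrable (fun x => (v (j + 2) - v (j + 1)) * (B j).indicator (fun _ => (1 : ℝ)) x) μ :=
    fun j _ => (hi j).const_mul _
  have h2 : ∫ x, ψ x ∂μ ≤ ∫ x, (v 1 + ∑ j ∈ Finset.range J, (v (j + 2) - v (j + 1)) *
      (B j).indicator (fun _ => (1 : ℝ)) x) ∂μ := by
    refine integral_mono_ae hψ ((integrable_const _).add (integrable_finsetSum _ hi2)) ?_
    filter_upwards [h1] with x hx
    have := layer_ptw v (ψ x) hv (fun j => (B j).indicator (fun _ => (1 : ℝ)) x)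
      (fun j => Set.indicator_nonneg (fun _ _ => zero_le_one) x)
      (fun j hj => Set.indicator_of_mem (hx.2 j hj) _) J
    rwa [min_eq_left hx.1] at this
  refine h2.trans_eq ?_
  rw [integral_add (integrable_const _) (integrable_finsetSum _ hi2), integral_finsetSum _ hi2]
  congr 1
  · simp
  · refine Finset.sum_congr rfl fun j _ => ?_
    rw [integral_const_mul, integral_indicator_const _ (hB j)]
    simp

theorem cone_conc_real {p : ℝ} (hp : 2 ≤ p) (n : ℕ) (A B : Set (Fin n → ℝ))
    (hA : MeasurableSet A) (hB : MeasurableSet B) (hAS : A ⊆ lpSphere p n) (hBS : B ⊆ lpSphere p n)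
    (ρ : ℝ) (hρ : 0 ≤ ρ) (h : ∀ a ∈ A, ∀ b ∈ B, ρ ≤ _root_.lpNorm p (a - b)) :
    (coneMeasure p n).real A * (coneMeasure p n).real B ≤
      Real.exp (-(2 * n / p) * (ρ / 2) ^ p) := by
  have h1 := cone_conc hp n A B hA hB hAS hBS ρ hρ h
  have h2 := ENNReal.toReal_mono ENNReal.ofReal_ne_top h1
  rwa [ENNReal.toReal_mul, ENNReal.toReal_ofReal (Real.exp_pos _).le] at h2

theorem exp_36 : Real.exp (9/25) ≤ 1434/1000 := by
  have h : Real.exp (9/25) ^ 25 ≤ (1434/1000 : ℝ) ^ 25 := by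
    rw [← Real.exp_nat_mul, show ((25:ℕ):ℝ) * (9/25) = ((9:ℕ):ℝ) * 1 by norm_num, Real.exp_nat_mul]
    have := Real.exp_one_lt_d9
    calc Real.exp 1 ^ 9 ≤ (2.7182818286 : ℝ) ^ 9 := by gcongr
      _ ≤ _ := by norm_num
  exact le_of_pow_le_pow_left₀ (by norm_num) (by norm_num) h

theorem exp_364 : Real.exp (9/25 - 4) ≤ 1/32 := by
  have h : (32:ℝ) ≤ Real.exp (7/2) := by
    have : (32:ℝ)^2 ≤ Real.exp (7/2) ^ 2 := by
      rw [← Real.exp_nat_mul, show ((2:ℕ):ℝ) * (7/2) = ((7:ℕ):ℝ) * 1 by norm_num, Real.exp_nat_mul]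
      have := Real.exp_one_gt_d9
      calc (32:ℝ)^2 ≤ (2.7182818283 : ℝ) ^ 7 := by norm_num
        _ ≤ _ := by gcongr
    exact le_of_pow_le_pow_left₀ (by norm_num) (by positivity) this
  calc Real.exp (9/25 - 4) ≤ Real.exp (-(7/2)) := Real.exp_le_exp.2 (by norm_num)
    _ = 1 / Real.exp (7/2) := by rw [Real.exp_neg, one_div]
    _ ≤ _ := by gcongr

theorem exp_04 : Real.exp (2/5) < 3/2 := by
  have h : Real.exp (2/5) ^ 5 < (3/2 : ℝ) ^ 5 := by
    rw [← Real.exp_nat_mul, show ((5:ℕ):ℝ) * (2/5) = ((2:ℕ):ℝ) * 1 by norm_num, Real.exp_nat_mul]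
    have := Real.exp_one_lt_d9
    calc Real.exp 1 ^ 2 ≤ (2.7182818286 : ℝ) ^ 2 := by gcongr
      _ < _ := by norm_num
  exact lt_of_pow_lt_pow_left₀ 5 (by norm_num) h

theorem geom_num (y t : ℝ) (hy0 : 0 < y) (hy : y ≤ 9/25) (ht : 0 < t) (J : ℕ) (m : ℕ → ℝ)
    (hm : ∀ j, m j ≤ 4 * Real.exp (-4 * ((j + 1 : ℕ) : ℝ))) :
    t * (Real.exp ((1 : ℕ) * y) - 1) + ∑ j ∈ Finset.range J,
      (t * (Real.exp ((j + 2 : ℕ) * y) - 1) - t * (Real.exp ((j + 1 : ℕ) * y) - 1)) * m j < t / 2 := by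
  have hE : Real.exp y ≤ 1434/1000 := (Real.exp_le_exp.2 hy).trans exp_36
  have hE1 : 1 ≤ Real.exp y := Real.one_le_exp hy0.le
  have hr : Real.exp (y - 4) ≤ 1/32 := (Real.exp_le_exp.2 (by linarith)).trans exp_364
  have h1 : ∀ j ∈ Finset.range J,
      (t * (Real.exp ((j + 2 : ℕ) * y) - 1) - t * (Real.exp ((j + 1 : ℕ) * y) - 1)) * m j
      ≤ 4 * t * (Real.exp y - 1) * (1/32 * (1/32) ^ j) := by
    intro j _
    have e1 : Real.exp ((j + 2 : ℕ) * y) = Real.exp ((j + 1 : ℕ) * y) * Real.exp y := by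
      rw [← Real.exp_add]; congr 1; push_cast; ring
    have e2 : t * (Real.exp ((j + 2 : ℕ) * y) - 1) - t * (Real.exp ((j + 1 : ℕ) * y) - 1)
      = t * (Real.exp y - 1) * Real.exp ((j + 1 : ℕ) * y) := by rw [e1]; ring
    rw [e2]
    have e3 : Real.exp ((j + 1 : ℕ) * y) * Real.exp (-4 * ((j + 1 : ℕ) : ℝ)) = Real.exp (y - 4) ^ (j + 1) := by
      rw [← Real.exp_add, ← Real.exp_nat_mul]; congr 1; ring
    have h0 : 0 ≤ t * (Real.exp y - 1) := mul_nonneg ht.le (by linarith)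
    calc _ ≤ t * (Real.exp y - 1) * Real.exp ((j + 1 : ℕ) * y) * (4 * Real.exp (-4 * ((j + 1 : ℕ) : ℝ))) := by
            have := hm j
            gcongr
      _ = 4 * (t * (Real.exp y - 1)) * Real.exp (y - 4) ^ (j + 1) := by rw [← e3]; ring
      _ ≤ 4 * (t * (Real.exp y - 1)) * (1/32) ^ (j + 1) := by gcongr
      _ = _ := by ring
  have h2 := Finset.sum_le_sum h1
  rw [← Finset.mul_sum, ← Finset.mul_sum] at h2
  have h3 : ∑ j ∈ Finset.range J, (1/32 : ℝ) ^ j ≤ 32/31 := by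
    have := geom_sum_eq (show (1/32:ℝ) ≠ 1 by norm_num) J
    rw [this]
    have : (0:ℝ) ≤ (1/32)^J := by positivity
    have e : ((1/32:ℝ)^J - 1) / (1/32 - 1) = 32/31 * (1 - (1/32)^J) := by ring
    rw [e]; linarith
  rw [Nat.cast_one, one_mul]
  have h0 : 0 ≤ t * (Real.exp y - 1) := mul_nonneg ht.le (by linarith)
  have h4 : t * (Real.exp y - 1) ≤ t * (434/1000) := mul_le_mul_of_nonneg_left (by linarith) ht.le
  nlinarith

theorem core_one {p : ℝ} (hp : 2 ≤ p) (n : ℕ) (hn : 1 ≤ n) (f : (Fin n → ℝ) → ℝ)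
    (hf : ContinuousOn f (lpSphere p n)) (hmean : ∫ x, f x ∂(coneMeasure p n) = 0)
    (t : ℝ) (ht : 0 < t) (G : Set (Fin n → ℝ)) (hGS : G ⊆ lpSphere p n) (hGm : MeasurableSet G)
    (hG : 3 / 4 ≤ (coneMeasure p n).real G) (κ h ρ w : ℝ) (hκ : 0 < κ) (hh : 0 < h) (hρ : 0 ≤ ρ)
    (hu : ∀ a ∈ G, ∀ x ∈ lpSphere p n, |f x - f a| ≤ t * (Real.exp (κ * _root_.lpNorm p (a - x)) - 1))
    (hh1 : (2 * n / p) * (h / 2) ^ p = 4) (hh2 : κ * h ≤ 9 / 25)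
    (hρ1 : (2 * n / p) * (ρ / 2) ^ p = 3 * w) (hρ2 : κ * ρ ≤ 2 / 5) :
    (coneMeasure p n).real (lpSphere p n ∩ f ⁻¹' Set.Ici t) ≤ 2 * Real.exp (-(3 * w)) := by
  have := cone_prob hp n
  have hSc := lpSphere_closed hp n
  have hclosed : ∀ s : Set ℝ, IsClosed s → MeasurableSet (lpSphere p n ∩ f ⁻¹' s) := fun s hs =>
    (hf.preimage_isClosed_of_isClosed hSc hs).measurableSet
  have hA1m : MeasurableSet (G ∩ (lpSphere p n ∩ f ⁻¹' Set.Ici (t/2))) := hGm.inter (hclosed _ isClosed_Ici)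
  have hmu1 : (coneMeasure p n).real (G ∩ (lpSphere p n ∩ f ⁻¹' Set.Ici (t/2))) ≤ 1 / 4 := by
    by_contra hlt
    push Not at hlt
    set A' := G ∩ (lpSphere p n ∩ f ⁻¹' Set.Ici (t/2)) with hA'
    set y := κ * h with hy
    have hy0 : 0 < y := by positivity
    let v : ℕ → ℝ := fun j => t * (Real.exp ((j : ℝ) * y) - 1)
    have hv : Monotone v := by
      intro i j hij
      simp only [v]
      have : (i : ℝ) ≤ j := by exact_mod_cast hij
      gcongr
    let B : ℕ → Set (Fin n → ℝ) := fun j => lpSphere p n ∩ f ⁻¹' Set.Iic (t / 2 - v (j + 1))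
    have hBm : ∀ j, MeasurableSet (B j) := fun j => hclosed _ isClosed_Iic
    have hBμ : ∀ j, (coneMeasure p n).real (B j) ≤ 4 * Real.exp (-4 * ((j + 1 : ℕ) : ℝ)) := by
      intro j
      have hc := cone_conc_real hp n A' (B j) hA1m (hBm j) (fun x hx => hx.2.1) (fun x hx => hx.1)
        (((j + 1 : ℕ) : ℝ) * h) (by positivity) (by
          intro a ha b hb
          have h1 := hu a ha.1 b hb.1
          have h2 : t / 2 ≤ f a := ha.2.2
          have h3 : f b ≤ t / 2 - v (j + 1) := hb.2
          have h4 : v (j + 1) ≤ t * (Real.exp (κ * _root_.lpNorm p (a - b)) - 1) := by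
            have := neg_abs_le (f b - f a)
            linarith
          simp only [v] at h4
          have h5 := le_of_mul_le_mul_left h4 ht
          have h6 : Real.exp (((j + 1 : ℕ) : ℝ) * y) ≤ Real.exp (κ * _root_.lpNorm p (a - b)) := by linarith
          rw [Real.exp_le_exp, hy] at h6
          have h7 : κ * (((j + 1 : ℕ) : ℝ) * h) ≤ κ * _root_.lpNorm p (a - b) := by linarith
          exact le_of_mul_le_mul_left h7 hκ)
      have e : -(2 * n / p) * (((j + 1 : ℕ) : ℝ) * h / 2) ^ p = -(4 * ((j + 1 : ℕ) : ℝ) ^ p) := by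
        rw [mul_div_assoc (((j + 1 : ℕ) : ℝ)) h 2, Real.mul_rpow (by positivity) (by positivity), ← hh1]; ring
      rw [e] at hc
      have h8 : ((j + 1 : ℕ) : ℝ) ≤ ((j + 1 : ℕ) : ℝ) ^ p := by
        conv_lhs => rw [← Real.rpow_one ((j + 1 : ℕ) : ℝ)]
        exact Real.rpow_le_rpow_of_exponent_le (by push_cast; linarith [Nat.cast_nonneg (α := ℝ) j]) (by linarith)
      have h9 : Real.exp (-(4 * ((j + 1 : ℕ) : ℝ) ^ p)) ≤ Real.exp (-4 * ((j + 1 : ℕ) : ℝ)) :=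
        Real.exp_le_exp.2 (by linarith)
      have h10 : 0 ≤ (coneMeasure p n).real (B j) := measureReal_nonneg
      nlinarith
    obtain ⟨K, hK⟩ := (lpSphere_compact hp n).bddBelow_image hf
    obtain ⟨J, hJ⟩ := exists_nat_gt ((t / 2 - K) / (t * y))
    have hψi : Integrable (fun x => t / 2 - f x) (coneMeasure p n) :=
      (integrable_const _).sub (cone_integrable hp n hn f hf)
    have hl := layer_int (coneMeasure p n) (fun x => t / 2 - f x) hψi v hv B hBm J (by
      filter_upwards [cone_ae hp n hn] with x hx
      constructor
      · have h1 : K ≤ f x := hK ⟨x, hx, rfl⟩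
        rw [div_lt_iff₀ (by positivity)] at hJ
        have h2 : t * ((J + 1 : ℕ) * y) ≤ v (J + 1) := by
          simp only [v]
          have := Real.add_one_le_exp (((J + 1 : ℕ) : ℝ) * y)
          gcongr
          linarith
        have h3 : (J : ℝ) * (t * y) ≤ t * ((J + 1 : ℕ) * y) := by
          push_cast
          nlinarith [mul_pos ht hy0]
        linarith
      · intro j hj
        refine ⟨hx, ?_⟩
        show f x ≤ _
        linarith)
    have hE : ∫ x, (t / 2 - f x) ∂(coneMeasure p n) = t / 2 := by
      rw [integral_sub (integrable_const _) (cone_integrable hp n hn f hf), hmean]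
      simp
    rw [hE] at hl
    exact absurd (hl.trans_lt (geom_num y t hy0 hh2 ht J (fun j => (coneMeasure p n).real (B j)) hBμ)) (lt_irrefl _)
  set A := G \ (G ∩ (lpSphere p n ∩ f ⁻¹' Set.Ici (t/2))) with hA
  have hAm : MeasurableSet A := hGm.diff hA1m
  have hAμ : 1 / 2 ≤ (coneMeasure p n).real A := by
    have := le_measureReal_sdiff (μ := coneMeasure p n) (s₁ := G)
      (s₂ := G ∩ (lpSphere p n ∩ f ⁻¹' Set.Ici (t/2))) (h := measure_ne_top _ _)
    linarith
  have hc := cone_conc_real hp n A (lpSphere p n ∩ f ⁻¹' Set.Ici t) hAm (hclosed _ isClosed_Ici)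
    (fun x hx => hGS hx.1) (fun x hx => hx.1) ρ hρ (by
      intro a ha b hb
      by_contra hlt
      push Not at hlt
      have h1 := hu a ha.1 b hb.1
      have h2 : f a < t / 2 := by
        by_contra h
        push Not at h
        exact ha.2 ⟨ha.1, hGS ha.1, h⟩
      have h3 : t ≤ f b := hb.2
      have h4 := le_abs_self (f b - f a)
      have h5 : t * (1/2) < t * (Real.exp (κ * _root_.lpNorm p (a - b)) - 1) := by linarith
      have h6 := lt_of_mul_lt_mul_left h5 ht.le
      have h7 : Real.exp (κ * _root_.lpNorm p (a - b)) ≤ Real.exp (2/5) := by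
        apply Real.exp_le_exp.2
        exact (mul_le_mul_of_nonneg_left hlt.le hκ.le).trans hρ2
      linarith [exp_04])
  rw [show -(2 * (n:ℝ) / p) * (ρ / 2) ^ p = -(3 * w) by rw [← hρ1]; ring] at hc
  have h10 : 0 ≤ (coneMeasure p n).real (lpSphere p n ∩ f ⁻¹' Set.Ici t) := measureReal_nonneg
  nlinarith


theorem bpow_lem (p b : ℝ) (hp : 2 ≤ p) (hb : 423/100 ≤ b) : p / 2 * (178/10) ≤ b ^ p := by
  have hb0 : 0 < b := by linarith
  have h1 : p / 2 ≤ Real.exp (p / 2 - 1) := by linarith [Real.add_one_le_exp (p / 2 - 1)]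
  have h2 : Real.exp (p / 2 - 1) ≤ b ^ (p - 2) := by
    rw [show p / 2 - 1 = (1/2) * (p - 2) by ring, Real.exp_mul]
    refine Real.rpow_le_rpow (Real.exp_pos _).le ?_ (by linarith)
    have h3 : Real.exp (1/2) ≤ Real.exp 1 := Real.exp_le_exp.2 (by norm_num)
    linarith [Real.exp_one_lt_d9]
  have h3 : b ^ p = b ^ (p - 2) * b ^ 2 := by
    rw [← Real.rpow_natCast b 2, ← Real.rpow_add hb0]; congr 1; push_cast; ring
  rw [h3]
  have h4 : (178/10 : ℝ) ≤ b ^ 2 := by nlinarith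
  have h5 : 0 ≤ p / 2 := by linarith
  exact mul_le_mul (h1.trans h2) h4 (by norm_num) (by positivity)

theorem CD_lem (p : ℝ) (hp : 2 ≤ p) (d : ℕ) (hd : 1 ≤ d) :
    Real.log 2 ^ p / (3 ^ (p - 1) * 4 ^ (2 * p - 1) * p ^ 2 * (p - 1) ^ (p - 1) *
              (d : ℝ) ^ p * Real.exp 1 ^ p) * ((p - 1) * d) ^ p ≤
      3 * (Real.log 2 / (48 * Real.exp 1)) ^ p := by
  have hl : 0 < Real.log 2 := Real.log_pos (by norm_num)
  have hp1 : 0 < p - 1 := by linarith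
  have hd0 : (0:ℝ) < d := by exact_mod_cast hd
  have he := Real.exp_pos 1
  have e1 : (3:ℝ) ^ (p - 1) = 3 ^ p / 3 := by rw [Real.rpow_sub_one (by norm_num)]
  have e2 : (4:ℝ) ^ (2 * p - 1) = 16 ^ p / 4 := by
    rw [Real.rpow_sub_one (by norm_num), Real.rpow_mul (by norm_num)]; norm_num
  have e3 : (p - 1) ^ (p - 1) = (p - 1) ^ p / (p - 1) := Real.rpow_sub_one hp1.ne' p
  have e4 : (48:ℝ) ^ p = 3 ^ p * 16 ^ p := by rw [← Real.mul_rpow (by norm_num) (by norm_num)]; norm_num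
  rw [e1, e2, e3, Real.mul_rpow hp1.le hd0.le, Real.div_rpow hl.le (by positivity),
    Real.mul_rpow (by norm_num) he.le, e4]
  have a1 : (0:ℝ) < 3 ^ p := by positivity
  have a2 : (0:ℝ) < 16 ^ p := by positivity
  have a3 : 0 < (p - 1) ^ p := by positivity
  have a4 : 0 < (d:ℝ) ^ p := by positivity
  have a5 : 0 < Real.exp 1 ^ p := by positivity
  have a6 : 0 < Real.log 2 ^ p := by positivity
  generalize (3:ℝ) ^ p = A1 at *
  generalize (16:ℝ) ^ p = A2 at *
  generalize (p - 1) ^ p = A3 at *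
  generalize (d:ℝ) ^ p = A4 at *
  generalize Real.exp 1 ^ p = A5 at *
  generalize Real.log 2 ^ p = A6 at *
  have : A6 / (A1 / 3 * (A2 / 4) * p ^ 2 * (A3 / (p - 1)) * A4 * A5) * (A3 * A4)
    = (12 * (p - 1) / p ^ 2) * (A6 / (A1 * A2 * A5)) := by
    field_simp; ring
  rw [this]
  have h3 : 12 * (p - 1) / p ^ 2 ≤ 3 := by
    rw [div_le_iff₀ (by positivity)]; nlinarith [sq_nonneg (p - 2)]
  gcongr

theorem num_one (p C D s : ℝ) (hp : 2 ≤ p) (hD : 0 < D)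
    (h : C * D ^ p ≤ 3 * (Real.log 2 / (48 * Real.exp 1)) ^ p) (hC : 0 < C) (hs : Real.log 2 ≤ C * s) (hs0 : 0 < s) :
    16 * D * (2 * p / s) ^ (1 / p) ≤ 9 / 25 := by
  have hl : 0 < Real.log 2 := Real.log_pos (by norm_num)
  have hp0 : 0 < p := by linarith
  have he := Real.exp_pos 1
  have hb := bpow_lem p (27/25 * Real.exp 1 / Real.log 2) hp (by
    rw [le_div_iff₀ hl]
    have := Real.exp_one_gt_d9
    have := Real.log_two_lt_d9
    linarith)
  have e : (27/25 * Real.exp 1 / Real.log 2) = (9/400) / (Real.log 2 / (48 * Real.exp 1)) := by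
    field_simp; norm_num
  set z := Real.log 2 / (48 * Real.exp 1) with hz
  have hz0 : 0 < z := by positivity
  rw [e, Real.div_rpow (by norm_num) hz0.le, le_div_iff₀ (by positivity)] at hb
  rw [← Real.rpow_le_rpow_iff (by positivity) (by norm_num) hp0, Real.mul_rpow (by positivity) (by positivity),
    ← Real.rpow_mul (by positivity), one_div, inv_mul_cancel₀ hp0.ne', Real.rpow_one,
    Real.mul_rpow (by norm_num) hD.le]
  have e2 : (9/25 : ℝ) ^ p = 16 ^ p * (9/400) ^ p := by
    rw [← Real.mul_rpow (by norm_num) (by norm_num)]; norm_num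
  rw [e2, mul_assoc]
  gcongr
  refine le_trans ?_ hb
  have h1 : 1 / s ≤ C / Real.log 2 := by
    rw [div_le_div_iff₀ hs0 hl]; linarith
  have h12 : 12 / Real.log 2 ≤ 178/10 := by
    rw [div_le_iff₀ hl]; have := Real.log_two_gt_d9; linarith
  have hzp : 0 < z ^ p := by positivity
  calc D ^ p * (2 * p / s) = D ^ p * (2 * p) * (1 / s) := by ring
    _ ≤ D ^ p * (2 * p) * (C / Real.log 2) := by gcongr
    _ = (2 * p / Real.log 2) * (C * D ^ p) := by ring
    _ ≤ (2 * p / Real.log 2) * (3 * z ^ p) := by gcongr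
    _ = p / 2 * (12 / Real.log 2) * z ^ p := by ring
    _ ≤ p / 2 * (178/10) * z ^ p := by gcongr

theorem num_two (p C D : ℝ) (hp : 2 ≤ p) (hD : 0 < D)
    (h : C * D ^ p ≤ 3 * (Real.log 2 / (48 * Real.exp 1)) ^ p) (hC : 0 < C) :
    16 * D * (3 * p * C / 2) ^ (1 / p) ≤ 2 / 5 := by
  have hl : 0 < Real.log 2 := Real.log_pos (by norm_num)
  have hp0 : 0 < p := by linarith
  have he := Real.exp_pos 1
  have hb := bpow_lem p (6/5 * Real.exp 1 / Real.log 2) hp (by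
    rw [le_div_iff₀ hl]
    have := Real.exp_one_gt_d9
    have := Real.log_two_lt_d9
    linarith)
  have e : (6/5 * Real.exp 1 / Real.log 2) = (1/40) / (Real.log 2 / (48 * Real.exp 1)) := by
    field_simp; norm_num
  set z := Real.log 2 / (48 * Real.exp 1) with hz
  have hz0 : 0 < z := by positivity
  rw [e, Real.div_rpow (by norm_num) hz0.le, le_div_iff₀ (by positivity)] at hb
  rw [← Real.rpow_le_rpow_iff (by positivity) (by norm_num) hp0, Real.mul_rpow (by positivity) (by positivity),
    ← Real.rpow_mul (by positivity), one_div, inv_mul_cancel₀ hp0.ne', Real.rpow_one,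
    Real.mul_rpow (by norm_num) hD.le]
  have e2 : (2/5 : ℝ) ^ p = 16 ^ p * (1/40) ^ p := by
    rw [← Real.mul_rpow (by norm_num) (by norm_num)]; norm_num
  rw [e2, mul_assoc]
  gcongr
  refine le_trans ?_ hb
  have hzp : 0 < z ^ p := by positivity
  calc D ^ p * (3 * p * C / 2) = (3 * p / 2) * (C * D ^ p) := by ring
    _ ≤ (3 * p / 2) * (3 * z ^ p) := by gcongr
    _ = p / 2 * 9 * z ^ p := by ring
    _ ≤ p / 2 * (178/10) * z ^ p := by gcongr; norm_num

theorem num_c (p q : ℝ) (hp : 2 ≤ p) (hq : q = p / (p - 1)) (d : ℕ) (hd : 1 ≤ d) :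
    4 * ((d : ℝ) - 1) ≤ ((p - 1) * d) ^ q := by
  have hp1 : 0 < p - 1 := by linarith
  have hd1 : (1:ℝ) ≤ d := by exact_mod_cast hd
  have hd0 : (0:ℝ) < d := by linarith
  rcases hd1.eq_or_lt with h | h
  · rw [← h, sub_self, mul_zero]; positivity
  have hx : 0 < 4 * ((d:ℝ) - 1) := by linarith
  rw [← Real.rpow_le_rpow_iff hx.le (by positivity) hp1, ← Real.rpow_mul (by positivity), hq,
    div_mul_cancel₀ _ hp1.ne', Real.mul_rpow hp1.le hd0.le]
  have h1 : (4 * ((d:ℝ) - 1)) ^ (p - 1) = (4 * ((d:ℝ) - 1)) * (4 * ((d:ℝ) - 1)) ^ (p - 2) := by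
    conv_rhs => rw [← Real.rpow_one_add' hx.le (by linarith)]
    congr 1; ring
  have h2 : (4 * ((d:ℝ) - 1)) ^ (p - 2) ≤ 4 ^ (p - 2) * (d:ℝ) ^ (p - 2) := by
    rw [← Real.mul_rpow (by norm_num) hd0.le]
    exact Real.rpow_le_rpow hx.le (by linarith) (by linarith)
  have h3 : 4 * ((d:ℝ) - 1) ≤ (d:ℝ) ^ 2 := by nlinarith [sq_nonneg ((d:ℝ) - 2)]
  have h4 : (4:ℝ) ^ (p - 2) ≤ (p - 1) ^ p := by
    rw [Real.rpow_def_of_pos (by norm_num), Real.rpow_def_of_pos hp1, Real.exp_le_exp]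
    have h5 := Real.le_log_one_add_of_nonneg (show 0 ≤ p - 2 by linarith)
    rw [show 1 + (p - 2) = p - 1 by ring, show p - 2 + 2 = p by ring, div_le_iff₀ (by linarith)] at h5
    have h6 : Real.log 4 ≤ 2 := by
      rw [show (4:ℝ) = 2 ^ 2 by norm_num, Real.log_pow]
      have := Real.log_two_lt_d9
      push_cast; linarith
    nlinarith
  have h7 : (d:ℝ) ^ p = (d:ℝ) ^ 2 * (d:ℝ) ^ (p - 2) := by
    rw [← Real.rpow_natCast (d:ℝ) 2, ← Real.rpow_add hd0]; congr 1; push_cast; ring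
  calc _ = (4 * ((d:ℝ) - 1)) * (4 * ((d:ℝ) - 1)) ^ (p - 2) := h1
    _ ≤ (d:ℝ) ^ 2 * (4 ^ (p - 2) * (d:ℝ) ^ (p - 2)) := by gcongr
    _ = 4 ^ (p - 2) * (d:ℝ) ^ p := by rw [h7]; ring
    _ ≤ _ := by gcongr

theorem inv_lem (p t N τ : ℝ) (k : ℕ) (hp : 2 ≤ p) (hk : 1 ≤ k) (hN : 0 ≤ N) (ht : 0 ≤ t) (hτ : 0 < τ)
    (h : τ ^ p ≤ (t / N) ^ (p / k)) : 0 < t ∧ N ≤ t / τ ^ k := by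
  have hk0 : (0:ℝ) < k := by exact_mod_cast hk
  have e : τ ^ p = (τ ^ k) ^ (p / k) := by
    rw [← Real.rpow_natCast τ k, ← Real.rpow_mul hτ.le, mul_div_cancel₀ _ hk0.ne']
  have hpk : 0 < p / k := by positivity
  rw [e, Real.rpow_le_rpow_iff (by positivity) (by positivity) hpk] at h
  have hτk : 0 < τ ^ k := by positivity
  have h1 : 0 < t / N := hτk.trans_le h
  have hN0 : 0 < N := by
    rcases hN.eq_or_lt with h2 | h2
    · rw [← h2, div_zero] at h1; exact absurd h1 (lt_irrefl _)
    · exact h2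
  refine ⟨?_, ?_⟩
  · have := mul_pos h1 hN0
    rwa [div_mul_cancel₀ _ hN0.ne'] at this
  · rw [le_div_iff₀ hτk]
    rw [le_div_iff₀ hN0] at h
    linarith

theorem tay_exp (d : ℕ) (D t τ L : ℝ) (hD : 1 ≤ D) (ht : 0 < t) (hτ : 0 < τ) (hL : 0 ≤ L) (M : ℕ → ℝ)
    (hM0 : M 0 = 0) (hM : ∀ k, M (k + 1) = D * (t / τ ^ (k + 1))) :
    tayP d M 0 L ≤ t * (Real.exp (D * (L / τ)) - 1) := by
  have hx : 0 ≤ L / τ := by positivity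
  have h1 := Real.sum_le_exp_of_nonneg hx (d + 1)
  rw [Finset.sum_range_succ'] at h1
  simp only [pow_zero, Nat.factorial_zero, Nat.cast_one, div_one] at h1
  have e : tayP d M 0 L = D * t * ∑ i ∈ Finset.range d, (L / τ) ^ (i + 1) / ((i + 1).factorial : ℝ) := by
    unfold tayP
    rw [Nat.sub_zero, Finset.sum_range_succ', Finset.mul_sum]
    simp only [zero_add, hM0, zero_mul, add_zero]
    refine Finset.sum_congr rfl fun i _ => ?_
    rw [hM, div_pow]
    field_simp
  rw [e]
  have h2 : D * (Real.exp (L / τ) - 1) ≤ Real.exp (D * (L / τ)) - 1 := by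
    have := one_add_mul_self_le_rpow_one_add (s := Real.exp (L / τ) - 1) (by linarith [Real.exp_pos (L / τ)]) hD
    rw [add_sub_cancel, ← Real.exp_mul, mul_comm (L / τ)] at this
    linarith
  calc _ ≤ D * t * (Real.exp (L / τ) - 1) := by gcongr; linarith
    _ = t * (D * (Real.exp (L / τ) - 1)) := by ring
    _ ≤ _ := by gcongr

/-- Theorem 4.6 (2): higher order concentration (tail bound form) for the cone measure on
the `ℓ_p`-sphere. The minimum over `k = 1, …, d` is expressed as an infimum of the
corresponding finite nonempty set. -/
theorem higher_order_tail_bound_cone (p : ℝ) (hp : 2 ≤ p) (q : ℝ) (hq : q = p / (p - 1))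
    (n : ℕ) (hn : 3 ≤ n) (d : ℕ) (hd : 1 ≤ d)
    (f : (Fin n → ℝ) → ℝ) (U : Set (Fin n → ℝ)) (hU : IsOpen U)
    (hsub : {x : Fin n → ℝ | lpNorm p x = 1} ⊆ U) (hf : ContDiffOn ℝ (d : ℕ∞) f U)
    (hmean : ∫ x, f x ∂(coneMeasure p n) = 0)
    (t : ℝ) (ht : 0 ≤ t) :
    coneMeasure p n {x | t ≤ |f x|} ≤
      ENNReal.ofReal (2 * Real.exp
        (-(Real.log 2 ^ p / (3 ^ (p - 1) * 4 ^ (2 * p - 1) * p ^ 2 * (p - 1) ^ (p - 1) *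
              (d : ℝ) ^ p * Real.exp 1 ^ p)) * n *
          sInf (insert ((t / opNormLinfty (coneMeasure p n) p d f) ^ (p / d))
            {y | ∃ k : ℕ, 1 ≤ k ∧ k < d ∧
              y = (t / opNormLq (coneMeasure p n) p q k f) ^ (p / k)}))) := by
  have hprob := cone_prob hp n
  have hp0 : 0 < p := by linarith
  have hp1 : 0 < p - 1 := by linarith
  have hn1 : 1 ≤ n := by omega
  have hn0 : (0:ℝ) < n := by exact_mod_cast hn1
  have hd0 : (0:ℝ) < d := by exact_mod_cast hd
  have hd1 : (1:ℝ) ≤ d := by exact_mod_cast hd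
  have hl : 0 < Real.log 2 := Real.log_pos (by norm_num)
  have hCD := CD_lem p hp d hd
  set C : ℝ := Real.log 2 ^ p / (3 ^ (p - 1) * 4 ^ (2 * p - 1) * p ^ 2 * (p - 1) ^ (p - 1) *
              (d : ℝ) ^ p * Real.exp 1 ^ p) with hC
  have hC0 : 0 < C := by positivity
  set Sset : Set ℝ := insert ((t / opNormLinfty (coneMeasure p n) p d f) ^ (p / d))
            {y | ∃ k : ℕ, 1 ≤ k ∧ k < d ∧
              y = (t / opNormLq (coneMeasure p n) p q k f) ^ (p / k)} with hSset
  set m := sInf Sset with hm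
  rcases lt_or_ge (C * n * m) (Real.log 2) with hsmall | hbig
  · refine prob_le_one.trans ?_
    rw [← ENNReal.ofReal_one]
    apply ENNReal.ofReal_le_ofReal
    have h1 : Real.exp (-Real.log 2) ≤ Real.exp (-C * n * m) := Real.exp_le_exp.2 (by linarith)
    rw [Real.exp_neg, Real.exp_log (by norm_num)] at h1
    linarith
  have hm0 : 0 < m := by
    by_contra h
    push Not at h
    have : C * n * m ≤ 0 := mul_nonpos_of_nonneg_of_nonpos (by positivity) h
    linarith
  have hsub' : lpSphere p n ⊆ U := hsub
  have hq0 : 0 < q := by rw [hq]; positivity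
  let g : ℕ → (Fin n → ℝ) → ℝ := fun k x => opNormQ p (iteratedFDeriv ℝ k f x)
  have hgc : ∀ k ≤ d, ContinuousOn (g k) (lpSphere p n) := fun k hk => opq_contOn hp f U hU hsub' hf k hk
  have hg0 : ∀ k, 1 ≤ k → ∀ x, 0 ≤ g k x := fun k hk x => opq_nonneg hp hk _
  have hess : ∀ x ∈ lpSphere p n, g d x ≤ opNormLinfty (coneMeasure p n) p d f := fun x hx =>
    ess_bound hp n hn1 (g d) (hgc d le_rfl) x hx
  have hNinf : 0 ≤ opNormLinfty (coneMeasure p n) p d f :=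
    (hg0 d hd _).trans (hess (Pi.single ⟨0, by omega⟩ 1) (lpn_single hp _ 1 (by simp)))
  have hNq : ∀ k, 1 ≤ k → 0 ≤ opNormLq (coneMeasure p n) p q k f := by
    intro k hk
    exact Real.rpow_nonneg (integral_nonneg fun x => Real.rpow_nonneg (hg0 k hk x) q) _
  have hbdd : BddBelow Sset := by
    refine ⟨0, ?_⟩
    rintro y (rfl | ⟨k, hk1, _, rfl⟩)
    · exact Real.rpow_nonneg (div_nonneg ht hNinf) _
    · exact Real.rpow_nonneg (div_nonneg ht (hNq k hk1)) _
  set τ := m ^ (1 / p) with hτ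
  have hτ0 : 0 < τ := by positivity
  have hτp : τ ^ p = m := by
    rw [hτ, ← Real.rpow_mul hm0.le, one_div, inv_mul_cancel₀ hp0.ne', Real.rpow_one]
  obtain ⟨ht0, hNd⟩ := inv_lem p t _ τ d hp hd hNinf ht hτ0 (by
    rw [hτp]; exact csInf_le hbdd (Set.mem_insert _ _))
  have hNk : ∀ k, 1 ≤ k → k < d → opNormLq (coneMeasure p n) p q k f ≤ t / τ ^ k := by
    intro k hk1 hk2
    refine (inv_lem p t _ τ k hp hk1 (hNq k hk1) ht hτ0 ?_).2
    rw [hτp]; exact csInf_le hbdd (Set.mem_insert_of_mem _ ⟨k, hk1, hk2, rfl⟩)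
  set D : ℝ := (p - 1) * d with hD
  have hD1 : 1 ≤ D := by rw [hD]; nlinarith
  have hD0 : 0 < D := by linarith
  obtain ⟨G, hGS, hGm, hGμ, hGb⟩ := good_set hp n hn1 q hq0 d hd g
    (fun k _ hk => hgc k hk.le) (fun k hk _ => hg0 k hk) D (fun k => t / τ ^ k) hD0
    (fun k => by positivity) hNk (num_c p q hp hq d hd)
  let M : ℕ → ℝ := fun k => if k = 0 then 0 else D * (t / τ ^ k)
  have hM : ∀ k, 0 ≤ M k := by
    intro k
    simp only [M]
    split_ifs
    · exact le_rfl
    · positivity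
  have hMk : ∀ k, 1 ≤ k → M k = D * (t / τ ^ k) := by
    intro k hk
    simp only [M]
    rw [if_neg (by omega)]
  have hu : ∀ a ∈ G, ∀ x ∈ lpSphere p n,
      |f x - f a| ≤ t * (Real.exp (8 * D / τ * _root_.lpNorm p (a - x)) - 1) := by
    intro a ha x hx
    have h1 := path_bound hp hn hd M hM (by simp [M]) f U hU hsub' hf
      (by
        intro y hy v hv
        refine (opq_le hp hd _ v hv).trans ((hess y hy).trans (hNd.trans ?_))
        rw [hMk d hd]
        exact le_mul_of_one_le_left (by positivity) hD1)
      a x (hGS ha) hx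
      (by
        intro k hk1 hk2 v hv
        refine (opq_le hp hk1 _ v hv).trans ?_
        rw [hMk k hk1]
        exact hGb a ha k hk1 hk2)
    have h2 := tay_exp d D t τ (8 * _root_.lpNorm p (a - x)) hD1 ht0 hτ0
      (mul_nonneg (by norm_num) (lpn_nonneg p _)) M (by simp [M]) (fun k => hMk (k + 1) (by omega))
    refine h1.trans (h2.trans_eq ?_)
    congr 3
    ring
  have hfc : ContinuousOn f (lpSphere p n) := hf.continuousOn.mono hsub'
  have hpow : ∀ x : ℝ, 0 ≤ x → (x ^ (1 / p)) ^ p = x := by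
    intro x hx
    rw [← Real.rpow_mul hx, one_div, inv_mul_cancel₀ hp0.ne', Real.rpow_one]
  set w := C * n * m with hw
  have hh1 : (2 * n / p) * (2 * (2 * p / n) ^ (1 / p) / 2) ^ p = 4 := by
    rw [mul_div_cancel_left₀ _ (two_ne_zero), hpow _ (by positivity)]
    field_simp; norm_num
  have hh2 : 8 * D / τ * (2 * (2 * p / n) ^ (1 / p)) ≤ 9 / 25 := by
    have h1 := num_one p C D (n * m) hp hD0 hCD hC0 (by rw [hw] at hbig; linarith) (by positivity)
    have e : (2 * p / (n * m)) ^ (1 / p) = (2 * p / n) ^ (1 / p) / τ := by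
      rw [hτ, ← Real.div_rpow (by positivity) hm0.le]; congr 1; field_simp
    rw [e] at h1
    refine le_trans (le_of_eq ?_) h1
    ring
  have hρ1 : (2 * n / p) * (2 * ((3 * p * C / 2) ^ (1 / p) * τ) / 2) ^ p = 3 * w := by
    rw [mul_div_cancel_left₀ _ (two_ne_zero), Real.mul_rpow (by positivity) hτ0.le,
      hpow _ (by positivity), hτp, hw]
    field_simp
  have hρ2 : 8 * D / τ * (2 * ((3 * p * C / 2) ^ (1 / p) * τ)) ≤ 2 / 5 := by
    have h1 := num_two p C D hp hD0 hCD hC0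
    refine le_trans (le_of_eq ?_) h1
    field_simp; norm_num
  have k1 := core_one hp n hn1 f hfc hmean t ht0 G hGS hGm hGμ (8 * D / τ) _ _ w (by positivity)
    (by positivity) (by positivity) hu hh1 hh2 hρ1 hρ2
  have k2 := core_one hp n hn1 (fun x => -f x) hfc.neg (by rw [integral_neg, hmean, neg_zero]) t ht0 G hGS
    hGm hGμ (8 * D / τ) _ _ w (by positivity)
    (by positivity) (by positivity) (by
      intro a ha x hx
      have := hu a ha x hx
      rwa [show -f x - -f a = -(f x - f a) by ring, abs_neg]) hh1 hh2 hρ1 hρ2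
  have hle : (coneMeasure p n).real {x | t ≤ |f x|} ≤
      (coneMeasure p n).real (lpSphere p n ∩ f ⁻¹' Set.Ici t) +
      (coneMeasure p n).real (lpSphere p n ∩ (fun x => -f x) ⁻¹' Set.Ici t) := by
    have h0 : (coneMeasure p n).real (lpSphere p n)ᶜ = 0 := by
      rw [measureReal_def, cone_compl hp n hn1]; rfl
    have hs : {x | t ≤ |f x|} ⊆ ((lpSphere p n ∩ f ⁻¹' Set.Ici t) ∪
        (lpSphere p n ∩ (fun x => -f x) ⁻¹' Set.Ici t)) ∪ (lpSphere p n)ᶜ := by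
      intro x hx
      by_cases hxS : x ∈ lpSphere p n
      · left
        rcases le_abs.1 (show t ≤ |f x| from hx) with h | h
        · exact Or.inl ⟨hxS, h⟩
        · exact Or.inr ⟨hxS, h⟩
      · exact Or.inr hxS
    have h1 := measureReal_mono (μ := coneMeasure p n) hs
    have h2 := measureReal_union_le (μ := coneMeasure p n) ((lpSphere p n ∩ f ⁻¹' Set.Ici t) ∪
        (lpSphere p n ∩ (fun x => -f x) ⁻¹' Set.Ici t)) (lpSphere p n)ᶜ
    have h3 := measureReal_union_le (μ := coneMeasure p n) (lpSphere p n ∩ f ⁻¹' Set.Ici t)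
        (lpSphere p n ∩ (fun x => -f x) ⁻¹' Set.Ici t)
    linarith
  have hfin : (coneMeasure p n).real {x | t ≤ |f x|} ≤ 2 * Real.exp (-C * n * m) := by
    have e1 : -C * n * m = -w := by rw [hw]; ring
    have e2 : Real.exp (-(3 * w)) = Real.exp (-w) * (Real.exp (-w) * Real.exp (-w)) := by
      rw [← Real.exp_add, ← Real.exp_add]; congr 1; ring
    have h1 : Real.exp (-w) ≤ 1 / 2 := by
      have : Real.exp (-w) ≤ Real.exp (-Real.log 2) := Real.exp_le_exp.2 (by linarith)
      rw [Real.exp_neg (Real.log 2), Real.exp_log (by norm_num)] at this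
      linarith
    rw [e1]
    rw [e2] at k1 k2
    have h2 := Real.exp_pos (-w)
    have h3 : Real.exp (-w) * Real.exp (-w) ≤ 1 / 4 := by nlinarith
    nlinarith
  rw [measureReal_def] at hfin
  exact (ENNReal.le_ofReal_iff_toReal_le (measure_ne_top _ _) (by positivity)).2 hfin
end

section
/- Let n ≥ 3, p ≥ 2 real, and let m > p be a natural number. Let a = (a₁, …, a_n) ∈ ℝⁿ satisfy |a|_{p/(p−2)} ≤ 1 (where for p = 2 this means max_j |a_j| ≤ 1), and define Q_m(θ) := Σ_{j=1}^n a_j θ_j^m on S_p^{n−1}. Then there exists a constant c_{m,p} > 0 depending only on m and p such that ∫_{S_p^{n−1}} exp( c_{m,p} n |Q_m − ∫ Q_m dμ_{p,n}|^{p/(m − ⌈p⌉ + 1)} ) dμ_{p,n} ≤ 2, where ⌈p⌉ is the smallest integer greater than or equal to p. -/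
open MeasureTheory Real

lemma epc_comb {n N : ℕ} (ν : Measure ℝ) [IsProbabilityMeasure ν] (ξ : Fin n → ℝ → ℝ)
    (hintg : ∀ j k, Integrable (fun x => ξ j x ^ k) ν) (b : ℕ → ℝ) (hb : ∀ k, 0 ≤ b k)
    (hξ : ∀ j k, k ≤ N → |∫ x, ξ j x ^ k ∂ν| ≤ (Nat.factorial k : ℝ) * b k) :
    Integrable (fun x : Fin n → ℝ => (∑ j, ξ j (x j)) ^ N) (Measure.pi (fun _ => ν)) ∧
    ∫ x : Fin n → ℝ, (∑ j, ξ j (x j)) ^ N ∂(Measure.pi (fun _ => ν)) ≤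
      (Nat.factorial N : ℝ) * (∑ k ∈ Finset.range (N + 1), b k) ^ n := by
  have hI : ∀ k : Fin n → ℕ, Integrable (fun x : Fin n → ℝ => ∏ j, ξ j (x j) ^ k j)
      (Measure.pi (fun _ => ν)) := fun k =>
    Integrable.fintype_prod (f := fun j y => ξ j y ^ k j) (fun j => hintg j (k j))
  simp_rw [Finset.sum_pow_eq_sum_piAntidiag (Finset.univ : Finset (Fin n))]
  refine ⟨integrable_finsetSum _ fun k _ => (hI k).const_mul _, ?_⟩
  rw [integral_finsetSum _ fun k _ => (hI k).const_mul _]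
  have hsub : Finset.piAntidiag (Finset.univ : Finset (Fin n)) N ⊆
      Fintype.piFinset (fun _ : Fin n => Finset.range (N + 1)) := by
    intro k hk
    rw [Finset.mem_piAntidiag] at hk
    rw [Fintype.mem_piFinset]
    intro j
    rw [Finset.mem_range, Nat.lt_succ_iff, ← hk.1]
    exact Finset.single_le_sum (f := k) (fun _ _ => Nat.zero_le _) (Finset.mem_univ j)
  have hrhs : (∑ k ∈ Finset.range (N + 1), b k) ^ n =
      ∑ k ∈ Fintype.piFinset (fun _ : Fin n => Finset.range (N + 1)), ∏ j, b (k j) := by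
    rw [← Finset.prod_univ_sum]; simp
  rw [hrhs, Finset.mul_sum]
  refine le_trans (Finset.sum_le_sum (g := fun k => (Nat.factorial N : ℝ) * ∏ j, b (k j)) ?_)
    (Finset.sum_le_sum_of_subset_of_nonneg hsub fun k _ _ =>
      mul_nonneg (Nat.cast_nonneg _) (Finset.prod_nonneg fun _ _ => hb _))
  intro k hk
  have hkN : ∀ j, k j ≤ N := fun j => by
    have := Fintype.mem_piFinset.1 (hsub hk) j
    rw [Finset.mem_range] at this; omega
  rw [integral_const_mul, integral_fintype_prod_eq_prod (f := fun j y => ξ j y ^ k j)]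
  have h1 : (∏ j, ∫ y, ξ j y ^ k j ∂ν) ≤ ∏ j, ((Nat.factorial (k j) : ℝ) * b (k j)) := by
    refine (le_abs_self _).trans ?_
    rw [Finset.abs_prod]
    exact Finset.prod_le_prod (fun _ _ => abs_nonneg _) (fun j _ => hξ j (k j) (hkN j))
  refine (mul_le_mul_of_nonneg_left h1 (Nat.cast_nonneg _)).trans (le_of_eq ?_)
  rw [Finset.prod_mul_distrib, ← mul_assoc]
  congr 1
  have := Nat.multinomial_spec (Finset.univ : Finset (Fin n)) k
  rw [(Finset.mem_piAntidiag.1 hk).1] at this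
  rw [← this]; push_cast; ring

/-- power mean inequality for `[0,1]`-valued functions -/
lemma epc_pm {Ω : Type} [MeasurableSpace Ω] (μ : Measure Ω) [IsProbabilityMeasure μ]
    (h : Ω → ℝ) (hm : Measurable h) (h0 : ∀ x, 0 ≤ h x) (h1 : ∀ᵐ x ∂μ, h x ≤ 1)
    (w : ℝ) (hw : 1 ≤ w) : ∫ x, h x ∂μ ≤ (∫ x, h x ^ w ∂μ) ^ (1 / w) := by
  have hi : Integrable h μ := by
    refine Integrable.of_bound hm.aestronglyMeasurable 1 ?_
    filter_upwards [h1] with x hx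
    rw [Real.norm_eq_abs, abs_of_nonneg (h0 x)]; exact hx
  have hi2 : Integrable (fun x => h x ^ w) μ := by
    refine Integrable.of_bound (hm.pow_const w).aestronglyMeasurable 1 ?_
    filter_upwards [h1] with x hx
    rw [Real.norm_eq_abs, abs_of_nonneg (Real.rpow_nonneg (h0 x) _)]
    exact Real.rpow_le_one (h0 x) hx (by linarith)
  have hJ := (convexOn_rpow hw).map_integral_le (μ := μ) (f := h)
    (Real.continuous_rpow_const (by linarith)).continuousOn isClosed_Ici
    (Filter.Eventually.of_forall fun x => h0 x) hi hi2
  have hn : 0 ≤ ∫ x, h x ∂μ := integral_nonneg h0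
  calc ∫ x, h x ∂μ = ((∫ x, h x ∂μ) ^ w) ^ (1 / w) := by
        rw [← Real.rpow_mul hn, mul_one_div_cancel (by linarith), Real.rpow_one]
    _ ≤ _ := Real.rpow_le_rpow (Real.rpow_nonneg hn _) hJ (by positivity)

lemma epc_pow_le_fact (l : ℕ) : (l : ℝ) ^ l ≤ Real.exp 1 ^ l * (Nat.factorial l : ℝ) := by
  have h := Real.pow_div_factorial_le_exp (l : ℝ) (Nat.cast_nonneg l) l
  rw [div_le_iff₀ (by positivity)] at h
  rwa [← Real.exp_nat_mul, mul_one]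

lemma epc_final (κ α C : ℝ) (hκ : 0 < κ) (hα : 1 ≤ κ * α) (hC : 1 ≤ C) :
    ∃ c : ℝ, 0 < c ∧ ∀ {Ω : Type} [MeasurableSpace Ω] (μ : Measure Ω) [IsProbabilityMeasure μ]
      (f : Ω → ℝ) (n : ℕ), 1 ≤ n → Measurable f → (∀ᵐ x ∂μ, |f x| ≤ 2) →
      (∀ l : ℕ, 1 ≤ l → l ≤ n → ∫ x, |f x| ^ (2 * l) ∂μ ≤ (C * ((l : ℝ) / n) ^ κ) ^ (2 * l)) →
      ∫ x, Real.exp (c * n * |f x| ^ α) ∂μ ≤ 2 := by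
  have hα0 : 0 < α := by
    by_contra h
    push Not at h
    nlinarith
  set D : ℝ := C ^ (1 / κ) * (1 / κ + 1) with hD
  have hD0 : 0 < D := by positivity
  set c : ℝ := 1 / (2 * 2 ^ α * D * Real.exp 1) with hc
  have hc0 : 0 < c := by positivity
  refine ⟨c, hc0, ?_⟩
  intro Ω _ μ _ f n hn hf hf2 hmom
  have hn0 : (0 : ℝ) < n := by exact_mod_cast hn
  set g : Ω → ℝ := fun x => |f x| / 2 with hg
  have hgm : Measurable g := (hf.abs).div_const 2
  have hg0 : ∀ x, 0 ≤ g x := fun x => by positivity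
  have hg1 : ∀ᵐ x ∂μ, g x ≤ 1 := by
    filter_upwards [hf2] with x hx
    simp only [hg]; linarith
  have bdd : ∀ (s : ℝ), 0 ≤ s → Integrable (fun x => g x ^ s) μ := by
    intro s hs
    refine Integrable.of_bound (hgm.pow_const s).aestronglyMeasurable 1 ?_
    filter_upwards [hg1] with x hx
    rw [Real.norm_eq_abs, abs_of_nonneg (Real.rpow_nonneg (hg0 x) _)]
    exact Real.rpow_le_one (hg0 x) hx hs
  -- even moments of g
  have hgmom : ∀ L : ℕ, 1 ≤ L → ∫ x, g x ^ ((2 * L : ℕ) : ℝ) ∂μ ≤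
      (C * ((L : ℝ) / n) ^ κ) ^ (2 * L) := by
    intro L hL
    rcases le_or_gt L n with h | h
    · refine le_trans (integral_mono_ae (bdd _ (by positivity)) ?_ ?_) (hmom L hL h)
      · refine Integrable.of_bound (hf.abs.pow_const _).aestronglyMeasurable (2 ^ (2 * L)) ?_
        filter_upwards [hf2] with x hx
        rw [Real.norm_eq_abs, abs_of_nonneg (by positivity)]
        exact pow_le_pow_left₀ (abs_nonneg _) hx _
      · refine Filter.Eventually.of_forall fun x => ?_
        simp only [Real.rpow_natCast]
        refine pow_le_pow_left₀ (hg0 x) ?_ _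
        simp only [hg]
        linarith [abs_nonneg (f x)]
    · have h1 : ∫ x, g x ^ ((2 * L : ℕ) : ℝ) ∂μ ≤ ∫ x, (1 : ℝ) ∂μ := by
        refine integral_mono_ae (bdd _ (by positivity)) (integrable_const _) ?_
        filter_upwards [hg1] with x hx
        exact Real.rpow_le_one (hg0 x) hx (by positivity)
      refine h1.trans ?_
      simp only [integral_const, probReal_univ, smul_eq_mul, mul_one]
      apply one_le_pow₀
      have : (1 : ℝ) ≤ (L : ℝ) / n := by
        rw [le_div_iff₀ hn0, one_mul]; exact_mod_cast h.le
      have := Real.one_le_rpow this hκ.le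
      nlinarith
  have hgu : ∀ l : ℕ, 1 ≤ l → ∫ x, g x ^ ((l : ℝ) / κ) ∂μ ≤ (D * l / n) ^ l := by
    intro l hl
    have hl0 : (0 : ℝ) < l := by exact_mod_cast hl
    have hl1 : (1 : ℝ) ≤ l := by exact_mod_cast hl
    set u : ℝ := (l : ℝ) / κ with hu
    have hu0 : 0 < u := by positivity
    set L : ℕ := ⌈u⌉₊ with hLdef
    have hL1 : 1 ≤ L := Nat.one_le_ceil_iff.2 hu0
    have hL0 : (0 : ℝ) < L := by exact_mod_cast hL1
    have hLu : u ≤ L := Nat.le_ceil u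
    have hLu2 : (L : ℝ) ≤ u + 1 := (Nat.ceil_lt_add_one hu0.le).le
    have hw : 1 ≤ ((2 * L : ℕ) : ℝ) / u := by
      rw [le_div_iff₀ hu0]; push_cast; linarith
    have h1 := epc_pm μ (fun x => g x ^ u) (hgm.pow_const u)
      (fun x => Real.rpow_nonneg (hg0 x) _)
      (by filter_upwards [hg1] with x hx using Real.rpow_le_one (hg0 x) hx hu0.le) _ hw
    have h2 : ∀ x, (g x ^ u) ^ (((2 * L : ℕ) : ℝ) / u) = g x ^ ((2 * L : ℕ) : ℝ) := fun x => by
      rw [← Real.rpow_mul (hg0 x), mul_div_cancel₀ _ hu0.ne']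
    simp only [h2] at h1
    refine h1.trans ?_
    refine (Real.rpow_le_rpow (integral_nonneg fun x => Real.rpow_nonneg (hg0 x) _)
      (hgmom L hL1) (by positivity)).trans ?_
    have hB : 0 ≤ C * ((L : ℝ) / n) ^ κ := by positivity
    rw [← Real.rpow_natCast (C * ((L : ℝ) / n) ^ κ), ← Real.rpow_mul hB]
    have h3 : ((2 * L : ℕ) : ℝ) * (1 / (((2 * L : ℕ) : ℝ) / u)) = u := by
      push_cast; field_simp
    rw [h3, Real.mul_rpow (by positivity) (by positivity), ← Real.rpow_mul (by positivity)]
    have h4 : κ * u = l := by rw [hu]; field_simp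
    rw [h4, Real.rpow_natCast]
    have h5 : C ^ u = (C ^ (1 / κ)) ^ l := by
      rw [← Real.rpow_natCast, ← Real.rpow_mul (by positivity)]
      congr 1; rw [hu]; ring
    rw [h5, ← mul_pow]
    refine pow_le_pow_left₀ (by positivity) ?_ _
    rw [hD, ← mul_div_assoc]
    refine div_le_div_of_nonneg_right ?_ hn0.le
    rw [mul_assoc]
    refine mul_le_mul_of_nonneg_left ?_ (by positivity)
    refine hLu2.trans ?_
    rw [hu, add_mul, one_mul]
    have : (l : ℝ) / κ = 1 / κ * l := by ring
    linarith
  set Y : Ω → ℝ := fun x => c * n * |f x| ^ α with hY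
  have hY0 : ∀ x, 0 ≤ Y x := fun x => by positivity
  have hYg : ∀ x, Y x = c * n * 2 ^ α * g x ^ α := fun x => by
    simp only [hY, hg]
    rw [Real.div_rpow (abs_nonneg _) (by norm_num)]
    have : (2 : ℝ) ^ α ≠ 0 := by positivity
    field_simp
  have hterm : ∀ l : ℕ, ∀ x, Y x ^ l / (Nat.factorial l : ℝ) =
      ((c * n * 2 ^ α) ^ l / (Nat.factorial l : ℝ)) * g x ^ (α * l) := fun l x => by
    rw [hYg, mul_pow, ← Real.rpow_natCast (g x ^ α), ← Real.rpow_mul (hg0 x)]; ring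
  have hYint : ∀ l : ℕ, Integrable (fun x => Y x ^ l / (Nat.factorial l : ℝ)) μ := fun l => by
    simp only [hterm]
    exact (bdd _ (by positivity)).const_mul _
  have hYl : ∀ l : ℕ, ∫ x, Y x ^ l / (Nat.factorial l : ℝ) ∂μ ≤ (1 / 2) ^ l := by
    intro l
    rcases Nat.eq_zero_or_pos l with rfl | hl
    · simp
    simp only [hterm]
    rw [integral_const_mul]
    have h1 : ∫ x, g x ^ (α * l) ∂μ ≤ (D * l / n) ^ l := by
      refine le_trans (integral_mono_ae (bdd _ (by positivity)) (bdd _ (by positivity)) ?_) (hgu l hl)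
      filter_upwards [hg1] with x hx
      refine Real.rpow_le_rpow_of_exponent_ge' (hg0 x) hx (by positivity) ?_
      rw [div_le_iff₀ hκ]
      have : (0 : ℝ) ≤ l := by positivity
      nlinarith
    refine (mul_le_mul_of_nonneg_left h1 (by positivity)).trans ?_
    rw [div_mul_eq_mul_div, ← mul_pow, div_le_iff₀ (by positivity)]
    have h2 : c * n * 2 ^ α * (D * l / n) = (1 / (2 * Real.exp 1)) * l := by
      rw [hc]; field_simp
    rw [h2, mul_pow]
    refine (mul_le_mul_of_nonneg_left (epc_pow_le_fact l) (by positivity)).trans (le_of_eq ?_)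
    rw [← mul_assoc, ← mul_pow]
    congr 2
    field_simp
  have hnorm : ∀ l, ∫ x, ‖Y x ^ l / (Nat.factorial l : ℝ)‖ ∂μ =
      ∫ x, Y x ^ l / (Nat.factorial l : ℝ) ∂μ := fun l => by
    congr 1; ext x
    rw [Real.norm_eq_abs, abs_of_nonneg]
    have := hY0 x; positivity
  have hsum : Summable fun l => ∫ x, Y x ^ l / (Nat.factorial l : ℝ) ∂μ := by
    refine Summable.of_nonneg_of_le (fun l => integral_nonneg fun x => ?_) hYl summable_geometric_two
    have := hY0 x; positivity
  have hexp : ∀ x, Real.exp (Y x) = ∑' l : ℕ, Y x ^ l / (Nat.factorial l : ℝ) := fun x => by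
    rw [Real.exp_eq_exp_ℝ, NormedSpace.exp_eq_tsum_div]
  calc ∫ x, Real.exp (Y x) ∂μ = ∫ x, ∑' l : ℕ, Y x ^ l / (Nat.factorial l : ℝ) ∂μ := by
        simp only [hexp]
    _ = ∑' l : ℕ, ∫ x, Y x ^ l / (Nat.factorial l : ℝ) ∂μ := by
        rw [← integral_tsum_of_summable_integral_norm hYint]
        simpa only [hnorm] using hsum
    _ ≤ ∑' l : ℕ, (1 / 2 : ℝ) ^ l := hsum.tsum_le_tsum hYl summable_geometric_two
    _ = 2 := tsum_geometric_two

lemma epc_integrable_half (p : ℝ) (hp : 2 ≤ p) :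
    Integrable (fun x : ℝ => Real.exp (-(|x| ^ p / 2))) := by
  have h := (integrable_exp_neg_mul_sq (b := 1 / 2) (by norm_num)).const_mul (Real.exp (1 / 2))
  have hc : Continuous (fun x : ℝ => Real.exp (-(|x| ^ p / 2))) := by
    have : Continuous (fun x : ℝ => |x| ^ p) :=
      (Real.continuous_rpow_const (by linarith)).comp continuous_abs
    fun_prop
  refine h.mono' hc.aestronglyMeasurable (Filter.Eventually.of_forall fun x => ?_)
  rw [Real.norm_eq_abs, abs_of_pos (Real.exp_pos _), ← Real.exp_add]
  apply Real.exp_le_exp.2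
  have : x ^ 2 - 1 ≤ |x| ^ p := by
    rcases le_or_gt |x| 1 with h1 | h1
    · have : 0 ≤ |x| ^ p := by positivity
      have := sq_abs x
      nlinarith [abs_nonneg x]
    · have := Real.rpow_le_rpow_of_exponent_le h1.le hp
      rw [Real.rpow_two, sq_abs] at this
      linarith
  linarith

/-- normalising constant -/
noncomputable def epcZ (p : ℝ) : ℝ := ∫ x : ℝ, Real.exp (-|x| ^ p)

/-- the density -/
noncomputable def epcW (p : ℝ) (x : ℝ) : ℝ := Real.exp (-|x| ^ p) / epcZ p

/-- the `p`-generalised Gaussian measure on the line -/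
noncomputable def epcNu (p : ℝ) : Measure ℝ :=
  volume.withDensity (fun x => ENNReal.ofReal (epcW p x))

lemma epc_cont (p : ℝ) (hp : 2 ≤ p) : Continuous (fun x : ℝ => Real.exp (-|x| ^ p)) := by
  have : Continuous (fun x : ℝ => |x| ^ p) :=
    (Real.continuous_rpow_const (by linarith)).comp continuous_abs
  fun_prop

lemma epc_integrable_exp (p : ℝ) (hp : 2 ≤ p) :
    Integrable (fun x : ℝ => Real.exp (-|x| ^ p)) := by
  refine (epc_integrable_half p hp).mono' (epc_cont p hp).aestronglyMeasurable
    (Filter.Eventually.of_forall fun x => ?_)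
  rw [Real.norm_eq_abs, abs_of_pos (Real.exp_pos _)]
  apply Real.exp_le_exp.2
  have : 0 ≤ |x| ^ p := by positivity
  linarith

lemma epcZ_pos (p : ℝ) (hp : 2 ≤ p) : 0 < epcZ p :=
  integral_exp_pos (epc_integrable_exp p hp)

lemma epcW_cont (p : ℝ) (hp : 2 ≤ p) : Continuous (epcW p) := (epc_cont p hp).div_const _

lemma epcW_pos (p : ℝ) (hp : 2 ≤ p) (x : ℝ) : 0 < epcW p x :=
  div_pos (Real.exp_pos _) (epcZ_pos p hp)

lemma epcW_integrable (p : ℝ) (hp : 2 ≤ p) : Integrable (epcW p) :=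
  (epc_integrable_exp p hp).div_const _

lemma epcNu_prob (p : ℝ) (hp : 2 ≤ p) : IsProbabilityMeasure (epcNu p) := by
  refine ⟨?_⟩
  rw [epcNu, withDensity_apply _ MeasurableSet.univ, Measure.restrict_univ,
    ← ofReal_integral_eq_lintegral_ofReal (epcW_integrable p hp)
      (Filter.Eventually.of_forall fun x => (epcW_pos p hp x).le)]
  have : ∫ x, epcW p x = 1 := by
    simp only [epcW]
    rw [integral_div]
    exact div_self (epcZ_pos p hp).ne'
  rw [this, ENNReal.ofReal_one]

/-- moment constant -/
noncomputable def epcK (p : ℝ) : ℝ := (∫ x : ℝ, Real.exp (-(|x| ^ p / 2))) / epcZ p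

lemma epcK_ge_one (p : ℝ) (hp : 2 ≤ p) : 1 ≤ epcK p := by
  rw [epcK, le_div_iff₀ (epcZ_pos p hp), one_mul, epcZ]
  refine integral_mono (epc_integrable_exp p hp) (epc_integrable_half p hp) fun x => ?_
  apply Real.exp_le_exp.2
  have : 0 ≤ |x| ^ p := by positivity
  linarith

lemma epc_pointwise (p : ℝ) (hp : 2 ≤ p) (s : ℝ) (hs : 0 < s) (x : ℝ) :
    |x| ^ s * Real.exp (-|x| ^ p) ≤ (2 * s / p) ^ (s / p) * Real.exp (-(|x| ^ p / 2)) := by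
  have hp0 : 0 < p := by linarith
  set t := s / p with ht
  have ht0 : 0 < t := by positivity
  set y := |x| ^ p with hy
  have hy0 : 0 ≤ y := by positivity
  have h1 : |x| ^ s = y ^ t := by
    rw [hy, ← Real.rpow_mul (abs_nonneg x), ht, mul_div_cancel₀ _ hp0.ne']
  have h2 : 2 * s / p = 2 * t := by rw [ht]; ring
  rw [h1, h2]
  have h3 : y / (2 * t) ≤ Real.exp (y / (2 * t)) := by
    linarith [Real.add_one_le_exp (y / (2 * t))]
  have h4 : (y / (2 * t)) ^ t ≤ Real.exp (y / 2) := by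
    refine (Real.rpow_le_rpow (by positivity) h3 ht0.le).trans (le_of_eq ?_)
    rw [← Real.exp_mul]; congr 1; field_simp
  rw [Real.div_rpow hy0 (by positivity), div_le_iff₀ (by positivity)] at h4
  have h5 : Real.exp (-y) = Real.exp (-(y / 2)) * Real.exp (-(y / 2)) := by
    rw [← Real.exp_add]; congr 1; ring
  calc y ^ t * Real.exp (-y) ≤ (Real.exp (y / 2) * (2 * t) ^ t) * Real.exp (-y) := by gcongr
    _ = (2 * t) ^ t * (Real.exp (y / 2) * Real.exp (-(y / 2))) * Real.exp (-(y / 2)) := by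
      rw [h5]; ring
    _ = _ := by rw [← Real.exp_add]; simp

lemma epcNu_integrable_iff (p : ℝ) (hp : 2 ≤ p) (f : ℝ → ℝ) :
    Integrable f (epcNu p) ↔ Integrable (fun x => f x * epcW p x) := by
  rw [epcNu, integrable_withDensity_iff (epcW_cont p hp).measurable.ennreal_ofReal
    (Filter.Eventually.of_forall fun x => ENNReal.ofReal_lt_top)]
  simp only [ENNReal.toReal_ofReal (epcW_pos p hp _).le]

lemma epcNu_integral (p : ℝ) (hp : 2 ≤ p) (f : ℝ → ℝ) :
    ∫ x, f x ∂(epcNu p) = ∫ x, f x * epcW p x := by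
  rw [epcNu, integral_withDensity_eq_integral_toReal_smul
    (epcW_cont p hp).measurable.ennreal_ofReal
    (Filter.Eventually.of_forall fun x => ENNReal.ofReal_lt_top)]
  simp only [ENNReal.toReal_ofReal (epcW_pos p hp _).le, smul_eq_mul, mul_comm]

lemma epcNu_moment (p : ℝ) (hp : 2 ≤ p) (s : ℝ) (hs : 0 < s) :
    Integrable (fun x => |x| ^ s) (epcNu p) ∧
    ∫ x, |x| ^ s ∂(epcNu p) ≤ epcK p * (2 * s / p) ^ (s / p) := by
  have hZ := epcZ_pos p hp
  have hpt : ∀ x : ℝ, |x| ^ s * epcW p x ≤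
      (2 * s / p) ^ (s / p) * Real.exp (-(|x| ^ p / 2)) / epcZ p := fun x => by
    rw [epcW, ← mul_div_assoc]
    exact div_le_div_of_nonneg_right (epc_pointwise p hp s hs x) hZ.le
  have hR : Integrable (fun x : ℝ =>
      (2 * s / p) ^ (s / p) * Real.exp (-(|x| ^ p / 2)) / epcZ p) :=
    ((epc_integrable_half p hp).const_mul _).div_const _
  have hc : Continuous (fun x : ℝ => |x| ^ s * epcW p x) :=
    ((Real.continuous_rpow_const hs.le).comp continuous_abs).mul (epcW_cont p hp)
  have hL : Integrable (fun x : ℝ => |x| ^ s * epcW p x) := by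
    refine hR.mono' hc.aestronglyMeasurable (Filter.Eventually.of_forall fun x => ?_)
    rw [Real.norm_eq_abs, abs_of_nonneg (mul_nonneg (by positivity) (epcW_pos p hp x).le)]
    exact hpt x
  refine ⟨(epcNu_integrable_iff p hp _).2 hL, ?_⟩
  rw [epcNu_integral p hp]
  refine (integral_mono hL hR hpt).trans (le_of_eq ?_)
  rw [integral_div, integral_const_mul, epcK]; ring

lemma epc_pi_eq (p : ℝ) (hp : 2 ≤ p) (n : ℕ) :
    Measure.pi (fun _ : Fin n => epcNu p) =
      volume.withDensity (fun x : Fin n → ℝ => ENNReal.ofReal (∏ i, epcW p (x i))) := by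
  have := epcNu_prob p hp
  refine Measure.pi_eq fun s hs => ?_
  rw [withDensity_apply _ (MeasurableSet.univ_pi hs), volume_pi, Measure.restrict_pi_pi]
  rw [← ofReal_integral_eq_lintegral_ofReal
    (Integrable.fintype_prod (f := fun _ y => epcW p y)
      fun i => (epcW_integrable p hp).integrableOn)
    (Filter.Eventually.of_forall fun x => Finset.prod_nonneg fun i _ => (epcW_pos p hp _).le)]
  rw [integral_fintype_prod_eq_prod (f := fun _ y => epcW p y),
    ENNReal.ofReal_prod_of_nonneg fun i _ => integral_nonneg fun x => (epcW_pos p hp _).le]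
  refine Finset.prod_congr rfl fun i _ => ?_
  rw [epcNu, withDensity_apply _ (hs i),
    ← ofReal_integral_eq_lintegral_ofReal (epcW_integrable p hp).integrableOn
      (Filter.Eventually.of_forall fun x => (epcW_pos p hp x).le)]


/-- radial projection -/
noncomputable def epcDir (p : ℝ) {n : ℕ} (x : Fin n → ℝ) : Fin n → ℝ := (lpNorm p x)⁻¹ • x

lemma epc_lpNorm_meas (p : ℝ) (n : ℕ) : Measurable (fun x : Fin n → ℝ => lpNorm p x) := by
  unfold _root_.lpNorm
  have : ∀ i, Measurable (fun x : Fin n → ℝ => |x i| ^ p) := fun i =>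
    ((measurable_pi_apply i).abs).pow_const p
  exact (Finset.measurable_sum _ fun i _ => this i).pow_const _

lemma epc_dir_meas (p : ℝ) (n : ℕ) : Measurable (fun x : Fin n → ℝ => epcDir p x) :=
  (epc_lpNorm_meas p n).inv.smul measurable_id

lemma epc_lpNorm_nonneg (p : ℝ) {n : ℕ} (x : Fin n → ℝ) : 0 ≤ lpNorm p x := by
  unfold _root_.lpNorm; positivity

lemma epc_lpNorm_rpow (p : ℝ) (hp : 2 ≤ p) {n : ℕ} (x : Fin n → ℝ) :
    lpNorm p x ^ p = ∑ i, |x i| ^ p := by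
  unfold _root_.lpNorm
  rw [← Real.rpow_mul (by positivity), one_div_mul_cancel (by linarith), Real.rpow_one]

lemma epc_lpNorm_smul (p : ℝ) (hp : 2 ≤ p) {n : ℕ} (t : ℝ) (ht : 0 ≤ t) (x : Fin n → ℝ) :
    lpNorm p (t • x) = t * lpNorm p x := by
  unfold _root_.lpNorm
  have : ∀ i, |(t • x) i| ^ p = t ^ p * |x i| ^ p := fun i => by
    rw [Pi.smul_apply, smul_eq_mul, abs_mul, abs_of_nonneg ht,
      Real.mul_rpow ht (abs_nonneg _)]
  simp only [this]
  rw [← Finset.mul_sum, Real.mul_rpow (by positivity) (by positivity), ← Real.rpow_mul ht,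
    mul_one_div_cancel (by linarith), Real.rpow_one]

lemma epc_lpNorm_eq_zero (p : ℝ) (hp : 2 ≤ p) {n : ℕ} (x : Fin n → ℝ) (h : lpNorm p x = 0) :
    x = 0 := by
  have h1 := epc_lpNorm_rpow p hp x
  rw [h, Real.zero_rpow (by linarith)] at h1
  have h2 := (Finset.sum_eq_zero_iff_of_nonneg (fun i _ => by positivity)).1 h1.symm
  ext i
  have h3 := h2 i (Finset.mem_univ i)
  rw [Real.rpow_eq_zero (abs_nonneg _) (by linarith)] at h3
  simpa using h3

lemma epc_norm_smul_dir (p : ℝ) (hp : 2 ≤ p) {n : ℕ} (x : Fin n → ℝ) :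
    lpNorm p x • epcDir p x = x := by
  unfold epcDir
  rcases eq_or_ne (lpNorm p x) 0 with h | h
  · rw [epc_lpNorm_eq_zero p hp x h]; simp
  · rw [smul_smul, mul_inv_cancel₀ h, one_smul]

lemma epc_dir_smul (p : ℝ) (hp : 2 ≤ p) {n : ℕ} (t : ℝ) (ht : 0 < t) (x : Fin n → ℝ) :
    epcDir p (t • x) = epcDir p x := by
  unfold epcDir
  rw [epc_lpNorm_smul p hp t ht.le, smul_smul]
  congr 1
  field_simp

lemma epc_ball_vol (p : ℝ) (hp : 2 ≤ p) (n : ℕ) (hn : 1 ≤ n) (t : ℝ) :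
    volume {x : Fin n → ℝ | lpNorm p x ≤ t} ≠ ⊤ ∧
    (0 < t → volume {x : Fin n → ℝ | lpNorm p x ≤ t} ≠ 0) ∧
    (t ≤ 0 → volume {x : Fin n → ℝ | lpNorm p x ≤ t} = 0) := by
  have : Nonempty (Fin n) := ⟨⟨0, hn⟩⟩
  have h := volume_sum_rpow_le (ι := Fin n) (p := p) (by linarith) t
  have h' : volume {x : Fin n → ℝ | lpNorm p x ≤ t} = _ := h
  rw [h']
  have hG : 0 < (2 * Real.Gamma (1 / p + 1)) ^ Fintype.card (Fin n) /
      Real.Gamma (Fintype.card (Fin n) / p + 1) := by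
    have h1 : 0 < Real.Gamma (1 / p + 1) := Real.Gamma_pos_of_pos (by positivity)
    have h2 : 0 < Real.Gamma (Fintype.card (Fin n) / p + 1) := Real.Gamma_pos_of_pos (by positivity)
    positivity
  refine ⟨ENNReal.mul_ne_top (ENNReal.pow_ne_top ENNReal.ofReal_ne_top) ENNReal.ofReal_ne_top,
    fun ht => mul_ne_zero (pow_ne_zero _ ?_) ?_, fun ht => ?_⟩
  · simpa using ht
  · simpa using hG
  · rw [ENNReal.ofReal_of_nonpos ht, zero_pow, zero_mul]
    simp; omega

lemma epc_cone_apply (p : ℝ) (n : ℕ) (B : Set (Fin n → ℝ)) (hB : MeasurableSet B) :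
    coneMeasure p n B = (volume {x : Fin n → ℝ | lpNorm p x ≤ 1})⁻¹ *
      volume (epcDir p ⁻¹' B ∩ {x : Fin n → ℝ | lpNorm p x ≤ 1}) := by
  unfold coneMeasure
  have hm : Measurable (fun x : Fin n → ℝ => (lpNorm p x)⁻¹ • x) := epc_dir_meas p n
  rw [Measure.map_apply hm hB, Measure.smul_apply, smul_eq_mul,
    Measure.restrict_apply (hm hB)]
  rfl

lemma epc_cone_prob (p : ℝ) (hp : 2 ≤ p) (n : ℕ) (hn : 1 ≤ n) :
    IsProbabilityMeasure (coneMeasure p n) := by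
  refine ⟨?_⟩
  rw [epc_cone_apply p n _ MeasurableSet.univ, Set.preimage_univ, Set.univ_inter]
  exact ENNReal.inv_mul_cancel ((epc_ball_vol p hp n hn 1).2.1 one_pos) (epc_ball_vol p hp n hn 1).1

lemma epc_cone_ae (p : ℝ) (hp : 2 ≤ p) (n : ℕ) :
    ∀ᵐ θ ∂(coneMeasure p n), ∑ i, |θ i| ^ p ≤ 1 := by
  unfold coneMeasure
  have hm : Measurable (fun x : Fin n → ℝ => (lpNorm p x)⁻¹ • x) := epc_dir_meas p n
  rw [ae_map_iff hm.aemeasurable]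
  · refine Filter.Eventually.of_forall fun x => ?_
    rw [← epc_lpNorm_rpow p hp, epc_lpNorm_smul p hp _ (inv_nonneg.2 (epc_lpNorm_nonneg p x))]
    refine Real.rpow_le_one ?_ inv_mul_le_one (by linarith)
    have := epc_lpNorm_nonneg p x
    positivity
  · refine measurableSet_le (Finset.measurable_sum _ fun i _ => ?_) measurable_const
    exact ((measurable_pi_apply i).abs).pow_const p

lemma epc_scale (p : ℝ) (hp : 2 ≤ p) (n : ℕ) (t : ℝ) (ht : 0 < t) (B : Set (Fin n → ℝ)) :
    volume (epcDir p ⁻¹' B ∩ {x : Fin n → ℝ | lpNorm p x ≤ t}) =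
      ENNReal.ofReal |t ^ n| *
        volume (epcDir p ⁻¹' B ∩ {x : Fin n → ℝ | lpNorm p x ≤ 1}) := by
  have h := Measure.addHaar_smul (volume : Measure (Fin n → ℝ)) t
    (epcDir p ⁻¹' B ∩ {x : Fin n → ℝ | lpNorm p x ≤ 1})
  rw [Module.finrank_fin_fun] at h
  rw [← h]
  congr 1
  ext x
  rw [Set.mem_smul_set_iff_inv_smul_mem₀ ht.ne']
  simp only [Set.mem_inter_iff, Set.mem_preimage, Set.mem_ofPred_eq]
  rw [epc_dir_smul p hp _ (inv_pos.2 ht), epc_lpNorm_smul p hp _ (inv_pos.2 ht).le,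
    inv_mul_le_iff₀ ht, mul_one]

lemma epc_Iic (p : ℝ) (hp : 2 ≤ p) (n : ℕ) (hn : 1 ≤ n) (t : ℝ) (B : Set (Fin n → ℝ))
    (hB : MeasurableSet B) :
    volume (epcDir p ⁻¹' B ∩ {x : Fin n → ℝ | lpNorm p x ≤ t}) =
      coneMeasure p n B * volume {x : Fin n → ℝ | lpNorm p x ≤ t} := by
  rcases le_or_gt t 0 with ht | ht
  · have h0 := (epc_ball_vol p hp n hn t).2.2 ht
    rw [h0, mul_zero]
    exact measure_mono_null Set.inter_subset_right h0
  · have h1 := epc_scale p hp n t ht Set.univ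
    rw [Set.preimage_univ, Set.univ_inter, Set.univ_inter] at h1
    rw [epc_scale p hp n t ht B, h1, epc_cone_apply p n B hB]
    have h2 := (epc_ball_vol p hp n hn 1).1
    have h3 := (epc_ball_vol p hp n hn 1).2.1 one_pos
    set V := volume {x : Fin n → ℝ | lpNorm p x ≤ 1}
    rw [show ∀ a b c : ENNReal, (a * b) * (c * V) = (a * V) * (c * b) by intros; ring,
      ENNReal.inv_mul_cancel h3 h2, one_mul]

lemma epc_radial (p : ℝ) (hp : 2 ≤ p) (n : ℕ) (hn : 1 ≤ n) (B : Set (Fin n → ℝ))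
    (hB : MeasurableSet B) :
    (volume.restrict (epcDir p ⁻¹' B)).map (fun x : Fin n → ℝ => lpNorm p x) =
      coneMeasure p n B • (volume : Measure (Fin n → ℝ)).map (fun x => lpNorm p x) := by
  have hN := epc_lpNorm_meas p n
  have hD := epc_dir_meas p n
  have := epc_cone_prob p hp n hn
  have key : ∀ t, ((volume.restrict (epcDir p ⁻¹' B)).map (fun x : Fin n → ℝ => lpNorm p x))
      (Set.Iic t) = (coneMeasure p n B •
        (volume : Measure (Fin n → ℝ)).map (fun x => lpNorm p x)) (Set.Iic t) := by
    intro t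
    rw [Measure.map_apply hN measurableSet_Iic, Measure.smul_apply,
      Measure.map_apply hN measurableSet_Iic, Measure.restrict_apply (hN measurableSet_Iic),
      smul_eq_mul, Set.inter_comm]
    exact epc_Iic p hp n hn t B hB
  have fin : ∀ t, ((volume.restrict (epcDir p ⁻¹' B)).map (fun x : Fin n → ℝ => lpNorm p x))
      (Set.Iic t) ≠ ⊤ := by
    intro t
    rw [Measure.map_apply hN measurableSet_Iic]
    exact ne_top_of_le_ne_top (epc_ball_vol p hp n hn t).1 (Measure.restrict_apply_le _ _)
  refine Measure.ext_of_Ioc' _ _ (fun a b _ => ne_top_of_le_ne_top (fin b)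
    (measure_mono Set.Ioc_subset_Iic_self)) fun a b hab => ?_
  rw [← Set.Iic_sdiff_Iic, measure_sdiff (Set.Iic_subset_Iic.2 hab.le)
    measurableSet_Iic.nullMeasurableSet (fin a), measure_sdiff (Set.Iic_subset_Iic.2 hab.le)
    measurableSet_Iic.nullMeasurableSet (key a ▸ fin a), key, key]

lemma epc_polar (p : ℝ) (hp : 2 ≤ p) (n : ℕ) (hn : 1 ≤ n) :
    (Measure.pi (fun _ : Fin n => epcNu p)).map (fun x => (lpNorm p x, epcDir p x)) =
      ((Measure.pi (fun _ : Fin n => epcNu p)).map (fun x => lpNorm p x)).prod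
        (coneMeasure p n) := by
  have hN := epc_lpNorm_meas p n
  have hD := epc_dir_meas p n
  have := epc_cone_prob p hp n hn
  have := epcNu_prob p hp
  have : IsProbabilityMeasure
      ((Measure.pi (fun _ : Fin n => epcNu p)).map (fun x => lpNorm p x)) :=
    Measure.isProbabilityMeasure_map hN.aemeasurable
  symm
  refine Measure.prod_eq fun A B hA hB => ?_
  rw [Measure.map_apply (hN.prodMk hD) (hA.prod hB), Measure.map_apply hN hA]
  set φ : ℝ → ENNReal := fun r => ENNReal.ofReal (Real.exp (-r ^ p) / epcZ p ^ n) with hφ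
  have hφm : Measurable φ := by
    refine Measurable.ennreal_ofReal ?_
    have : Measurable (fun r : ℝ => r ^ p) := measurable_id.pow_const p
    fun_prop
  have hγ : Measure.pi (fun _ : Fin n => epcNu p) =
      volume.withDensity (fun x : Fin n → ℝ => φ (lpNorm p x)) := by
    rw [epc_pi_eq p hp n]
    congr 1
    ext x
    simp only [hφ, epcW]
    rw [epc_lpNorm_rpow p hp, Finset.prod_div_distrib, ← Real.exp_sum, Finset.sum_neg_distrib]
    simp
  have hset : (fun x : Fin n → ℝ => (lpNorm p x, epcDir p x)) ⁻¹' (A ×ˢ B) =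
      (fun x : Fin n → ℝ => lpNorm p x) ⁻¹' A ∩ epcDir p ⁻¹' B := by
    ext x; simp
  have hA' := hN hA
  rw [hset, hγ, withDensity_apply _ (hA'.inter (hD hB)), withDensity_apply _ hA',
    ← Measure.restrict_restrict hA']
  have e1 : ∀ m : Measure (Fin n → ℝ), ∫⁻ x in (fun x : Fin n → ℝ => lpNorm p x) ⁻¹' A,
      φ (lpNorm p x) ∂m = ∫⁻ r in A, φ r ∂(m.map (fun x => lpNorm p x)) := fun m => by
    rw [setLIntegral_map hA hφm hN]
  rw [e1, e1, epc_radial p hp n hn B hB, Measure.restrict_smul, lintegral_smul_measure,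
    smul_eq_mul, mul_comm]


lemma epc_J (p : ℝ) (hp : 2 ≤ p) (n : ℕ) (hn : 1 ≤ n) (s : ℝ)
    (F : (Fin n → ℝ) → ℝ) (hF : Measurable F)
    (hom : ∀ t : ℝ, 0 ≤ t → ∀ x, F (t • x) = t ^ s * F x)
    (hb : ∀ᵐ θ ∂(coneMeasure p n), |F θ| ≤ 1)
    (hR : Integrable (fun x : Fin n → ℝ => lpNorm p x ^ s) (Measure.pi (fun _ => epcNu p)))
    (R : ℝ) (hRdef : R = ∫ x : Fin n → ℝ, lpNorm p x ^ s ∂(Measure.pi (fun _ => epcNu p))) :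
    ∫ x, F x ∂(Measure.pi (fun _ => epcNu p)) = R * ∫ θ, F θ ∂(coneMeasure p n) ∧
    ∀ (v : ℝ) (l : ℕ),
      Integrable (fun x => (F x - R * v) ^ (2 * l)) (Measure.pi (fun _ => epcNu p)) →
      R ^ (2 * l) * ∫ θ, |F θ - v| ^ (2 * l) ∂(coneMeasure p n) ≤
        ∫ x, (F x - R * v) ^ (2 * l) ∂(Measure.pi (fun _ => epcNu p)) := by
  have hN := epc_lpNorm_meas p n
  have hD := epc_dir_meas p n
  have := epc_cone_prob p hp n hn
  have := epcNu_prob p hp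
  have hpol := epc_polar p hp n hn
  set γ := Measure.pi (fun _ : Fin n => epcNu p) with hγ
  set μ := coneMeasure p n with hμ
  set ρ := γ.map (fun x => lpNorm p x) with hρ
  have : IsProbabilityMeasure ρ := Measure.isProbabilityMeasure_map hN.aemeasurable
  have hFx : ∀ x, F x = lpNorm p x ^ s * F (epcDir p x) := fun x => by
    conv_lhs => rw [← epc_norm_smul_dir p hp x]
    exact hom _ (epc_lpNorm_nonneg p x) _
  have hND : Measurable (fun x : Fin n → ℝ => (lpNorm p x, epcDir p x)) := hN.prodMk hD
  have hpow : Measurable (fun r : ℝ => r ^ s) := measurable_id.pow_const s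
  have hRρ : ∫ r, r ^ s ∂ρ = R := by
    rw [hρ, integral_map hN.aemeasurable hpow.aestronglyMeasurable, hRdef]
  have hRi : Integrable (fun r : ℝ => r ^ s) ρ := by
    rw [hρ, integrable_map_measure hpow.aestronglyMeasurable hN.aemeasurable]
    exact hR
  constructor
  · have h1 : ∫ x, F x ∂γ = ∫ x, (fun y : ℝ × (Fin n → ℝ) => y.1 ^ s * F y.2)
        (lpNorm p x, epcDir p x) ∂γ := by
      congr 1; ext x; exact hFx x
    have hm : Measurable (fun y : ℝ × (Fin n → ℝ) => y.1 ^ s * F y.2) :=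
      (hpow.comp measurable_fst).mul (hF.comp measurable_snd)
    rw [h1, ← integral_map hND.aemeasurable hm.aestronglyMeasurable, hpol,
      integral_prod_mul (fun r : ℝ => r ^ s) F, hRρ]
  · intro v l hI
    set G : ℝ × (Fin n → ℝ) → ℝ := fun y => (y.1 ^ s * F y.2 - R * v) ^ (2 * l) with hG
    have hm : Measurable G :=
      (((hpow.comp measurable_fst).mul (hF.comp measurable_snd)).sub_const _).pow_const _
    have hGx : (fun x => (F x - R * v) ^ (2 * l)) =
        G ∘ (fun x : Fin n → ℝ => (lpNorm p x, epcDir p x)) := by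
      ext x; simp only [hG, Function.comp]; rw [← hFx x]
    have hGi : Integrable G (ρ.prod μ) := by
      rw [← hpol, integrable_map_measure hm.aestronglyMeasurable hND.aemeasurable, ← hGx]
      exact hI
    have h2 : ∫ x, (F x - R * v) ^ (2 * l) ∂γ = ∫ θ, ∫ r, G (r, θ) ∂ρ ∂μ := by
      rw [hGx]
      change ∫ x : Fin n → ℝ, G (lpNorm p x, epcDir p x) ∂γ = _
      rw [← integral_map hND.aemeasurable hm.aestronglyMeasurable, hpol,
        integral_prod_symm _ hGi]
    rw [h2, ← integral_const_mul]
    refine integral_mono_ae ?_ hGi.integral_prod_right ?_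
    · refine Integrable.const_mul ?_ _
      refine Integrable.of_bound (((hF.sub_const v).abs).pow_const _).aestronglyMeasurable
        ((1 + |v|) ^ (2 * l)) ?_
      filter_upwards [hb] with θ hθ
      rw [Real.norm_eq_abs, abs_of_nonneg (by positivity)]
      refine pow_le_pow_left₀ (abs_nonneg _) ?_ _
      exact (abs_sub _ _).trans (by linarith)
    · filter_upwards [hGi.prod_left_ae] with θ hθ
      have hi : Integrable (fun r : ℝ => r ^ s * F θ - R * v) ρ :=
        (hRi.mul_const _).sub (integrable_const _)
      have hJ := ((even_two_mul l).convexOn_pow (𝕜 := ℝ)).map_integral_le (μ := ρ)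
        (f := fun r : ℝ => r ^ s * F θ - R * v) (continuous_pow _).continuousOn isClosed_univ
        (Filter.Eventually.of_forall fun _ => Set.mem_univ _) hi hθ
      refine le_trans (le_of_eq ?_) hJ
      rw [integral_sub (hRi.mul_const _) (integrable_const _), integral_mul_const, hRρ]
      simp only [integral_const, probReal_univ, smul_eq_mul, one_mul]
      rw [(even_two_mul l).pow_abs, ← mul_pow]
      congr 1; ring

lemma epc_beta_pos (p : ℝ) (hp : 2 ≤ p) : 0 < ∫ x, |x| ^ p ∂(epcNu p) := by
  have h := (epcNu_moment p hp p (by linarith)).1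
  rw [epcNu_integrable_iff p hp] at h
  rw [epcNu_integral p hp]
  have hc : Continuous (fun x : ℝ => |x| ^ p * epcW p x) :=
    ((Real.continuous_rpow_const (by linarith)).comp continuous_abs).mul (epcW_cont p hp)
  refine integral_pos_of_integrable_nonneg_nonzero (x := 1) hc h
    (fun x => mul_nonneg (by positivity) (epcW_pos p hp x).le) ?_
  simpa using (epcW_pos p hp 1).ne'

lemma epcNu_moment' (p : ℝ) (hp : 2 ≤ p) (s : ℝ) (hs : 0 < s) (k : ℕ) :
    Integrable (fun x => (|x| ^ s) ^ k) (epcNu p) := by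
  have := epcNu_prob p hp
  rcases Nat.eq_zero_or_pos k with rfl | hk
  · simp
  · have h := (epcNu_moment p hp (s * k) (by positivity)).1
    refine h.congr (Filter.Eventually.of_forall fun x => ?_)
    simp only
    rw [Real.rpow_mul (abs_nonneg x), Real.rpow_natCast]

lemma epc_R (p : ℝ) (hp : 2 ≤ p) (n m : ℕ) (hm : 2 ≤ m) (s : ℝ) (hs : s = p * (m / 2)) :
    Integrable (fun x : Fin n → ℝ => lpNorm p x ^ s) (Measure.pi (fun _ => epcNu p)) ∧
    (n * ∫ x, |x| ^ p ∂(epcNu p)) ^ ((m : ℝ) / 2) ≤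
      ∫ x : Fin n → ℝ, lpNorm p x ^ s ∂(Measure.pi (fun _ => epcNu p)) := by
  have := epcNu_prob p hp
  have hm2 : (1 : ℝ) ≤ (m : ℝ) / 2 := by
    have : (2 : ℝ) ≤ m := by exact_mod_cast hm
    linarith
  have hpow : ∀ x : Fin n → ℝ, lpNorm p x ^ s = (∑ i, |x i| ^ p) ^ ((m : ℝ) / 2) := fun x => by
    rw [hs, Real.rpow_mul (epc_lpNorm_nonneg p x), epc_lpNorm_rpow p hp]
  have hI1 := fun N => (epc_comb (n := n) (N := N) (epcNu p) (fun _ x => |x| ^ p)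
    (fun _ k => epcNu_moment' p hp p (by linarith) k)
    (fun k => |∫ x, (|x| ^ p) ^ k ∂(epcNu p)| / Nat.factorial k)
    (fun k => by positivity)
    (fun j k _ => by rw [mul_div_cancel₀]; positivity)).1
  have hI : Integrable (fun x : Fin n → ℝ => lpNorm p x ^ s) (Measure.pi (fun _ => epcNu p)) := by
    refine ((integrable_const (1 : ℝ)).add (hI1 m)).mono'
      ((epc_lpNorm_meas p n).pow_const s).aestronglyMeasurable
      (Filter.Eventually.of_forall fun x => ?_)
    rw [hpow, Real.norm_eq_abs, abs_of_nonneg (by positivity)]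
    have hy : 0 ≤ ∑ i, |x i| ^ p := by positivity
    simp only [Pi.add_apply]
    set y := ∑ i, |x i| ^ p
    rcases le_or_gt y 1 with h | h
    · have := Real.rpow_le_one hy h (by linarith : 0 ≤ (m : ℝ) / 2)
      have : 0 ≤ y ^ m := by positivity
      linarith
    · have := Real.rpow_le_rpow_of_exponent_le h.le (by linarith : (m : ℝ) / 2 ≤ m)
      rw [Real.rpow_natCast] at this
      linarith
  refine ⟨hI, ?_⟩
  simp only [hpow] at hI ⊢
  have h1 := hI1 1
  simp only [pow_one] at h1
  have hJ := (convexOn_rpow hm2).map_integral_le (μ := Measure.pi (fun _ : Fin n => epcNu p))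
    (f := fun x => ∑ i, |x i| ^ p)
    (Real.continuous_rpow_const (by linarith)).continuousOn isClosed_Ici
    (Filter.Eventually.of_forall fun x => by
      simp only [Set.mem_Ici]; positivity) h1 hI
  refine le_trans (le_of_eq ?_) hJ
  congr 1
  have h2 : ∀ i : Fin n, Integrable (fun x : Fin n → ℝ => |x i| ^ p)
      (Measure.pi (fun _ => epcNu p)) := fun i =>
    integrable_comp_eval (μ := fun _ : Fin n => epcNu p) (i := i) (f := fun y : ℝ => |y| ^ p) (epcNu_moment p hp p (by linarith)).1
  rw [integral_finsetSum _ fun i _ => h2 i]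
  have h3 : ∀ i : Fin n, ∫ x : Fin n → ℝ, |x i| ^ p ∂(Measure.pi (fun _ => epcNu p)) =
      ∫ x, |x| ^ p ∂(epcNu p) := fun i =>
    integral_comp_eval (μ := fun _ : Fin n => epcNu p) (i := i) (f := fun y : ℝ => |y| ^ p)
      (epcNu_moment p hp p (by linarith)).1.aestronglyMeasurable
  simp [h3]

lemma epc_geom (N : ℕ) (y : ℝ) (h0 : 0 ≤ y) (h1 : y ≤ 1 / 2) :
    ∑ k ∈ Finset.range N, y ^ k ≤ 1 + 2 * y := by
  have h := geom_sum_mul y N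
  have : 0 ≤ y ^ N := by positivity
  nlinarith [mul_nonneg h0 (by linarith : 0 ≤ 1 / 2 - y)]

lemma epc_nc {n l : ℕ} (hl : 1 ≤ l) (hln : l ≤ n) (ν : Measure ℝ) [IsProbabilityMeasure ν]
    (ξ : Fin n → ℝ → ℝ) (hintg : ∀ j k, Integrable (fun x => ξ j x ^ k) ν) (A : ℝ) (hA : 0 < A)
    (hξ : ∀ j k, k ≤ 2 * l → |∫ x, ξ j x ^ k ∂ν| ≤ (Nat.factorial k : ℝ) * A ^ k) :
    Integrable (fun x : Fin n → ℝ => (∑ j, ξ j (x j)) ^ (2 * l)) (Measure.pi (fun _ => ν)) ∧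
    ∫ x : Fin n → ℝ, (∑ j, ξ j (x j)) ^ (2 * l) ∂(Measure.pi (fun _ => ν)) ≤
      (4 * Real.exp 1 * A * n) ^ (2 * l) := by
  have hl0 : (0 : ℝ) < l := by exact_mod_cast hl
  have hln' : (l : ℝ) ≤ n := by exact_mod_cast hln
  have hn0 : (0 : ℝ) < n := by linarith
  set y : ℝ := l / (2 * n) with hy
  have hy0 : 0 < y := by positivity
  have hy1 : y ≤ 1 / 2 := by
    rw [hy, div_le_div_iff₀ (by positivity) (by norm_num)]; linarith
  have h1 := epc_comb (N := 2 * l) ν (fun j x => (y / A) * ξ j x)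
    (fun j k => by simp only [mul_pow]; exact (hintg j k).const_mul _) (fun k => y ^ k)
    (fun k => by positivity)
    (fun j k hk => by
      simp only [mul_pow]
      rw [integral_const_mul, abs_mul, abs_of_pos (by positivity)]
      refine (mul_le_mul_of_nonneg_left (hξ j k hk) (by positivity)).trans (le_of_eq ?_)
      rw [div_pow]; field_simp)
  have e1 : ∀ x : Fin n → ℝ, (∑ j, (y / A) * ξ j (x j)) ^ (2 * l) =
      (y / A) ^ (2 * l) * (∑ j, ξ j (x j)) ^ (2 * l) := fun x => by
    rw [← Finset.mul_sum, mul_pow]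
  have hne : (y / A) ^ (2 * l) ≠ 0 := by positivity
  simp only [e1] at h1
  refine ⟨(integrable_const_mul_iff (IsUnit.mk0 _ hne) _).1 h1.1, ?_⟩
  have h2 := h1.2
  rw [integral_const_mul] at h2
  have h3 : (∑ k ∈ Finset.range (2 * l + 1), y ^ k) ^ n ≤ Real.exp 1 ^ l := by
    have : ∑ k ∈ Finset.range (2 * l + 1), y ^ k ≤ Real.exp (2 * y) := by
      have := epc_geom (2 * l + 1) y hy0.le hy1
      linarith [Real.add_one_le_exp (2 * y)]
    refine (pow_le_pow_left₀ (Finset.sum_nonneg fun k _ => by positivity) this n).trans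
      (le_of_eq ?_)
    rw [← Real.exp_nat_mul, ← Real.exp_nat_mul]
    congr 1; rw [hy]; field_simp
  have h4 : ((Nat.factorial (2 * l) : ℕ) : ℝ) ≤ ((2 * l : ℕ) : ℝ) ^ (2 * l) := by
    exact_mod_cast Nat.factorial_le_pow (2 * l)
  have h5 : Real.exp 1 ^ l ≤ Real.exp 1 ^ (2 * l) :=
    pow_le_pow_right₀ (Real.one_le_exp zero_le_one) (by omega)
  have h6 : (y / A) ^ (2 * l) * ∫ x : Fin n → ℝ, (∑ j, ξ j (x j)) ^ (2 * l)
      ∂(Measure.pi (fun _ => ν)) ≤ ((2 * l : ℕ) : ℝ) ^ (2 * l) * Real.exp 1 ^ (2 * l) :=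
    h2.trans (mul_le_mul h4 (h3.trans h5) (by positivity) (by positivity))
  rw [← le_div_iff₀' (by positivity)] at h6
  refine h6.trans (le_of_eq ?_)
  rw [← mul_pow, ← div_pow]
  congr 1
  rw [hy]; push_cast; field_simp; ring

lemma epc_c {n l : ℕ} (hl : 1 ≤ l) (hln : l ≤ n) (ν : Measure ℝ) [IsProbabilityMeasure ν]
    (ξ : Fin n → ℝ → ℝ) (hintg : ∀ j k, Integrable (fun x => ξ j x ^ k) ν) (A : ℝ) (hA : 0 < A)
    (hξ0 : ∀ j, ∫ x, ξ j x ∂ν = 0)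
    (hξ : ∀ j k, k ≤ 2 * l → |∫ x, ξ j x ^ k ∂ν| ≤ (Nat.factorial k : ℝ) * A ^ k) :
    Integrable (fun x : Fin n → ℝ => (∑ j, ξ j (x j)) ^ (2 * l)) (Measure.pi (fun _ => ν)) ∧
    ∫ x : Fin n → ℝ, (∑ j, ξ j (x j)) ^ (2 * l) ∂(Measure.pi (fun _ => ν)) ≤
      (16 * Real.exp 1 * l * n * A ^ 2) ^ l := by
  have hl0 : (0 : ℝ) < l := by exact_mod_cast hl
  have hln' : (l : ℝ) ≤ n := by exact_mod_cast hln
  have hn0 : (0 : ℝ) < n := by linarith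
  set y : ℝ := Real.sqrt (l / (4 * n)) with hy
  have hyy : y ^ 2 = l / (4 * n) := Real.sq_sqrt (by positivity)
  have hy0 : 0 < y := Real.sqrt_pos.2 (by positivity)
  have hy1 : y ≤ 1 / 2 := by
    have : y ^ 2 ≤ (1 / 2) ^ 2 := by
      rw [hyy, div_le_iff₀ (by positivity)]; linarith
    exact le_of_sq_le_sq this (by norm_num)
  have h1 := epc_comb (N := 2 * l) ν (fun j x => (y / A) * ξ j x)
    (fun j k => by simp only [mul_pow]; exact (hintg j k).const_mul _)
    (fun k => if k = 1 then 0 else y ^ k)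
    (fun k => by split_ifs <;> positivity)
    (fun j k hk => by
      simp only [mul_pow]
      rw [integral_const_mul, abs_mul, abs_of_pos (by positivity)]
      split_ifs with h
      · subst h; simp [hξ0]
      refine (mul_le_mul_of_nonneg_left (hξ j k hk) (by positivity)).trans (le_of_eq ?_)
      rw [div_pow]; field_simp)
  have e1 : ∀ x : Fin n → ℝ, (∑ j, (y / A) * ξ j (x j)) ^ (2 * l) =
      (y / A) ^ (2 * l) * (∑ j, ξ j (x j)) ^ (2 * l) := fun x => by
    rw [← Finset.mul_sum, mul_pow]
  have hne : (y / A) ^ (2 * l) ≠ 0 := by positivity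
  simp only [e1] at h1
  refine ⟨(integrable_const_mul_iff (IsUnit.mk0 _ hne) _).1 h1.1, ?_⟩
  have h2 := h1.2
  rw [integral_const_mul] at h2
  have h3 : (∑ k ∈ Finset.range (2 * l + 1), if k = 1 then 0 else y ^ k) ^ n ≤ Real.exp 1 ^ l := by
    have : (∑ k ∈ Finset.range (2 * l + 1), if k = 1 then 0 else y ^ k) ≤
        Real.exp (2 * y ^ 2) := by
      obtain ⟨q, hq⟩ : ∃ q, 2 * l + 1 = q + 2 := ⟨2 * l - 1, by omega⟩
      rw [hq, Finset.sum_range_succ', Finset.sum_range_succ']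
      have h7 : ∀ k, (if k + 1 + 1 = 1 then 0 else y ^ (k + 1 + 1)) = y ^ 2 * y ^ k := fun k => by
        rw [if_neg (by omega)]; ring
      simp only [h7]
      rw [← Finset.mul_sum]
      have h8 := epc_geom q y hy0.le hy1
      have h9 : y ^ 2 * ∑ k ∈ Finset.range q, y ^ k ≤ y ^ 2 * 2 :=
        mul_le_mul_of_nonneg_left (by linarith) (by positivity)
      have := Real.add_one_le_exp (2 * y ^ 2)
      simp
      linarith
    refine (pow_le_pow_left₀ (Finset.sum_nonneg fun k _ => by split_ifs <;> positivity)
      this n).trans ?_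
    rw [← Real.exp_nat_mul, ← Real.exp_nat_mul]
    apply Real.exp_le_exp.2
    rw [hyy, show (n : ℝ) * (2 * (l / (4 * n))) = l / 2 by field_simp; norm_num]
    linarith
  have h4 : ((Nat.factorial (2 * l) : ℕ) : ℝ) ≤ ((2 * l : ℕ) : ℝ) ^ (2 * l) := by
    exact_mod_cast Nat.factorial_le_pow (2 * l)
  have h6 := h2.trans (mul_le_mul h4 h3
    (pow_nonneg (Finset.sum_nonneg fun k _ => by split_ifs <;> positivity) _) (by positivity))
  rw [← le_div_iff₀' (by positivity)] at h6
  refine h6.trans (le_of_eq ?_)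
  rw [pow_mul, pow_mul, ← mul_pow, ← div_pow, div_pow y A, hyy]
  congr 1
  push_cast; field_simp; ring


/-- constant in the moment bound -/
noncomputable def epcA (p : ℝ) (m : ℕ) : ℝ := epcK p * (m : ℝ) ^ ((m : ℝ) / 2) * Real.exp 1

lemma epcA_pos (p : ℝ) (hp : 2 ≤ p) (m : ℕ) (hm : 2 ≤ m) : 0 < epcA p m := by
  have := epcK_ge_one p hp
  have : (0 : ℝ) < m := by positivity
  unfold epcA
  positivity

lemma epc_moment_fact (p : ℝ) (hp : 2 ≤ p) (m : ℕ) (hm : 2 ≤ m) (s : ℝ) (hs : s = p * (m / 2))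
    (N k : ℕ) (hk : k ≤ N) :
    ∫ x, (|x| ^ s) ^ k ∂(epcNu p) ≤
      (Nat.factorial k : ℝ) * (epcA p m * (N : ℝ) ^ ((m : ℝ) / 2 - 1)) ^ k := by
  have := epcNu_prob p hp
  have hp0 : 0 < p := by linarith
  have hK := epcK_ge_one p hp
  have hm0 : (0 : ℝ) < m := by positivity
  have hm2 : (0 : ℝ) ≤ (m : ℝ) / 2 - 1 := by
    have : (2 : ℝ) ≤ m := by exact_mod_cast hm
    linarith
  rcases Nat.eq_zero_or_pos k with rfl | hk0
  · simp
  have hk0' : (0 : ℝ) < k := by exact_mod_cast hk0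
  have hs0 : 0 < s := by rw [hs]; positivity
  have h1 := (epcNu_moment p hp (s * k) (by positivity)).2
  have e1 : ∀ x : ℝ, |x| ^ (s * k) = (|x| ^ s) ^ k := fun x => by
    rw [Real.rpow_mul (abs_nonneg x), Real.rpow_natCast]
  simp only [e1] at h1
  refine h1.trans ?_
  have e2 : 2 * (s * k) / p = m * k := by rw [hs]; field_simp
  have e3 : s * k / p = (m : ℝ) / 2 * k := by rw [hs]; field_simp
  rw [e2, e3, Real.rpow_mul (by positivity), Real.rpow_natCast,
    Real.mul_rpow hm0.le hk0'.le]
  have e4 : (k : ℝ) ^ ((m : ℝ) / 2) ≤ k * (N : ℝ) ^ ((m : ℝ) / 2 - 1) := by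
    have : (k : ℝ) ^ ((m : ℝ) / 2) = k * (k : ℝ) ^ ((m : ℝ) / 2 - 1) := by
      rw [Real.rpow_sub_one hk0'.ne']; field_simp
    rw [this]
    exact mul_le_mul_of_nonneg_left
      (Real.rpow_le_rpow hk0'.le (by exact_mod_cast hk) hm2) hk0'.le
  have e5 : epcK p ≤ epcK p ^ k := le_self_pow₀ hK (by omega)
  have hN0 : (0 : ℝ) ≤ (N : ℝ) ^ ((m : ℝ) / 2 - 1) := by positivity
  calc epcK p * ((m : ℝ) ^ ((m : ℝ) / 2) * (k : ℝ) ^ ((m : ℝ) / 2)) ^ k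
      ≤ epcK p ^ k * ((m : ℝ) ^ ((m : ℝ) / 2) * (k * (N : ℝ) ^ ((m : ℝ) / 2 - 1))) ^ k := by
        gcongr
    _ = (epcK p * (m : ℝ) ^ ((m : ℝ) / 2) * (N : ℝ) ^ ((m : ℝ) / 2 - 1)) ^ k * (k : ℝ) ^ k := by
        simp only [mul_pow]; ring
    _ ≤ (epcK p * (m : ℝ) ^ ((m : ℝ) / 2) * (N : ℝ) ^ ((m : ℝ) / 2 - 1)) ^ k *
        (Real.exp 1 ^ k * (Nat.factorial k : ℝ)) :=
        mul_le_mul_of_nonneg_left (epc_pow_le_fact k) (by positivity)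
    _ = _ := by
        unfold epcA
        simp only [mul_pow]; ring

/-- the auxiliary sum `∑ |x_j|^s` -/
noncomputable def epcT (s : ℝ) {n : ℕ} (x : Fin n → ℝ) : ℝ := ∑ j, |x j| ^ s

lemma epcT_meas (s : ℝ) (n : ℕ) : Measurable (fun x : Fin n → ℝ => epcT s x) :=
  Finset.measurable_sum _ fun i _ => ((measurable_pi_apply i).abs).pow_const s

lemma epcT_nonneg (s : ℝ) {n : ℕ} (x : Fin n → ℝ) : 0 ≤ epcT s x := by
  unfold epcT; positivity

lemma epcT_le_one (p : ℝ) (hp : 2 ≤ p) (s : ℝ) (hs : p ≤ s) {n : ℕ} (x : Fin n → ℝ)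
    (hx : ∑ i, |x i| ^ p ≤ 1) : epcT s x ≤ 1 := by
  refine le_trans (Finset.sum_le_sum fun j _ => ?_) hx
  have h1 : |x j| ^ p ≤ 1 :=
    (Finset.single_le_sum (f := fun j => |x j| ^ p) (fun i _ => by positivity)
      (Finset.mem_univ j)).trans hx
  have h2 : |x j| ≤ 1 := by
    by_contra h
    push Not at h
    have := Real.one_lt_rpow h (by linarith : 0 < p)
    linarith
  exact Real.rpow_le_rpow_of_exponent_ge' (abs_nonneg _) h2 (by linarith) hs

/-- constant -/
noncomputable def epcB (p : ℝ) : ℝ := ∫ x, |x| ^ p ∂(epcNu p)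

lemma epc_T_moment (p : ℝ) (hp : 2 ≤ p) (m : ℕ) (hm : 2 ≤ m) (s : ℝ) (hs : s = p * (m / 2))
    (n l : ℕ) (hl : 1 ≤ l) (hln : l ≤ n) :
    ∫ θ : Fin n → ℝ, epcT s θ ^ (2 * l) ∂(coneMeasure p n) ≤
      ((4 * Real.exp 1 * epcA p m * 2 ^ ((m : ℝ) / 2 - 1) / epcB p ^ ((m : ℝ) / 2)) *
        ((l : ℝ) / n) ^ ((m : ℝ) / 2 - 1)) ^ (2 * l) := by
  have hn : 1 ≤ n := hl.trans hln
  have := epcNu_prob p hp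
  have := epc_cone_prob p hp n hn
  have hl0 : (0 : ℝ) < l := by exact_mod_cast hl
  have hn0 : (0 : ℝ) < n := by exact_mod_cast hn
  have hm2 : (1 : ℝ) ≤ (m : ℝ) / 2 := by
    have : (2 : ℝ) ≤ m := by exact_mod_cast hm
    linarith
  have hps : p ≤ s := by rw [hs]; nlinarith
  have hs0 : 0 < s := by linarith
  have hB : 0 < epcB p := epc_beta_pos p hp
  have hA := epcA_pos p hp m hm
  obtain ⟨hRi, hRl⟩ := epc_R p hp n m hm s hs
  set A : ℝ := epcA p m * ((2 * l : ℕ) : ℝ) ^ ((m : ℝ) / 2 - 1) with hAdef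
  have hA0 : 0 < A := by positivity
  obtain ⟨hi, hle⟩ := epc_nc (n := n) hl hln (epcNu p) (fun _ x => |x| ^ s)
    (fun _ k => epcNu_moment' p hp s hs0 k) A hA0 (fun j k hk => by
      rw [abs_of_nonneg (integral_nonneg fun x => by positivity)]
      exact epc_moment_fact p hp m hm s hs (2 * l) k hk)
  have hJ := (epc_J p hp n hn s (epcT s) (epcT_meas s n)
    (fun t ht x => by
      unfold epcT
      rw [Finset.mul_sum]
      refine Finset.sum_congr rfl fun j _ => ?_
      rw [Pi.smul_apply, smul_eq_mul, abs_mul, abs_of_nonneg ht,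
        Real.mul_rpow ht (abs_nonneg _)])
    (by
      filter_upwards [epc_cone_ae p hp n] with θ hθ
      rw [abs_of_nonneg (epcT_nonneg s θ)]
      exact epcT_le_one p hp s hps θ hθ) hRi _ rfl).2 0 l (by simpa [epcT] using hi)
  set R := ∫ x : Fin n → ℝ, lpNorm p x ^ s ∂(Measure.pi (fun _ => epcNu p)) with hRdef
  simp only [mul_zero, sub_zero] at hJ
  have hJ2 := hJ.trans hle
  simp only [abs_of_nonneg (epcT_nonneg s _)] at hJ2
  have hR0 : 0 < (n * epcB p) ^ ((m : ℝ) / 2) := by positivity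
  have hR1 : (n * epcB p) ^ ((m : ℝ) / 2) ≤ R := hRl
  have hT0 : 0 ≤ ∫ θ : Fin n → ℝ, epcT s θ ^ (2 * l) ∂(coneMeasure p n) :=
    integral_nonneg fun θ => pow_nonneg (epcT_nonneg s θ) _
  have h1 : ((n * epcB p) ^ ((m : ℝ) / 2)) ^ (2 * l) *
      ∫ θ : Fin n → ℝ, epcT s θ ^ (2 * l) ∂(coneMeasure p n) ≤
      (4 * Real.exp 1 * A * n) ^ (2 * l) :=
    (mul_le_mul_of_nonneg_right (pow_le_pow_left₀ hR0.le hR1 _) hT0).trans hJ2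
  rw [← le_div_iff₀' (by positivity), ← div_pow] at h1
  refine h1.trans (le_of_eq ?_)
  congr 1
  rw [hAdef, Real.mul_rpow hn0.le hB.le, Real.div_rpow hl0.le hn0.le]
  push_cast
  rw [Real.mul_rpow (by norm_num) hl0.le, Real.rpow_sub_one hn0.ne']
  field_simp

lemma epc_holder (p : ℝ) (hp : 2 ≤ p) (m : ℕ) (s : ℝ) (hs : s = p * (m / 2))
    (n : ℕ) (a : Fin n → ℝ) (h2 : p = 2 → ∀ j, |a j| ≤ 1)
    (h3 : p ≠ 2 → (∑ j, |a j| ^ (p / (p - 2))) ^ ((p - 2) / p) ≤ 1) (x : Fin n → ℝ) :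
    |∑ j, a j * x j ^ m| ≤ epcT s x ^ (2 / p) := by
  have h0 : |∑ j, a j * x j ^ m| ≤ ∑ j, |a j| * |x j| ^ m := by
    refine (Finset.abs_sum_le_sum_abs _ _).trans (le_of_eq ?_)
    refine Finset.sum_congr rfl fun j _ => ?_
    rw [abs_mul, abs_pow]
  refine h0.trans ?_
  have hp0 : 0 < p := by linarith
  rcases eq_or_ne p 2 with h | h
  · subst h
    rw [div_self (by norm_num), Real.rpow_one]
    unfold epcT
    refine Finset.sum_le_sum fun j _ => ?_
    rw [hs, show (2 : ℝ) * (m / 2) = m by ring, Real.rpow_natCast]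
    exact mul_le_of_le_one_left (by positivity) (h2 rfl j)
  · have hp2 : 0 < p - 2 := by
      have := lt_of_le_of_ne hp (Ne.symm h)
      linarith
    have hc : (p / (p - 2)).HolderConjugate (p / 2) := by
      rw [Real.holderConjugate_iff]
      refine ⟨?_, ?_⟩
      · rw [lt_div_iff₀ hp2]; linarith
      · rw [inv_div, inv_div]; field_simp; ring
    have hH := Real.inner_le_Lp_mul_Lq Finset.univ (fun j => |a j|) (fun j => |x j| ^ m) hc
    refine hH.trans ?_
    have e1 : (∑ j, |(|a j|)| ^ (p / (p - 2))) ^ (1 / (p / (p - 2))) ≤ 1 := by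
      simp only [abs_abs, one_div_div]
      exact h3 h
    have e2 : (∑ j, |(|x j| ^ m)| ^ (p / 2)) ^ (1 / (p / 2)) = epcT s x ^ (2 / p) := by
      rw [one_div_div]
      unfold epcT
      congr 1
      refine Finset.sum_congr rfl fun j _ => ?_
      rw [abs_of_nonneg (by positivity), ← Real.rpow_natCast, ← Real.rpow_mul (abs_nonneg _), hs]
      congr 1; ring
    rw [e2]
    exact mul_le_of_le_one_left (Real.rpow_nonneg (epcT_nonneg s x) _) e1


lemma epc_Q_meas (m n : ℕ) (a : Fin n → ℝ) :
    Measurable (fun x : Fin n → ℝ => ∑ j, a j * x j ^ m) :=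
  Finset.measurable_sum _ fun i _ => ((measurable_pi_apply i).pow_const m).const_mul _

/-- moments in the case `p > 2` (no cancellation needed) -/
lemma epc_mom_gt (p : ℝ) (hp : 2 ≤ p) (m : ℕ) (hm : 2 ≤ m)
    (n l : ℕ) (hl : 1 ≤ l) (hln : l ≤ n) (a : Fin n → ℝ) (h2 : p = 2 → ∀ j, |a j| ≤ 1)
    (h3 : p ≠ 2 → (∑ j, |a j| ^ (p / (p - 2))) ^ ((p - 2) / p) ≤ 1) :
    ∫ θ, |(∑ j, a j * θ j ^ m) - ∫ θ', (∑ j, a j * θ' j ^ m) ∂(coneMeasure p n)| ^ (2 * l)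
      ∂(coneMeasure p n) ≤
    ((2 * (4 * Real.exp 1 * epcA p m * 2 ^ ((m : ℝ) / 2 - 1) / epcB p ^ ((m : ℝ) / 2)) ^ (2 / p)) *
        ((l : ℝ) / n) ^ (((m : ℝ) - 2) / p)) ^ (2 * l) := by
  have hn : 1 ≤ n := hl.trans hln
  have := epc_cone_prob p hp n hn
  have hp0 : 0 < p := by linarith
  have hm2 : (1 : ℝ) ≤ (m : ℝ) / 2 := by
    have : (2 : ℝ) ≤ m := by exact_mod_cast hm
    linarith
  have hB : 0 < epcB p := epc_beta_pos p hp
  have hA := epcA_pos p hp m hm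
  set s : ℝ := p * (m / 2) with hs
  have hps : p ≤ s := by rw [hs]; nlinarith
  have hT := epc_T_moment p hp m hm s hs n l hl hln
  set C1 : ℝ := 4 * Real.exp 1 * epcA p m * 2 ^ ((m : ℝ) / 2 - 1) / epcB p ^ ((m : ℝ) / 2) with hC1
  have hC10 : 0 < C1 := by positivity
  set μ := coneMeasure p n with hμ
  set Q : (Fin n → ℝ) → ℝ := fun θ => ∑ j, a j * θ j ^ m with hQ
  have hQm : Measurable Q := epc_Q_meas m n a
  have hQT : ∀ x, |Q x| ≤ epcT s x ^ (2 / p) := epc_holder p hp m s hs n a h2 h3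
  have hT1 : ∀ᵐ θ ∂μ, epcT s θ ≤ 1 := by
    filter_upwards [epc_cone_ae p hp n] with θ hθ using epcT_le_one p hp s hps θ hθ
  have hTm := epcT_meas s n
  have hQ1 : ∀ᵐ θ ∂μ, |Q θ| ≤ 1 := by
    filter_upwards [hT1] with θ hθ
    exact (hQT θ).trans (Real.rpow_le_one (epcT_nonneg s θ) hθ (by positivity))
  have hQi : Integrable Q μ := Integrable.of_bound hQm.aestronglyMeasurable 1 hQ1
  have hQpi : Integrable (fun θ => |Q θ| ^ (2 * l)) μ := by
    refine Integrable.of_bound (hQm.abs.pow_const _).aestronglyMeasurable 1 ?_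
    filter_upwards [hQ1] with θ hθ
    rw [Real.norm_eq_abs, abs_of_nonneg (by positivity)]
    exact pow_le_one₀ (abs_nonneg _) hθ
  set v := ∫ θ, Q θ ∂μ with hv
  -- moment of |Q|
  have hmomQ : ∫ θ, |Q θ| ^ (2 * l) ∂μ ≤
      (C1 ^ (2 / p) * ((l : ℝ) / n) ^ (((m : ℝ) - 2) / p)) ^ (2 * l) := by
    set h : (Fin n → ℝ) → ℝ := fun θ => (epcT s θ ^ (2 * l)) ^ (2 / p) with hh
    have hhm : Measurable h := (hTm.pow_const (2 * l)).pow_const (2 / p)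
    have hT0 : ∀ θ : Fin n → ℝ, 0 ≤ epcT s θ ^ (2 * l) := fun θ => pow_nonneg (epcT_nonneg s θ) _
    have hh0 : ∀ θ, 0 ≤ h θ := fun θ => Real.rpow_nonneg (hT0 θ) _
    have hh1 : ∀ᵐ θ ∂μ, h θ ≤ 1 := by
      filter_upwards [hT1] with θ hθ
      exact Real.rpow_le_one (hT0 θ) (pow_le_one₀ (epcT_nonneg s θ) hθ) (by positivity)
    have hhi : Integrable h μ := by
      refine Integrable.of_bound hhm.aestronglyMeasurable 1 ?_
      filter_upwards [hh1] with θ hθ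
      rw [Real.norm_eq_abs, abs_of_nonneg (hh0 θ)]; exact hθ
    have h4 : ∫ θ, |Q θ| ^ (2 * l) ∂μ ≤ ∫ θ, h θ ∂μ := by
      refine integral_mono hQpi hhi fun θ => ?_
      refine (pow_le_pow_left₀ (abs_nonneg _) (hQT θ) _).trans (le_of_eq ?_)
      simp only [hh]
      rw [← Real.rpow_natCast, ← Real.rpow_natCast, ← Real.rpow_mul (epcT_nonneg s θ),
        ← Real.rpow_mul (epcT_nonneg s θ), mul_comm]
    have h5 := epc_pm μ h hhm hh0 hh1 (p / 2) (by linarith)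
    have h6 : ∀ θ, h θ ^ (p / 2) = epcT s θ ^ (2 * l) := fun θ => by
      simp only [hh]
      rw [← Real.rpow_mul (hT0 θ), show 2 / p * (p / 2) = 1 by field_simp, Real.rpow_one]
    simp only [h6, one_div_div] at h5
    refine h4.trans (h5.trans ?_)
    refine (Real.rpow_le_rpow (integral_nonneg hT0) hT (by positivity)).trans (le_of_eq ?_)
    have hx : 0 ≤ ((l : ℝ) / n) := by positivity
    have hsw : ∀ y : ℝ, 0 ≤ y → (y ^ (2 * l)) ^ (2 / p) = (y ^ (2 / p)) ^ (2 * l) := fun y hy => by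
      rw [← Real.rpow_natCast, ← Real.rpow_natCast, ← Real.rpow_mul hy, ← Real.rpow_mul hy,
        mul_comm]
    have he : ((m : ℝ) / 2 - 1) * (2 / p) = ((m : ℝ) - 2) / p := by field_simp
    rw [hsw _ (by positivity), Real.mul_rpow (by positivity) (by positivity),
      ← Real.rpow_mul hx, he]
  have hQpi' : Integrable (fun θ => Q θ ^ (2 * l)) μ := by
    simpa only [(even_two_mul l).pow_abs] using hQpi
  have hvle : |v| ^ (2 * l) ≤ ∫ θ, |Q θ| ^ (2 * l) ∂μ := by
    have hJ := ((even_two_mul l).convexOn_pow (𝕜 := ℝ)).map_integral_le (μ := μ)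
      (f := Q) (continuous_pow _).continuousOn isClosed_univ
      (Filter.Eventually.of_forall fun _ => Set.mem_univ _) hQi
      hQpi'
    simpa only [(even_two_mul l).pow_abs] using hJ
  have hpt : ∀ θ, |Q θ - v| ^ (2 * l) ≤ 2 ^ (2 * l - 1) * (|Q θ| ^ (2 * l) + |v| ^ (2 * l)) := by
    intro θ
    exact (pow_le_pow_left₀ (abs_nonneg _) (abs_sub _ _) _).trans
      (add_pow_le (abs_nonneg _) (abs_nonneg _) _)
  have hRi : Integrable (fun θ => (2 : ℝ) ^ (2 * l - 1) * (|Q θ| ^ (2 * l) + |v| ^ (2 * l))) μ :=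
    (hQpi.add (integrable_const _)).const_mul _
  have h7 : ∫ θ, |Q θ - v| ^ (2 * l) ∂μ ≤
      ∫ θ, (2 : ℝ) ^ (2 * l - 1) * (|Q θ| ^ (2 * l) + |v| ^ (2 * l)) ∂μ := by
    refine integral_mono_of_nonneg (Filter.Eventually.of_forall fun θ => ?_) hRi
      (Filter.Eventually.of_forall hpt)
    positivity
  rw [integral_const_mul, integral_add hQpi (integrable_const _)] at h7
  simp only [integral_const, probReal_univ, smul_eq_mul, one_mul] at h7
  refine h7.trans ?_
  have h8 : (2 : ℝ) ^ (2 * l) = 2 ^ (2 * l - 1) * 2 := by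
    rw [← pow_succ]; congr 1; omega
  rw [mul_assoc, mul_pow, h8, mul_assoc ((2 : ℝ) ^ (2 * l - 1))]
  exact mul_le_mul_of_nonneg_left (by linarith) (by positivity)

/-- moments in the case `p = 2` -/
lemma epc_mom_two (m : ℕ) (hm : 2 ≤ m)
    (n l : ℕ) (hl : 1 ≤ l) (hln : l ≤ n) (a : Fin n → ℝ) (h2 : ∀ j, |a j| ≤ 1) :
    ∫ θ, |(∑ j, a j * θ j ^ m) - ∫ θ', (∑ j, a j * θ' j ^ m) ∂(coneMeasure 2 n)| ^ (2 * l)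
      ∂(coneMeasure 2 n) ≤
    (Real.sqrt (64 * Real.exp 1 * epcA 2 m ^ 2 * (2 : ℝ) ^ ((m : ℝ) - 2) / epcB 2 ^ m) *
        ((l : ℝ) / n) ^ (((m : ℝ) - 1) / 2)) ^ (2 * l) := by
  have hp : (2 : ℝ) ≤ 2 := le_rfl
  have hn : 1 ≤ n := hl.trans hln
  have := epc_cone_prob 2 hp n hn
  have := epcNu_prob 2 hp
  have hl0 : (0 : ℝ) < l := by exact_mod_cast hl
  have hn0 : (0 : ℝ) < n := by exact_mod_cast hn
  have hm2 : (1 : ℝ) ≤ (m : ℝ) / 2 := by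
    have : (2 : ℝ) ≤ m := by exact_mod_cast hm
    linarith
  have hB : 0 < epcB 2 := epc_beta_pos 2 hp
  have hA := epcA_pos 2 hp m hm
  set s : ℝ := 2 * ((m : ℝ) / 2) with hs
  have hsm : s = m := by rw [hs]; ring
  have hs0 : 0 < s := by linarith
  have hps : 2 ≤ s := by linarith
  obtain ⟨hRi, hRl⟩ := epc_R 2 hp n m hm s hs
  set A : ℝ := epcA 2 m * ((2 * l : ℕ) : ℝ) ^ ((m : ℝ) / 2 - 1) with hAdef
  have hA0 : 0 < A := by positivity
  have habs : ∀ (x : ℝ), |x| ^ s = |x ^ m| := fun x => by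
    rw [hsm, Real.rpow_natCast, abs_pow]
  have hZi : ∀ k, Integrable (fun x : ℝ => |x ^ m| ^ k) (epcNu 2) := fun k => by
    simpa only [habs] using epcNu_moment' 2 hp s hs0 k
  have hZm : ∀ k, k ≤ 2 * l → ∫ x : ℝ, |x ^ m| ^ k ∂(epcNu 2) ≤ (Nat.factorial k : ℝ) * A ^ k := by
    intro k hk
    simpa only [habs] using epc_moment_fact 2 hp m hm s hs (2 * l) k hk
  have hmi : Integrable (fun x : ℝ => x ^ m) (epcNu 2) := by
    refine (hZi 1).mono' (by fun_prop) (Filter.Eventually.of_forall fun x => ?_)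
    rw [pow_one, Real.norm_eq_abs]
  set M := ∫ x : ℝ, x ^ m ∂(epcNu 2) with hM
  have hMA : |M| ≤ A := by
    have h1 := hZm 1 (by omega)
    simp only [pow_one, Nat.factorial_one, Nat.cast_one, one_mul] at h1
    exact (abs_integral_le_integral_abs).trans h1
  set ξ : Fin n → ℝ → ℝ := fun j x => a j * (x ^ m - M) with hξ
  have hdom : ∀ j k x, |ξ j x ^ k| ≤ 2 ^ (k - 1) * (|x ^ m| ^ k + |M| ^ k) := by
    intro j k x
    simp only [hξ]
    rw [abs_pow, abs_mul]
    have h1 : |a j| * |x ^ m - M| ≤ |x ^ m| + |M| :=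
      (mul_le_of_le_one_left (abs_nonneg _) (h2 j)).trans (abs_sub _ _)
    exact (pow_le_pow_left₀ (by positivity) h1 _).trans
      (add_pow_le (abs_nonneg _) (abs_nonneg _) _)
  have hdomi : ∀ k : ℕ, Integrable (fun x : ℝ => (2 : ℝ) ^ (k - 1) * (|x ^ m| ^ k + |M| ^ k))
      (epcNu 2) := fun k => ((hZi k).add (integrable_const _)).const_mul _
  have hξi : ∀ j k, Integrable (fun x => ξ j x ^ k) (epcNu 2) := fun j k =>
    (hdomi k).mono' (by simp only [hξ]; fun_prop) (Filter.Eventually.of_forall (hdom j k))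
  have hξ0 : ∀ j, ∫ x, ξ j x ∂(epcNu 2) = 0 := fun j => by
    simp only [hξ]
    rw [integral_const_mul, integral_sub hmi (integrable_const _)]
    simp [hM]
  have hξb : ∀ j k, k ≤ 2 * l → |∫ x, ξ j x ^ k ∂(epcNu 2)| ≤
      (Nat.factorial k : ℝ) * (2 * A) ^ k := by
    intro j k hk
    rcases Nat.eq_zero_or_pos k with rfl | hk0
    · simp
    refine (abs_integral_le_integral_abs).trans ?_
    refine (integral_mono (hξi j k).abs (hdomi k) (hdom j k)).trans ?_
    rw [integral_const_mul, integral_add (hZi k) (integrable_const _)]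
    simp only [integral_const, probReal_univ, smul_eq_mul, one_mul]
    have h4 : |M| ^ k ≤ (Nat.factorial k : ℝ) * A ^ k := by
      refine (pow_le_pow_left₀ (abs_nonneg _) hMA k).trans ?_
      refine le_mul_of_one_le_left (by positivity) ?_
      exact_mod_cast Nat.factorial_pos k
    have h8 : (2 : ℝ) ^ k = 2 ^ (k - 1) * 2 := by
      rw [← pow_succ]; congr 1; omega
    rw [mul_pow, h8, show (Nat.factorial k : ℝ) * ((2 : ℝ) ^ (k - 1) * 2 * A ^ k) =
      2 ^ (k - 1) * (2 * ((Nat.factorial k : ℝ) * A ^ k)) by ring]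
    exact mul_le_mul_of_nonneg_left (by linarith [hZm k hk]) (by positivity)
  obtain ⟨hi, hle⟩ := epc_c (n := n) hl hln (epcNu 2) ξ hξi (2 * A) (by positivity) hξ0 hξb
  set Q : (Fin n → ℝ) → ℝ := fun θ => ∑ j, a j * θ j ^ m with hQ
  have hQm : Measurable Q := epc_Q_meas m n a
  have hQ1 : ∀ᵐ θ ∂(coneMeasure 2 n), |Q θ| ≤ 1 := by
    filter_upwards [epc_cone_ae 2 hp n] with θ hθ
    have h5 := epc_holder 2 hp m s hs n a (fun _ => h2) (fun h => absurd rfl h) θ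
    rw [div_self (by norm_num), Real.rpow_one] at h5
    exact h5.trans (epcT_le_one 2 hp s hps θ hθ)
  obtain ⟨hJ1, hJ2⟩ := epc_J 2 hp n hn s Q hQm
    (fun t ht x => by
      simp only [hQ]
      rw [Finset.mul_sum]
      refine Finset.sum_congr rfl fun j _ => ?_
      rw [Pi.smul_apply, smul_eq_mul, hsm, Real.rpow_natCast, mul_pow]; ring) hQ1 hRi _ rfl
  set R := ∫ x : Fin n → ℝ, lpNorm 2 x ^ s ∂(Measure.pi (fun _ => epcNu 2)) with hRdef
  set v := ∫ θ, Q θ ∂(coneMeasure 2 n) with hv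
  have hEQ : R * v = ∑ j, a j * M := by
    rw [← hJ1]
    simp only [hQ]
    have h6 : ∀ i : Fin n, Integrable (fun x : Fin n → ℝ => x i ^ m)
        (Measure.pi (fun _ => epcNu 2)) := fun i =>
      integrable_comp_eval (μ := fun _ : Fin n => epcNu 2) (i := i) (f := fun y : ℝ => y ^ m) hmi
    rw [integral_finsetSum _ fun i _ => (h6 i).const_mul _]
    refine Finset.sum_congr rfl fun j _ => ?_
    rw [integral_const_mul]
    congr 1
    exact integral_comp_eval (μ := fun _ : Fin n => epcNu 2) (i := j) (f := fun y : ℝ => y ^ m)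
      hmi.aestronglyMeasurable
  have hQξ : ∀ x : Fin n → ℝ, Q x - R * v = ∑ j, ξ j (x j) := fun x => by
    rw [hEQ, hQ, ← Finset.sum_sub_distrib]
    refine Finset.sum_congr rfl fun j _ => ?_
    simp only [hξ]; ring
  have hJ3 := hJ2 v l (by simpa only [hQξ] using hi)
  simp only [hQξ] at hJ3
  have hJ4 := hJ3.trans hle
  have hR0 : 0 < (n * epcB 2) ^ ((m : ℝ) / 2) := by positivity
  have hR1 : (n * epcB 2) ^ ((m : ℝ) / 2) ≤ R := hRl
  have hT0 : 0 ≤ ∫ θ, |Q θ - v| ^ (2 * l) ∂(coneMeasure 2 n) :=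
    integral_nonneg fun θ => by positivity
  have h1 := (mul_le_mul_of_nonneg_right (pow_le_pow_left₀ hR0.le hR1 (2 * l)) hT0).trans hJ4
  rw [← le_div_iff₀' (by positivity), pow_mul, ← div_pow] at h1
  refine h1.trans (le_of_eq ?_)
  rw [pow_mul]
  congr 1
  have hx : 0 ≤ (l : ℝ) / n := by positivity
  have sq : ∀ (y z : ℝ), 0 ≤ y → (y ^ z) ^ 2 = y ^ (z * 2) := fun y z hy => by
    rw [← Real.rpow_natCast, ← Real.rpow_mul hy]; norm_num
  have e1 : A ^ 2 = epcA 2 m ^ 2 * ((2 : ℝ) ^ ((m : ℝ) - 2) * (l ^ m / l / l)) := by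
    rw [hAdef, mul_pow, sq _ _ (by positivity), show ((m : ℝ) / 2 - 1) * 2 = m - 2 by ring]
    push_cast
    rw [Real.mul_rpow (by norm_num) hl0.le]
    congr 2
    rw [show (m : ℝ) - 2 = m - 1 - 1 by ring, Real.rpow_sub_one hl0.ne', Real.rpow_sub_one hl0.ne',
      Real.rpow_natCast]
  have e2 : ((n * epcB 2) ^ ((m : ℝ) / 2)) ^ 2 = n ^ m * epcB 2 ^ m := by
    rw [sq _ _ (by positivity), show (m : ℝ) / 2 * 2 = m by ring, Real.rpow_natCast, mul_pow]
  have e3 : (((l : ℝ) / n) ^ (((m : ℝ) - 1) / 2)) ^ 2 = (l ^ m / l) / (n ^ m / n) := by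
    rw [sq _ _ hx, show ((m : ℝ) - 1) / 2 * 2 = m - 1 by ring, Real.div_rpow hl0.le hn0.le,
      Real.rpow_sub_one hl0.ne', Real.rpow_sub_one hn0.ne', Real.rpow_natCast, Real.rpow_natCast]
  rw [mul_pow (Real.sqrt _), Real.sq_sqrt (by positivity), e2, e3, mul_pow 2 A, e1]
  field_simp
  ring

/-- Proposition 5.2: concentration of elementary polynomials `Q_m(θ) = ∑_j a_j θ_j^m` on
the `ℓ_p`-sphere under the cone measure, with a constant depending only on `m` and `p`.
The coefficient condition is `|a|_{p/(p-2)} ≤ 1`, interpreted as `max_j |a_j| ≤ 1`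
when `p = 2`. -/
theorem elementary_polynomial_concentration (p : ℝ) (hp : 2 ≤ p) (m : ℕ)
    (hm : p < (m : ℝ)) :
    ∃ c : ℝ, 0 < c ∧
      ∀ (n : ℕ), 3 ≤ n →
      ∀ a : Fin n → ℝ,
        (p = 2 → ∀ j, |a j| ≤ 1) →
        (p ≠ 2 → (∑ j, |a j| ^ (p / (p - 2))) ^ ((p - 2) / p) ≤ 1) →
        ∫ θ, Real.exp (c * n *
            |(∑ j, a j * θ j ^ m) -
              ∫ θ', (∑ j, a j * θ' j ^ m) ∂(coneMeasure p n)| ^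
              (p / ((m : ℝ) - ⌈p⌉₊ + 1))) ∂(coneMeasure p n) ≤ 2 := by
  have hp0 : 0 < p := by linarith
  have hm2' : 2 < m := by
    have : (2 : ℝ) < m := by linarith
    exact_mod_cast this
  have hm2 : 2 ≤ m := hm2'.le
  have hm3 : (3 : ℝ) ≤ m := by exact_mod_cast hm2'
  have hceil : ⌈p⌉₊ ≤ m := Nat.ceil_le.2 hm.le
  have hceil' : (⌈p⌉₊ : ℝ) ≤ m := by exact_mod_cast hceil
  obtain ⟨κ, C, hκ, hα, hC, hmom⟩ : ∃ κ C : ℝ, 0 < κ ∧ 1 ≤ κ * (p / ((m : ℝ) - ⌈p⌉₊ + 1)) ∧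
      1 ≤ C ∧ ∀ (n l : ℕ), 1 ≤ l → l ≤ n → ∀ a : Fin n → ℝ, (p = 2 → ∀ j, |a j| ≤ 1) →
        (p ≠ 2 → (∑ j, |a j| ^ (p / (p - 2))) ^ ((p - 2) / p) ≤ 1) →
        ∫ θ, |(∑ j, a j * θ j ^ m) - ∫ θ', (∑ j, a j * θ' j ^ m) ∂(coneMeasure p n)| ^ (2 * l)
          ∂(coneMeasure p n) ≤ (C * ((l : ℝ) / n) ^ κ) ^ (2 * l) := by
    rcases eq_or_ne p 2 with h | h
    · subst h
      set C0 := Real.sqrt (64 * Real.exp 1 * epcA 2 m ^ 2 * (2 : ℝ) ^ ((m : ℝ) - 2) / epcB 2 ^ m)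
        with hC0
      have hC00 : 0 ≤ C0 := Real.sqrt_nonneg _
      refine ⟨((m : ℝ) - 1) / 2, max 1 C0, by linarith, ?_, le_max_left _ _, ?_⟩
      · have : ⌈(2 : ℝ)⌉₊ = 2 := by exact_mod_cast Nat.ceil_natCast (R := ℝ) 2
        rw [this]
        push_cast
        rw [← mul_div_assoc, le_div_iff₀ (by linarith)]
        linarith
      · intro n l hl hln a h2 _
        refine (epc_mom_two m hm2 n l hl hln a (h2 rfl)).trans ?_
        refine pow_le_pow_left₀ (by positivity) ?_ _
        exact mul_le_mul_of_nonneg_right (le_max_right _ _) (by positivity)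
    · have hp2 : 2 < p := lt_of_le_of_ne hp (Ne.symm h)
      have hB : 0 < epcB p := epc_beta_pos p hp
      have hA := epcA_pos p hp m hm2
      set C0 := 2 * (4 * Real.exp 1 * epcA p m * 2 ^ ((m : ℝ) / 2 - 1) /
        epcB p ^ ((m : ℝ) / 2)) ^ (2 / p) with hC0
      have hC00 : 0 ≤ C0 := by positivity
      refine ⟨((m : ℝ) - 2) / p, max 1 C0, div_pos (by linarith) hp0, ?_, le_max_left _ _, ?_⟩
      · have h3 : 3 ≤ ⌈p⌉₊ := by
          have : 2 < ⌈p⌉₊ := Nat.lt_ceil.2 (by exact_mod_cast hp2)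
          omega
        have h3' : (3 : ℝ) ≤ ⌈p⌉₊ := by exact_mod_cast h3
        rw [div_mul_div_cancel₀ hp0.ne', le_div_iff₀ (by linarith)]
        linarith
      · intro n l hl hln a h2 h3
        refine (epc_mom_gt p hp m hm2 n l hl hln a h2 h3).trans ?_
        refine pow_le_pow_left₀ (by positivity) ?_ _
        exact mul_le_mul_of_nonneg_right (le_max_right _ _) (by positivity)
  obtain ⟨c, hc, hfin⟩ := epc_final κ (p / ((m : ℝ) - ⌈p⌉₊ + 1)) C hκ hα hC
  refine ⟨c, hc, fun n hn a h2 h3 => ?_⟩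
  have hn1 : 1 ≤ n := by omega
  have := epc_cone_prob p hp n hn1
  have hQm := epc_Q_meas m n a
  have hQ1 : ∀ᵐ θ ∂(coneMeasure p n), |∑ j, a j * θ j ^ m| ≤ 1 := by
    filter_upwards [epc_cone_ae p hp n] with θ hθ
    have h5 := epc_holder p hp m _ rfl n a h2 h3 θ
    refine h5.trans (Real.rpow_le_one (epcT_nonneg _ θ) ?_ (by positivity))
    refine epcT_le_one p hp _ ?_ θ hθ
    nlinarith
  have hv : |∫ θ', (∑ j, a j * θ' j ^ m) ∂(coneMeasure p n)| ≤ 1 := by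
    have h6 := norm_integral_le_of_norm_le_const (μ := coneMeasure p n) (C := 1)
      (f := fun θ : Fin n → ℝ => ∑ j, a j * θ j ^ m) hQ1
    simpa using h6
  refine hfin (coneMeasure p n) (fun θ => (∑ j, a j * θ j ^ m) -
    ∫ θ', (∑ j, a j * θ' j ^ m) ∂(coneMeasure p n)) n hn1 (hQm.sub_const _) ?_
    (fun l hl hln => hmom n l hl hln a h2 h3)
  filter_upwards [hQ1] with θ hθ
  exact (abs_sub _ _).trans (by linarith)
end
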